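/- arXiv:math/0403502 — 3 statements merged into one kernel-verified Lean document; each statement's English description precedes it below -/
import Mathlib

section
/- Let k ≥ 4 and let q_k be the pattern of length k given by 1, 2, …, (k−3), (k−1), k, (k−2) (so q_4 = 1342 and q_5 = 12453). Then the sequence (S_n(q_k))^{1/n} converges, as n → ∞, to (k − 4 + √8)². -/
/-- A permutation `p` of length `n` contains the pattern `q` of length `k`:
there are positions `f 0 < f 1 < … < f (k-1)` whose values are order-isomorphic to `q`. -/
def PermContains {n k : ℕ} (p : Equiv.Perm (Fin n)) (q : Equiv.Perm (Fin k)) : Prop :=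
  ∃ f : Fin k → Fin n, StrictMono f ∧ ∀ a b : Fin k, p (f a) < p (f b) ↔ q a < q b

/-- `p` avoids the pattern `q`. -/
def PermAvoids {n k : ℕ} (p : Equiv.Perm (Fin n)) (q : Equiv.Perm (Fin k)) : Prop :=
  ¬ PermContains p q

/-- `avoiders n q` is `S_n(q)`, the number of permutations of length `n` avoiding `q`. -/
noncomputable def avoiders (n : ℕ) {k : ℕ} (q : Equiv.Perm (Fin k)) : ℕ :=
  Nat.card {p : Equiv.Perm (Fin n) // PermAvoids p q}

/-- The pattern 12453 (0-indexed: 0,1,3,4,2). -/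
def pat12453 : Equiv.Perm (Fin 5) :=
  ⟨![0, 1, 3, 4, 2], ![0, 1, 4, 2, 3], by decide, by decide⟩

/-- `p i` is a left-to-right minimum of `p`: every earlier entry is larger. -/
def IsLtrMin {n : ℕ} (p : Equiv.Perm (Fin n)) (i : Fin n) : Prop :=
  ∀ j : Fin n, j < i → p i < p j

/-- The sequence `s` contains the pattern `q` using only positions satisfying `P`:
there is a subsequence, supported on positions satisfying `P`, order-isomorphic to `q`.
Taking `P := fun _ => True` gives ordinary pattern containment in the sequence `s`;
taking `P i := ¬ IsLtrMin p i` and `s := p` gives pattern containment in the string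
of remaining entries of a permutation `p`. -/
def ContainsOn {α : Type*} [LinearOrder α] {m k : ℕ} (s : Fin m → α)
    (P : Fin m → Prop) (q : Equiv.Perm (Fin k)) : Prop :=
  ∃ f : Fin k → Fin m, StrictMono f ∧ (∀ a : Fin k, P (f a)) ∧
    ∀ a b : Fin k, s (f a) < s (f b) ↔ q a < q b

/-- A pattern `q` of length `k` is indecomposable if it cannot be cut into two parts
so that all entries before the cut are larger than all entries after the cut:
there is no `r` with `1 ≤ r < k` such that the first `r` positions carry exactly
the top `r` values `{k-r, …, k-1}` (0-indexed). -/
def Indecomposable {k : ℕ} (q : Equiv.Perm (Fin k)) : Prop :=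
  ¬ ∃ r : ℕ, 1 ≤ r ∧ r < k ∧ ∀ i : Fin k, ((i : ℕ) < r ↔ k - r ≤ (q i : ℕ))

/-- A pattern `q` is layered: positions can be labelled by a monotone block function `b`
(whose fibers are then consecutive intervals, the layers) such that `q` is decreasing
within each layer and entries in earlier layers are smaller than those in later layers,
i.e. for `i < j`, `q j < q i` exactly when `i` and `j` are in the same layer. -/
def Layered {k : ℕ} (q : Equiv.Perm (Fin k)) : Prop :=
  ∃ b : Fin k → ℕ, Monotone b ∧ ∀ i j : Fin k, i < j → (q j < q i ↔ b i = b j)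

namespace StanleyWilf

/-- Occurrence of the pattern `Q`, given by its sequence of values, among the entries of `p`
at positions satisfying `P`. -/
def Occurs {n k : ℕ} (p : Equiv.Perm (Fin n)) (P : Fin n → Prop) (Q : Fin k → ℕ) : Prop :=
  ∃ f : Fin k → Fin n, StrictMono f ∧ (∀ a, P (f a)) ∧
    ∀ a b, p (f a) < p (f b) ↔ Q a < Q b

/-- The pattern `1 ⊕ Q`. -/
def oneSum {k : ℕ} (Q : Fin k → ℕ) : Fin (k + 1) → ℕ :=
  Fin.cons 0 fun i => Q i + 1

/-- The number of permutations of length `n` avoiding `Q`. -/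
noncomputable def avoidCount (n : ℕ) {k : ℕ} (Q : Fin k → ℕ) : ℕ :=
  Nat.card {p : Equiv.Perm (Fin n) // ¬ Occurs p (fun _ => True) Q}

theorem Occurs.mono {n k : ℕ} {p : Equiv.Perm (Fin n)} {P P' : Fin n → Prop} {Q : Fin k → ℕ}
    (h : Occurs p P Q) (hP : ∀ i, P i → P' i) : Occurs p P' Q := by
  obtain ⟨f, hf, hfP, hfQ⟩ := h
  exact ⟨f, hf, fun a => hP _ (hfP a), hfQ⟩

theorem occurs_oneSum_imp {n k : ℕ} {p : Equiv.Perm (Fin n)} {Q : Fin k → ℕ}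
    (h : Occurs p (fun _ => True) (oneSum Q)) : Occurs p (fun i => ¬ IsLtrMin p i) Q := by
  obtain ⟨f, hf, -, hQ⟩ := h
  refine ⟨fun a => f a.succ, hf.comp Fin.strictMono_succ, fun a hmin => ?_, fun a b => ?_⟩
  · have h1 := hmin (f 0) (hf (Fin.succ_pos a))
    have h2 := (hQ 0 a.succ).2 (by simp [oneSum])
    exact absurd h1 (not_lt.2 h2.le)
  · rw [hQ]; simp [oneSum]

theorem occurs_oneSum_of {n k : ℕ} {p : Equiv.Perm (Fin n)} {Q : Fin (k + 1) → ℕ}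
    (hQ0 : ∀ a, a ≠ 0 → Q 0 < Q a)
    (h : Occurs p (fun i => ¬ IsLtrMin p i) Q) : Occurs p (fun _ => True) (oneSum Q) := by
  obtain ⟨f, hf, hm, hQ⟩ := h
  have h0 := hm 0
  simp only [IsLtrMin, not_forall, not_lt] at h0
  obtain ⟨j, hj, hpj⟩ := h0
  have hpj' : p j < p (f 0) := lt_of_le_of_ne hpj fun h => hj.ne (p.injective h)
  have hall : ∀ a, p j < p (f a) := fun a => by
    rcases eq_or_ne a 0 with rfl | ha
    · exact hpj'
    · exact hpj'.trans ((hQ 0 a).2 (hQ0 a ha))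
  refine ⟨Fin.cons j f, ?_, fun _ => trivial, fun a b => ?_⟩
  · intro a b
    refine Fin.cases ?_ (fun a' => ?_) a <;> refine Fin.cases ?_ (fun b' => ?_) b
    · simp
    · exact fun _ => by simpa using hj.trans_le (hf.monotone (Fin.zero_le _))
    · simp
    · simpa using fun h => hf h
  · refine Fin.cases ?_ (fun a' => ?_) a <;> refine Fin.cases ?_ (fun b' => ?_) b
    · simp
    · simp [oneSum, hall]
    · simp [oneSum, (hall a').le]
    · simp [oneSum, hQ]

theorem avoidCount_pos (n : ℕ) {k : ℕ} {Q : Fin (k + 2) → ℕ}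
    (hQ0 : ∀ a, a ≠ 0 → Q 0 < Q a) : 0 < avoidCount n Q := by
  have : Nonempty {p : Equiv.Perm (Fin n) // ¬ Occurs p (fun _ => True) Q} := by
    refine ⟨⟨Fin.revPerm, ?_⟩⟩
    rintro ⟨f, hf, -, hQ⟩
    have h1 := (hQ 0 1).2 (hQ0 1 (by simp))
    have h2 : f 0 < f 1 := hf (by simp)
    simp only [Fin.revPerm_apply, Fin.rev_lt_rev] at h1
    exact absurd h1 (not_lt.2 h2.le)
  exact Nat.card_pos

/-- The skew sum of two permutations. -/
def skewSum {m n : ℕ} (p : Equiv.Perm (Fin m)) (r : Equiv.Perm (Fin n)) :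
    Equiv.Perm (Fin (m + n)) :=
  finSumFinEquiv.symm.trans <| (Equiv.sumCongr p r).trans <| (Equiv.sumComm _ _).trans <|
    finSumFinEquiv.trans (finCongr (Nat.add_comm n m))

theorem skewSum_left {m n : ℕ} (p : Equiv.Perm (Fin m)) (r : Equiv.Perm (Fin n)) (i : Fin m) :
    (skewSum p r (Fin.castAdd n i) : ℕ) = n + p i := by
  simp [skewSum, Nat.add_comm]

theorem skewSum_right {m n : ℕ} (p : Equiv.Perm (Fin m)) (r : Equiv.Perm (Fin n)) (i : Fin n) :
    (skewSum p r (Fin.natAdd m i) : ℕ) = r i := by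
  simp [skewSum]

/-- An occurrence of a pattern starting with its minimum lies on one side of any cut of the
positions such that the entries before the cut exceed those after it. -/
theorem occurs_split {n k : ℕ} {p : Equiv.Perm (Fin n)} {P : Fin n → Prop} {Q : Fin (k + 1) → ℕ}
    (hQ0 : ∀ a, a ≠ 0 → Q 0 < Q a) (m : ℕ)
    (hcut : ∀ i j : Fin n, P i → P j → (i : ℕ) < m → m ≤ (j : ℕ) → p j < p i)
    (h : Occurs p P Q) :
    Occurs p (fun i => P i ∧ (i : ℕ) < m) Q ∨ Occurs p (fun i => P i ∧ m ≤ (i : ℕ)) Q := by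
  obtain ⟨f, hf, hP, hQ⟩ := h
  rcases lt_or_ge (f 0 : ℕ) m with h0 | h0
  · refine Or.inl ⟨f, hf, fun a => ⟨hP a, ?_⟩, hQ⟩
    by_contra hge
    have ha : a ≠ 0 := by rintro rfl; exact hge h0
    have h1 := hcut _ _ (hP 0) (hP a) h0 (not_lt.1 hge)
    exact absurd h1 (not_lt.2 ((hQ 0 a).2 (hQ0 a ha)).le)
  · exact Or.inr ⟨f, hf, fun a => ⟨hP a, h0.trans (hf.monotone (Fin.zero_le a))⟩, hQ⟩

/-- Transport of an occurrence along an order-preserving map of positions. -/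
theorem Occurs.transport {n n' k : ℕ} {p : Equiv.Perm (Fin n)} {p' : Equiv.Perm (Fin n')}
    {P : Fin n → Prop} {P' : Fin n' → Prop} {Q : Fin k → ℕ} (e : Fin n' → Fin n)
    (he : StrictMono e) (hpe : ∀ i j, p' i < p' j ↔ p (e i) < p (e j))
    (hP : ∀ i, P i → ∃ i', e i' = i ∧ P' i') (h : Occurs p P Q) : Occurs p' P' Q := by
  obtain ⟨f, hf, hfP, hfQ⟩ := h
  choose g hg hgP using fun a => hP _ (hfP a)
  refine ⟨g, fun a b hab => ?_, hgP, fun a b => ?_⟩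
  · rw [← he.lt_iff_lt, hg, hg]; exact hf hab
  · rw [hpe, hg, hg, hfQ]

theorem skewSum_avoids {m n k : ℕ} {p : Equiv.Perm (Fin m)} {r : Equiv.Perm (Fin n)}
    {Q : Fin (k + 1) → ℕ} (hQ0 : ∀ a, a ≠ 0 → Q 0 < Q a)
    (hp : ¬ Occurs p (fun _ => True) Q) (hr : ¬ Occurs r (fun _ => True) Q) :
    ¬ Occurs (skewSum p r) (fun _ => True) Q := by
  intro h
  have hcut : ∀ i j : Fin (m + n), True → True → (i : ℕ) < m → m ≤ (j : ℕ) →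
      skewSum p r j < skewSum p r i := by
    intro i j _ _ hi hj
    obtain ⟨i', rfl⟩ : ∃ i', i = Fin.castAdd n i' := ⟨⟨i, hi⟩, Fin.ext rfl⟩
    obtain ⟨j', rfl⟩ : ∃ j', j = Fin.natAdd m j' := ⟨⟨j - m, by omega⟩, Fin.ext (by simp; omega)⟩
    rw [Fin.lt_def, skewSum_left, skewSum_right]
    omega
  rcases occurs_split hQ0 m hcut h with h | h
  · refine hp (h.transport (Fin.castAdd n) (Fin.strictMono_castAdd n) (fun i j => ?_) ?_)
    · rw [Fin.lt_def, Fin.lt_def, skewSum_left, skewSum_left]; omega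
    · rintro i ⟨-, hi⟩
      exact ⟨⟨i, hi⟩, Fin.ext rfl, trivial⟩
  · refine hr (h.transport (Fin.natAdd m) (Fin.strictMono_natAdd m) (fun i j => ?_) ?_)
    · rw [Fin.lt_def, Fin.lt_def, skewSum_right, skewSum_right]
    · rintro i ⟨-, hi⟩
      exact ⟨⟨i - m, by omega⟩, Fin.ext (by simp; omega), trivial⟩

theorem avoidCount_mul_le {k : ℕ} {Q : Fin (k + 1) → ℕ} (hQ0 : ∀ a, a ≠ 0 → Q 0 < Q a)
    (m n : ℕ) : avoidCount m Q * avoidCount n Q ≤ avoidCount (m + n) Q := by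
  rw [avoidCount, avoidCount, ← Nat.card_prod]
  refine Nat.card_le_card_of_injective
    (fun x => ⟨skewSum x.1.1 x.2.1, skewSum_avoids hQ0 x.1.2 x.2.2⟩) ?_
  rintro ⟨⟨p, hp⟩, ⟨r, hr⟩⟩ ⟨⟨p', hp'⟩, ⟨r', hr'⟩⟩ h
  simp only [Subtype.mk.injEq] at h
  simp only [Prod.mk.injEq, Subtype.mk.injEq]
  constructor
  · ext i
    have := skewSum_left p r i
    rw [h, skewSum_left] at this
    omega
  · ext i
    have := skewSum_right p r i
    rw [h, skewSum_right] at this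
    omega

end StanleyWilf

namespace StanleyWilf

/-- The permutation equal to `τ` from the positions in `A` to the values in `B`, and decreasing
elsewhere. -/
def mergeDecreasing {n m l : ℕ} {A B : Finset (Fin n)} (hA : A.card = m) (hA' : Aᶜ.card = l)
    (hB : B.card = m) (hB' : Bᶜ.card = l) (τ : Equiv.Perm (Fin m)) : Equiv.Perm (Fin n) :=
  (finSumEquivOfFinset hA hA').symm.trans <|
    (Equiv.sumCongr τ Fin.revPerm).trans (finSumEquivOfFinset hB hB')

theorem mergeDecreasing_inl {n m l : ℕ} {A B : Finset (Fin n)} (hA : A.card = m)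
    (hA' : Aᶜ.card = l) (hB : B.card = m) (hB' : Bᶜ.card = l) (τ : Equiv.Perm (Fin m))
    (i : Fin m) : mergeDecreasing hA hA' hB hB' τ (A.orderEmbOfFin hA i) =
      B.orderEmbOfFin hB (τ i) := by
  rw [← finSumEquivOfFinset_inl hA hA', ← finSumEquivOfFinset_inl hB hB']
  simp only [mergeDecreasing, Equiv.trans_apply, Equiv.symm_apply_apply, Equiv.sumCongr_apply,
    Sum.map_inl]

theorem mergeDecreasing_inr {n m l : ℕ} {A B : Finset (Fin n)} (hA : A.card = m)
    (hA' : Aᶜ.card = l) (hB : B.card = m) (hB' : Bᶜ.card = l) (τ : Equiv.Perm (Fin m))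
    (j : Fin l) : mergeDecreasing hA hA' hB hB' τ (Aᶜ.orderEmbOfFin hA' j) =
      Bᶜ.orderEmbOfFin hB' j.rev := by
  rw [← finSumEquivOfFinset_inr hA hA', ← finSumEquivOfFinset_inr hB hB']
  simp only [mergeDecreasing, Equiv.trans_apply, Equiv.symm_apply_apply, Equiv.sumCongr_apply,
    Sum.map_inr, Fin.revPerm_apply]

theorem strictAnti_ltrMin {n : ℕ} (p : Equiv.Perm (Fin n)) {i j : Fin n} (hj : IsLtrMin p j)
    (hij : i < j) : p j < p i :=
  hj i hij


theorem exists_mergeDecreasing {n k : ℕ} {Q : Fin k → ℕ} (p : Equiv.Perm (Fin n))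
    (hp : ¬ Occurs p (fun i => ¬ IsLtrMin p i) Q) :
    ∃ (m : ℕ) (_ : m < n + 1) (A B : Finset (Fin n)) (hA : A.card = m) (hB : B.card = m)
      (τ : Equiv.Perm (Fin m)), ¬ Occurs τ (fun _ => True) Q ∧
      mergeDecreasing (l := n - m) hA (by rw [Finset.card_compl, Fintype.card_fin, hA]) hB
        (by rw [Finset.card_compl, Fintype.card_fin, hB]) τ =
        p := by
  have : DecidablePred fun i => ¬ IsLtrMin p i := Classical.decPred _
  set A : Finset (Fin n) := Finset.univ.filter fun i => ¬ IsLtrMin p i with hAdef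
  set B : Finset (Fin n) := A.map p.toEmbedding with hBdef
  have hB : B.card = A.card := by simp [hBdef]
  have hAB : ∀ a, a ∈ A ↔ p a ∈ B := by simp [hBdef]
  let τ : Equiv.Perm (Fin A.card) := (A.orderIsoOfFin rfl).toEquiv.trans <|
    (p.subtypeEquiv hAB).trans (B.orderIsoOfFin hB).symm.toEquiv
  have hτ : ∀ i, B.orderEmbOfFin hB (τ i) = p (A.orderEmbOfFin rfl i) := by
    intro i
    rw [← Finset.coe_orderIsoOfFin_apply, ← Finset.coe_orderIsoOfFin_apply]
    simp [τ]
  have hAmem : ∀ i, i ∈ A ↔ ¬ IsLtrMin p i := fun i => by simp [hAdef]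
  have hcard : A.card < n + 1 := by
    have := Finset.card_le_univ A
    simp only [Fintype.card_fin] at this
    omega
  refine ⟨A.card, hcard, A, B, rfl, hB, τ, ?_, ?_⟩
  · rintro ⟨f, hf, -, hQ⟩
    refine hp ⟨fun a => A.orderEmbOfFin rfl (f a), fun a b hab => ?_, fun a => ?_, fun a b => ?_⟩
    · simpa using hf hab
    · exact (hAmem _).1 (A.orderEmbOfFin_mem rfl (f a))
    · rw [← hτ, ← hτ, ← hQ, OrderEmbedding.lt_iff_lt]
  · have hAc : Aᶜ.card = n - A.card := by rw [Finset.card_compl, Fintype.card_fin]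
    have hBc : Bᶜ.card = n - A.card := by rw [Finset.card_compl, Fintype.card_fin, hB]
    have hdec : (fun j => p (Aᶜ.orderEmbOfFin hAc j.rev)) = Bᶜ.orderEmbOfFin hBc := by
      rw [← StrictMono.range_inj]
      · rw [Finset.range_orderEmbOfFin]
        ext v
        simp only [Set.mem_range, Finset.coe_compl, Set.mem_compl_iff, SetLike.mem_coe]
        constructor
        · rintro ⟨j, rfl⟩
          rw [← hAB]
          exact Finset.mem_compl.1 (Aᶜ.orderEmbOfFin_mem hAc j.rev)
        · intro hv
          have hm : p.symm v ∈ (Aᶜ : Finset (Fin n)) := by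
            rw [Finset.mem_compl, hAB]; simpa using hv
          rw [← Finset.mem_coe, ← Finset.range_orderEmbOfFin _ hAc] at hm
          obtain ⟨j, hj⟩ := hm
          exact ⟨j.rev, by simp [hj]⟩
      · intro i j hij
        refine strictAnti_ltrMin p ?_ (by simpa using hij)
        have := Finset.mem_compl.1 (Aᶜ.orderEmbOfFin_mem hAc i.rev)
        rwa [hAmem, not_not] at this
      · exact (Bᶜ.orderEmbOfFin hBc).strictMono
    refine Equiv.ext fun x => ?_
    obtain ⟨y, rfl⟩ := (finSumEquivOfFinset (rfl : A.card = A.card) hAc).surjective x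
    rcases y with i | j
    · rw [finSumEquivOfFinset_inl, mergeDecreasing_inl, hτ]
    · have := congrFun hdec j.rev
      simp only [Fin.rev_rev] at this
      rw [finSumEquivOfFinset_inr, mergeDecreasing_inr, this]

theorem avoidCount_oneSum_le {n k : ℕ} {Q : Fin (k + 1) → ℕ} (hQ0 : ∀ a, a ≠ 0 → Q 0 < Q a) :
    avoidCount n (oneSum Q) ≤
      ∑ m ∈ Finset.range (n + 1), n.choose m ^ 2 * avoidCount m Q := by
  have key : ∀ p : {p : Equiv.Perm (Fin n) // ¬ Occurs p (fun _ => True) (oneSum Q)},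
      ∃ t : Σ m : Fin (n + 1), {A : Finset (Fin n) // A.card = m} ×
        {B : Finset (Fin n) // B.card = m} ×
        {τ : Equiv.Perm (Fin m) // ¬ Occurs τ (fun _ => True) Q},
        mergeDecreasing (l := n - t.1) t.2.1.2
          (by rw [Finset.card_compl, Fintype.card_fin, t.2.1.2]) t.2.2.1.2
          (by rw [Finset.card_compl, Fintype.card_fin, t.2.2.1.2]) t.2.2.2.1 = p.1 := by
    rintro ⟨p, hp⟩
    obtain ⟨m, hm, A, B, hA, hB, τ, hτ, h⟩ :=
      exists_mergeDecreasing p fun h => hp (occurs_oneSum_of hQ0 h)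
    exact ⟨⟨⟨m, hm⟩, ⟨A, hA⟩, ⟨B, hB⟩, ⟨τ, hτ⟩⟩, h⟩
  choose g hg using key
  have hinj : Function.Injective g := fun p p' h => by
    refine Subtype.ext ?_
    rw [← hg p, ← hg p', h]
  refine (Nat.card_le_card_of_injective g hinj).trans (le_of_eq ?_)
  rw [Nat.card_sigma, Finset.sum_range]
  refine Finset.sum_congr rfl fun m _ => ?_
  rw [Nat.card_prod, Nat.card_prod, Nat.card_eq_fintype_card (α := {A : Finset (Fin n) // A.card = m}),
    Fintype.card_finset_len, Fintype.card_fin, avoidCount, ← mul_assoc, sq]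

end StanleyWilf

namespace StanleyWilf

/-- Add to the left of `p` a block of `b` entries forming `σ`, larger than everything else,
together with a decreasing sequence of `s` entries. The positions of the latter relative to `σ`
are given by `u`, their values relative to `p` by `v`. -/
def prependBlock {b s N : ℕ} (σ : Equiv.Perm (Fin b)) (u : Fin b ⊕ Fin s ≃ Fin (b + s))
    (v : Fin N ⊕ Fin s ≃ Fin (N + s)) (p : Equiv.Perm (Fin N)) : Equiv.Perm (Fin (b + s + N)) :=
  finSumFinEquiv.symm.trans <| (Equiv.sumCongr u.symm (Equiv.refl _)).trans <|
    (Equiv.sumCongr (Equiv.sumCongr σ Fin.revPerm) p).trans <| (Equiv.sumComm _ _).trans <|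
    (Equiv.sumCongr (Equiv.refl _) (Equiv.sumComm _ _)).trans <| (Equiv.sumAssoc _ _ _).symm.trans <|
    (Equiv.sumCongr v (Equiv.refl _)).trans <| finSumFinEquiv.trans (finCongr (by omega))

section prependBlock

variable {b s N : ℕ} (σ : Equiv.Perm (Fin b)) (u : Fin b ⊕ Fin s ≃ Fin (b + s))
  (v : Fin N ⊕ Fin s ≃ Fin (N + s)) (p : Equiv.Perm (Fin N))

theorem prependBlock_block (i : Fin b) :
    (prependBlock σ u v p (Fin.castAdd N (u (Sum.inl i))) : ℕ) = N + s + σ i := by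
  simp [prependBlock]

theorem prependBlock_decreasing (j : Fin s) :
    (prependBlock σ u v p (Fin.castAdd N (u (Sum.inr j))) : ℕ) = v (Sum.inr j.rev) := by
  simp [prependBlock]

theorem prependBlock_rest (t : Fin N) :
    (prependBlock σ u v p (Fin.natAdd (b + s) t) : ℕ) = v (Sum.inl (p t)) := by
  simp [prependBlock]

variable {σ u v p}

theorem prependBlock_cases (u : Fin b ⊕ Fin s ≃ Fin (b + s)) (x : Fin (b + s + N)) :
    (∃ i : Fin b, x = Fin.castAdd N (u (Sum.inl i))) ∨
      (∃ j : Fin s, x = Fin.castAdd N (u (Sum.inr j))) ∨ ∃ t : Fin N, x = Fin.natAdd (b + s) t := by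
  refine Fin.addCases (fun y => ?_) (fun t => Or.inr (Or.inr ⟨t, rfl⟩)) x
  obtain ⟨y | y, rfl⟩ := u.surjective y
  · exact Or.inl ⟨y, rfl⟩
  · exact Or.inr (Or.inl ⟨y, rfl⟩)

theorem prependBlock_avoids {k : ℕ} {Q : Fin (k + 1) → ℕ} (hQ0 : ∀ a, a ≠ 0 → Q 0 < Q a)
    (hul : StrictMono (u ∘ Sum.inl)) (hur : StrictMono (u ∘ Sum.inr))
    (hvl : StrictMono (v ∘ Sum.inl)) (hvr : StrictMono (v ∘ Sum.inr))
    (hv : ∀ (t : Fin N) (j : Fin s), (t : ℕ) + b < N → v (Sum.inl t) < v (Sum.inr j))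
    (hσ : ¬ Occurs σ (fun _ => True) Q)
    (hp : ¬ Occurs p (fun i => N ≤ (p i : ℕ) + b ∨ ¬ IsLtrMin p i) Q) :
    ¬ Occurs (prependBlock σ u v p) (fun i => b + s + N ≤ (prependBlock σ u v p i : ℕ) + b ∨
      ¬ IsLtrMin (prependBlock σ u v p) i) Q := by
  intro h
  set r := prependBlock σ u v p with hr
  have hr1 : ∀ i, (r (Fin.castAdd N (u (Sum.inl i))) : ℕ) = N + s + σ i :=
    prependBlock_block σ u v p
  have hr2 : ∀ i, (r (Fin.castAdd N (u (Sum.inr i))) : ℕ) = v (Sum.inr i.rev) :=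
    prependBlock_decreasing σ u v p
  have hr3 : ∀ i, (r (Fin.natAdd (b + s) i) : ℕ) = v (Sum.inl (p i)) :=
    prependBlock_rest σ u v p
  have hD : ∀ j : Fin s, ¬ (b + s + N ≤ (r (Fin.castAdd N (u (Sum.inr j))) : ℕ) + b ∨
      ¬ IsLtrMin r (Fin.castAdd N (u (Sum.inr j)))) := by
    intro j
    rw [not_or, not_not]
    refine ⟨by rw [hr2]; omega, fun x hi => ?_⟩
    rcases prependBlock_cases u x with ⟨i, rfl⟩ | ⟨i, rfl⟩ | ⟨i, rfl⟩
    · rw [Fin.lt_def, hr1, hr2]; omega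
    · rw [Fin.lt_def, hr2, hr2, ← Fin.lt_def]
      exact hvr (Fin.rev_lt_rev.2 (hur.lt_iff_lt.1 ((Fin.strictMono_castAdd N).lt_iff_lt.1 hi)))
    · rw [Fin.lt_def] at hi
      simp only [Fin.val_natAdd, Fin.val_castAdd] at hi
      omega
  have hleft : ∀ x : Fin (b + s + N), (b + s + N ≤ (r x : ℕ) + b ∨ ¬ IsLtrMin r x) →
      (x : ℕ) < b + s → ∃ i : Fin b, Fin.castAdd N (u (Sum.inl i)) = x := by
    intro x hPx hx
    rcases prependBlock_cases u x with ⟨i, rfl⟩ | ⟨i, rfl⟩ | ⟨i, rfl⟩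
    · exact ⟨i, rfl⟩
    · exact (hD i hPx).elim
    · simp only [Fin.val_natAdd] at hx
      omega
  have hright : ∀ x : Fin (b + s + N), b + s ≤ (x : ℕ) → ∃ t : Fin N,
      Fin.natAdd (b + s) t = x := fun x hx =>
    ⟨⟨x - (b + s), by omega⟩, Fin.ext (by simp only [Fin.val_natAdd]; omega)⟩
  have hcut : ∀ i j : Fin (b + s + N), (b + s + N ≤ (r i : ℕ) + b ∨ ¬ IsLtrMin r i) →
      (b + s + N ≤ (r j : ℕ) + b ∨ ¬ IsLtrMin r j) → (i : ℕ) < b + s → b + s ≤ (j : ℕ) →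
      r j < r i := by
    intro i j hPi hPj hi hj
    obtain ⟨i', rfl⟩ := hleft i hPi hi
    obtain ⟨j', rfl⟩ := hright j hj
    rw [Fin.lt_def, hr1, hr3]
    omega
  rcases occurs_split hQ0 (b + s) hcut h with h | h
  · refine hσ (h.transport (fun i => Fin.castAdd N (u (Sum.inl i)))
      ((Fin.strictMono_castAdd N).comp hul) (fun i j => ?_) ?_)
    · rw [Fin.lt_def, Fin.lt_def, hr1, hr1]; omega
    · rintro x ⟨hPx, hx⟩
      obtain ⟨i, rfl⟩ := hleft x hPx hx
      exact ⟨i, rfl, trivial⟩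
  · refine hp (h.transport (Fin.natAdd (b + s)) (Fin.strictMono_natAdd _) (fun i j => ?_) ?_)
    · rw [Fin.lt_def (a := r _), hr3, hr3, ← Fin.lt_def]
      exact hvl.lt_iff_lt.symm
    · rintro x ⟨hPx, hx⟩
      obtain ⟨t, rfl⟩ := hright x hx
      refine ⟨t, rfl, ?_⟩
      by_contra hcon
      rw [not_or, not_not, not_le] at hcon
      refine hPx.elim (fun h => ?_) (fun h => h ?_)
      · rw [hr3] at h; omega
      · intro y hi
        rcases prependBlock_cases u y with ⟨i, rfl⟩ | ⟨i, rfl⟩ | ⟨i, rfl⟩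
        · rw [Fin.lt_def, hr1, hr3]; omega
        · rw [Fin.lt_def, hr2, hr3]; exact hv _ _ hcon.1
        · rw [Fin.lt_def, hr3, hr3]
          exact hvl (hcon.2 i (by simpa using hi))

end prependBlock

/-- Values below `N` are kept; the last `b` values among `N + b` are interleaved with `s` new
ones, `Y` being the set of their new places in the top window of length `b + s`. -/
def shuffleTop (N : ℕ) {b s : ℕ} {Y : Finset (Fin (b + s))} (hY : Y.card = b)
    (hY' : Yᶜ.card = s) : Fin (N + b) ⊕ Fin s ≃ Fin (N + b + s) :=
  (Equiv.sumCongr finSumFinEquiv.symm (Equiv.refl _)).trans <| (Equiv.sumAssoc _ _ _).trans <|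
    (Equiv.sumCongr (Equiv.refl _) (finSumEquivOfFinset hY hY')).trans <|
    finSumFinEquiv.trans (finCongr (by omega))

section shuffleTop

variable {N b s : ℕ} {Y : Finset (Fin (b + s))} (hY : Y.card = b) (hY' : Yᶜ.card = s)

theorem shuffleTop_low (i : Fin N) :
    (shuffleTop N hY hY' (Sum.inl (Fin.castAdd b i)) : ℕ) = i := by
  simp [shuffleTop]

theorem shuffleTop_high (i : Fin b) :
    (shuffleTop N hY hY' (Sum.inl (Fin.natAdd N i)) : ℕ) = N + Y.orderEmbOfFin hY i := by
  simp [shuffleTop]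

theorem shuffleTop_new (j : Fin s) :
    (shuffleTop N hY hY' (Sum.inr j) : ℕ) = N + Yᶜ.orderEmbOfFin hY' j := by
  simp [shuffleTop]

theorem shuffleTop_strictMono_inl : StrictMono (shuffleTop N hY hY' ∘ Sum.inl) := by
  intro i j
  refine Fin.addCases (fun i => ?_) (fun i => ?_) i <;>
    refine Fin.addCases (fun j => ?_) (fun j => ?_) j <;> intro hij <;>
    simp only [Function.comp_apply] <;> rw [Fin.lt_def] at hij ⊢ <;>
    simp only [shuffleTop_low, shuffleTop_high, Fin.val_castAdd, Fin.val_natAdd] at hij ⊢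
  · exact hij
  · omega
  · omega
  · have : Y.orderEmbOfFin hY i < Y.orderEmbOfFin hY j :=
      (Y.orderEmbOfFin hY).strictMono (by rw [Fin.lt_def]; omega)
    rw [Fin.lt_def] at this
    omega

theorem shuffleTop_strictMono_inr : StrictMono (shuffleTop N hY hY' ∘ Sum.inr) := by
  intro i j hij
  have : Yᶜ.orderEmbOfFin hY' i < Yᶜ.orderEmbOfFin hY' j := (Yᶜ.orderEmbOfFin hY').strictMono hij
  rw [Fin.lt_def] at this
  simp only [Function.comp_apply]
  rw [Fin.lt_def, shuffleTop_new, shuffleTop_new]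
  omega

theorem shuffleTop_low_lt (t : Fin (N + b)) (j : Fin s) (ht : (t : ℕ) + b < N + b) :
    shuffleTop N hY hY' (Sum.inl t) < shuffleTop N hY hY' (Sum.inr j) := by
  obtain ⟨t', rfl⟩ : ∃ t' : Fin N, t = Fin.castAdd b t' := ⟨⟨t, by omega⟩, rfl⟩
  rw [Fin.lt_def, shuffleTop_low, shuffleTop_new]
  omega

theorem exists_shuffleTop_eq_iff (y : Fin (b + s)) :
    (∃ t, (shuffleTop N hY hY' (Sum.inl t) : ℕ) = N + y) ↔ y ∈ Y := by
  rw [← Finset.mem_coe, ← Finset.range_orderEmbOfFin Y hY]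
  constructor
  · rintro ⟨t, ht⟩
    revert ht
    refine Fin.addCases (fun i hi => ?_) (fun i hi => ?_) t
    · rw [shuffleTop_low] at hi; omega
    · rw [shuffleTop_high] at hi
      exact ⟨i, Fin.ext (by omega)⟩
  · rintro ⟨i, rfl⟩
    exact ⟨Fin.natAdd N i, shuffleTop_high hY hY' i⟩

end shuffleTop

/-- The number of permutations of length `n` in which the `b` largest entries and the entries that
are not left-to-right minima together avoid `Q`. -/
noncomputable def topAvoidCount (b n : ℕ) {k : ℕ} (Q : Fin k → ℕ) : ℕ :=
  Nat.card {p : Equiv.Perm (Fin n) // ¬ Occurs p (fun i => n ≤ (p i : ℕ) + b ∨ ¬ IsLtrMin p i) Q}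

theorem topAvoidCount_le (b n : ℕ) {k : ℕ} (Q : Fin k → ℕ) :
    topAvoidCount b n Q ≤ avoidCount n (oneSum Q) :=
  Nat.card_le_card_of_injective
    (fun p => ⟨p.1, fun h => p.2 ((occurs_oneSum_imp h).mono fun _ => Or.inr)⟩)
    fun _ _ h => Subtype.ext (congrArg Subtype.val h :)

theorem prependBlock_shuffleTop_injective {N b s : ℕ} {X X' Y Y' : Finset (Fin (b + s))}
    (hX : X.card = b) (hXc : Xᶜ.card = s) (hX' : X'.card = b) (hXc' : X'ᶜ.card = s)
    (hY : Y.card = b) (hYc : Yᶜ.card = s) (hY' : Y'.card = b) (hYc' : Y'ᶜ.card = s)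
    {σ σ' : Equiv.Perm (Fin b)} {p p' : Equiv.Perm (Fin (N + b))}
    (h : prependBlock σ (finSumEquivOfFinset hX hXc) (shuffleTop N hY hYc) p =
      prependBlock σ' (finSumEquivOfFinset hX' hXc') (shuffleTop N hY' hYc') p') :
    p = p' ∧ σ = σ' ∧ X = X' ∧ Y = Y' := by
  have hXX : X = X' := by
    have key : ∀ {X : Finset (Fin (b + s))} (hX : X.card = b) (hXc : Xᶜ.card = s)
        {Y : Finset (Fin (b + s))} (hY : Y.card = b) (hYc : Yᶜ.card = s)
        (σ : Equiv.Perm (Fin b)) (p : Equiv.Perm (Fin (N + b))) (x : Fin (b + s)),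
        x ∈ X ↔ N + b + s ≤ (prependBlock σ (finSumEquivOfFinset hX hXc) (shuffleTop N hY hYc) p
          (Fin.castAdd (N + b) x) : ℕ) := by
      intro X hX hXc Y hY hYc σ p x
      obtain ⟨y | y, rfl⟩ := (finSumEquivOfFinset hX hXc).surjective x
      · rw [prependBlock_block, finSumEquivOfFinset_inl]
        simp
      · rw [prependBlock_decreasing, finSumEquivOfFinset_inr]
        have := Finset.mem_compl.1 (Xᶜ.orderEmbOfFin_mem hXc y)
        simp only [this, false_iff, not_le]
        omega
    ext x
    rw [key hX hXc hY hYc σ p, key hX' hXc' hY' hYc' σ' p', h]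
  subst hXX
  have hpp : ∀ t, (shuffleTop N hY hYc (Sum.inl (p t)) : ℕ) =
      shuffleTop N hY' hYc' (Sum.inl (p' t)) := fun t => by
    have := prependBlock_rest σ (finSumEquivOfFinset hX hXc) (shuffleTop N hY hYc) p t
    rw [h, prependBlock_rest] at this
    exact this.symm
  have hYY : Y = Y' := by
    ext y
    rw [← exists_shuffleTop_eq_iff (N := N) hY hYc, ← exists_shuffleTop_eq_iff (N := N) hY' hYc']
    exact p.surjective.exists.trans ((exists_congr fun t => by rw [hpp]).trans
      p'.surjective.exists.symm)
  subst hYY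
  refine ⟨?_, ?_, rfl, rfl⟩
  · ext t
    have := (shuffleTop N hY hYc).injective (Fin.ext (hpp t))
    rw [Sum.inl.inj this]
  · ext i
    have := prependBlock_block σ (finSumEquivOfFinset hX hXc) (shuffleTop N hY hYc) p i
    rw [h, prependBlock_block] at this
    omega

theorem topAvoidCount_mul_le {k : ℕ} {Q : Fin (k + 1) → ℕ} (hQ0 : ∀ a, a ≠ 0 → Q 0 < Q a)
    (N b s : ℕ) : topAvoidCount b (N + b) Q * (avoidCount b Q * (b + s).choose b ^ 2) ≤
      topAvoidCount b (b + s + (N + b)) Q := by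
  have hc : ∀ X : {X : Finset (Fin (b + s)) // X.card = b}, X.1ᶜ.card = s := fun X => by
    rw [Finset.card_compl, Fintype.card_fin, X.2]; omega
  have hcard : Nat.card {X : Finset (Fin (b + s)) // X.card = b} = (b + s).choose b := by
    rw [Nat.card_eq_fintype_card, Fintype.card_finset_len, Fintype.card_fin]
  rw [sq, ← hcard, topAvoidCount, avoidCount, ← Nat.card_prod, ← Nat.card_prod, ← Nat.card_prod]
  refine Nat.card_le_card_of_injective
    (fun x => ⟨prependBlock x.2.1.1 (finSumEquivOfFinset x.2.2.1.2 (hc _))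
      (shuffleTop N x.2.2.2.2 (hc _)) x.1.1, prependBlock_avoids hQ0 ?_ ?_
      (shuffleTop_strictMono_inl _ _) (shuffleTop_strictMono_inr _ _) (shuffleTop_low_lt _ _)
      x.2.1.2 x.1.2⟩) ?_
  · intro i j hij
    simpa using hij
  · intro i j hij
    simpa using hij
  · rintro ⟨⟨p, hp⟩, ⟨σ, hσ⟩, ⟨X, hX⟩, ⟨Y, hY⟩⟩ ⟨⟨p', hp'⟩, ⟨σ', hσ'⟩, ⟨X', hX'⟩, ⟨Y', hY'⟩⟩ h
    obtain ⟨rfl, rfl, rfl, rfl⟩ :=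
      prependBlock_shuffleTop_injective _ _ _ _ _ _ _ _ (congrArg Subtype.val h :)
    rfl

theorem pow_le_avoidCount_oneSum {k : ℕ} {Q : Fin (k + 2) → ℕ}
    (hQ0 : ∀ a, a ≠ 0 → Q 0 < Q a) (b s m : ℕ) :
    (avoidCount b Q * (b + s).choose b ^ 2) ^ m ≤
      avoidCount (m * (b + s) + b) (oneSum Q) := by
  refine le_trans ?_ (topAvoidCount_le b _ Q)
  induction m with
  | zero =>
    have : topAvoidCount b b Q = avoidCount b Q := by
      rw [topAvoidCount, avoidCount]
      simp
    rw [pow_zero, Nat.zero_mul, Nat.zero_add, this]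
    exact avoidCount_pos b hQ0
  | succ m ih =>
    rw [pow_succ]
    refine (Nat.mul_le_mul_right _ ih).trans ?_
    refine (topAvoidCount_mul_le hQ0 (m * (b + s)) b s).trans (le_of_eq ?_)
    congr 1
    ring

end StanleyWilf

namespace StanleyWilf
open Filter Topology

theorem le_of_forall_const_mul_pow_le {K x y : ℝ} (hK : 0 < K) (hy : 0 < y)
    (h : ∀ n : ℕ, K * x ^ n ≤ (n + 1) * y ^ n) : x ≤ y := by
  by_contra! hxy
  have hr : 1 < x / y := (one_lt_div hy).2 hxy
  have h1 := (tendsto_pow_const_div_const_pow_of_one_lt 1 hr).add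
    (tendsto_pow_const_div_const_pow_of_one_lt 0 hr)
  rw [add_zero] at h1
  obtain ⟨n, hn⟩ := (h1.eventually_lt_const hK).exists
  have hrn : 0 < (x / y) ^ n := by positivity
  rw [pow_one, pow_zero, ← add_div, div_lt_iff₀ hrn, div_pow, ← mul_div_assoc,
    lt_div_iff₀ (by positivity)] at hn
  exact (h n).not_gt hn

/-- Fekete's lemma for supermultiplicative sequences of positive integers. -/
theorem exists_tendsto_root {a : ℕ → ℕ} (ha : ∀ n, 1 ≤ a n)
    (hmul : ∀ m n, a m * a n ≤ a (m + n)) {C : ℝ} (hC : ∀ n, (a n : ℝ) ≤ C ^ n) :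
    ∃ c, Tendsto (fun n : ℕ => (a n : ℝ) ^ (1 / (n : ℝ))) atTop (𝓝 c) ∧ 1 ≤ c ∧
      ∀ n, (a n : ℝ) ≤ c ^ n := by
  have hpos : ∀ n, (0 : ℝ) < a n := fun n => Nat.cast_pos.2 (ha n)
  have hone : ∀ n, (1 : ℝ) ≤ a n := fun n => Nat.one_le_cast.2 (ha n)
  have hsub : Subadditive fun n => -Real.log (a n) := by
    intro m n
    have : (a m : ℝ) * a n ≤ a (m + n) := by exact_mod_cast hmul m n
    have := Real.log_le_log (mul_pos (hpos m) (hpos n)) this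
    rw [Real.log_mul (hpos m).ne' (hpos n).ne'] at this
    linarith
  have hC1 : 1 ≤ C := by simpa using (hone 1).trans (hC 1)
  have hbdd : BddBelow (Set.range fun n : ℕ => -Real.log (a n) / n) := by
    refine ⟨-Real.log C, ?_⟩
    rintro _ ⟨n, rfl⟩
    rcases n.eq_zero_or_pos with rfl | hn
    · simpa using Real.log_nonneg hC1
    · have hn' : (0 : ℝ) < n := Nat.cast_pos.2 hn
      have := Real.log_le_log (hpos n) (hC n)
      rw [Real.log_pow] at this
      simp only
      rw [le_div_iff₀ hn']
      linarith
  have hroot : ∀ n : ℕ, 0 < n → Real.exp (-(-Real.log (a n) / n)) = (a n : ℝ) ^ (1 / (n : ℝ)) := by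
    intro n _
    rw [Real.rpow_def_of_pos (hpos n)]
    congr 1
    ring
  have hlim := (Real.continuous_exp.tendsto _).comp (hsub.tendsto_lim hbdd).neg
  have hc : ∀ n, (a n : ℝ) ≤ Real.exp (-hsub.lim) ^ n := by
    intro n
    rcases n.eq_zero_or_pos with rfl | hn
    · have := hC 0
      simpa using this
    · have h1 := hsub.lim_le_div hbdd hn.ne'
      have hn' : (0 : ℝ) < n := Nat.cast_pos.2 hn
      rw [le_div_iff₀ hn'] at h1
      rw [← Real.exp_nat_mul, ← Real.log_le_iff_le_exp (hpos n)]
      linarith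
  refine ⟨Real.exp (-hsub.lim), hlim.congr' ?_, ?_, hc⟩
  · filter_upwards [eventually_gt_atTop 0] with n hn using hroot n hn
  · simpa using (hone 1).trans (hc 1)

theorem exists_const_mul_pow_le {a : ℕ → ℕ} (ha : ∀ n, 1 ≤ a n) {c t : ℝ} (ht : 0 ≤ t)
    (htc : t < c) (hlim : Tendsto (fun n : ℕ => (a n : ℝ) ^ (1 / (n : ℝ))) atTop (𝓝 c)) :
    ∃ K, 0 < K ∧ ∀ n, K * t ^ n ≤ a n := by
  obtain ⟨M, hM⟩ := eventually_atTop.1 ((hlim.eventually_const_lt htc).and (eventually_gt_atTop 0))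
  have hM' : ∀ n, M ≤ n → t ^ n ≤ a n := by
    intro n hn
    obtain ⟨h1, h2⟩ := hM n hn
    calc t ^ n ≤ ((a n : ℝ) ^ (1 / (n : ℝ))) ^ n := pow_le_pow_left₀ ht h1.le n
      _ = a n := by
        rw [one_div, Real.rpow_inv_natCast_pow (Nat.cast_nonneg _) h2.ne']
  refine ⟨1 / (1 + t) ^ M, by positivity, fun n => ?_⟩
  have h1t : (1 : ℝ) ≤ (1 + t) ^ M := one_le_pow₀ (by linarith)
  rw [div_mul_eq_mul_div, one_mul, div_le_iff₀ (by positivity)]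
  rcases le_total M n with hn | hn
  · exact (hM' n hn).trans (le_mul_of_one_le_right (Nat.cast_nonneg _) h1t)
  · calc t ^ n ≤ (1 + t) ^ n := pow_le_pow_left₀ ht (by linarith) n
      _ ≤ (1 + t) ^ M := pow_le_pow_right₀ (by linarith) hn
      _ ≤ a n * (1 + t) ^ M :=
        le_mul_of_one_le_left (by positivity) (Nat.one_le_cast.2 (ha n))

/-- If two supermultiplicative sequences satisfy the inequalities relating the numbers of
permutations avoiding `Q` and `oneSum Q`, their growth rates are related by
`√c' = 1 + √c`. -/
theorem tendsto_root_of_interleaving {a a' : ℕ → ℕ} (ha : ∀ n, 1 ≤ a n) (ha' : ∀ n, 1 ≤ a' n)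
    (hmul' : ∀ m n, a' m * a' n ≤ a' (m + n)) {c : ℝ}
    (hlim : Tendsto (fun n : ℕ => (a n : ℝ) ^ (1 / (n : ℝ))) atTop (𝓝 c))
    (hc : ∀ n, (a n : ℝ) ≤ c ^ n)
    (hupper : ∀ n, a' n ≤ ∑ m ∈ Finset.range (n + 1), n.choose m ^ 2 * a m)
    (hlower : ∀ b s m, (a b * (b + s).choose b ^ 2) ^ m ≤ a' (m * (b + s) + b)) :
    Tendsto (fun n : ℕ => (a' n : ℝ) ^ (1 / (n : ℝ))) atTop (𝓝 ((1 + √c) ^ 2)) ∧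
      ∀ n, (a' n : ℝ) ≤ ((1 + √c) ^ 2) ^ n := by
  have hc1 : 1 ≤ c := by
    have := hc 1
    rw [pow_one] at this
    exact (Nat.one_le_cast.2 (ha 1)).trans this
  have hc0 : 0 ≤ c := by linarith
  have hbound : ∀ n, (a' n : ℝ) ≤ ((1 + √c) ^ 2) ^ n := by
    intro n
    calc (a' n : ℝ) ≤ ((∑ m ∈ Finset.range (n + 1), n.choose m ^ 2 * a m : ℕ) : ℝ) :=
          Nat.cast_le.2 (hupper n)
      _ ≤ ∑ m ∈ Finset.range (n + 1), (√c ^ m * n.choose m) ^ 2 := by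
        push_cast
        refine Finset.sum_le_sum fun m _ => ?_
        rw [mul_pow, ← pow_mul, mul_comm m 2, pow_mul, Real.sq_sqrt hc0, mul_comm]
        exact mul_le_mul_of_nonneg_right (hc m) (by positivity)
      _ ≤ (∑ m ∈ Finset.range (n + 1), √c ^ m * n.choose m) ^ 2 :=
        Finset.sum_sq_le_sq_sum_of_nonneg fun m _ => by positivity
      _ = ((1 + √c) ^ 2) ^ n := by
        rw [← pow_mul, mul_comm 2 n, pow_mul, add_comm 1, add_pow]
        simp
  obtain ⟨c', hlim', hc1', hc'⟩ := exists_tendsto_root ha' hmul' hbound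
  suffices c' = (1 + √c) ^ 2 by
    rw [← this]
    exact ⟨hlim', hc'⟩
  refine le_antisymm ?_ ?_
  · refine le_of_tendsto hlim' ?_
    filter_upwards [eventually_gt_atTop 0] with n hn
    rw [one_div, Real.rpow_inv_le_iff_of_pos (Nat.cast_nonneg _) (by positivity)
      (Nat.cast_pos.2 hn), Real.rpow_natCast]
    exact hbound n
  · have hsq : ∀ b s, (a b : ℝ) * (b + s).choose b ^ 2 ≤ c' ^ (b + s) := by
      intro b s
      refine le_of_forall_const_mul_pow_le (K := 1 / c' ^ b) (by positivity) (by positivity)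
        fun m => ?_
      rw [div_mul_eq_mul_div, one_mul, div_le_iff₀ (by positivity), ← pow_mul]
      calc ((a b : ℝ) * (b + s).choose b ^ 2) ^ m ≤ a' (m * (b + s) + b) := by
            exact_mod_cast hlower b s m
        _ ≤ c' ^ (m * (b + s) + b) := hc' _
        _ = 1 * (c' ^ ((b + s) * m) * c' ^ b) := by rw [one_mul, ← pow_add, mul_comm]
        _ ≤ (m + 1) * c' ^ ((b + s) * m) * c' ^ b := by
          rw [mul_assoc]
          exact mul_le_mul_of_nonneg_right (by linarith [m.cast_nonneg (α := ℝ)]) (by positivity)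
    have ht : ∀ t : ℝ, 0 ≤ t → t < c → 1 + √t ≤ √c' := by
      intro t ht htc
      obtain ⟨K, hK, hKt⟩ := exists_const_mul_pow_le ha ht htc hlim
      refine le_of_forall_const_mul_pow_le (Real.sqrt_pos.2 hK) (by positivity) fun L => ?_
      calc √K * (1 + √t) ^ L = ∑ b ∈ Finset.range (L + 1), √K * (√t ^ b * L.choose b) := by
            rw [add_comm, add_pow, Finset.mul_sum]; simp
        _ ≤ ∑ b ∈ Finset.range (L + 1), √c' ^ L := by
          refine Finset.sum_le_sum fun b hb => ?_
          obtain ⟨s, rfl⟩ := Nat.exists_eq_add_of_le (Finset.mem_range_succ_iff.1 hb)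
          refine (sq_le_sq₀ (by positivity) (by positivity)).1 ?_
          rw [mul_pow, mul_pow, ← pow_mul, ← pow_mul, mul_comm b, mul_comm (b + s), pow_mul, pow_mul,
            Real.sq_sqrt ht, Real.sq_sqrt hK.le, Real.sq_sqrt (by linarith), ← mul_assoc]
          exact (mul_le_mul_of_nonneg_right (hKt b) (by positivity)).trans (hsq b s)
        _ = (L + 1) * √c' ^ L := by simp
    have hle : 1 + √c ≤ √c' := by
      have htend : Tendsto (fun t => 1 + √t) (𝓝[<] c) (𝓝 (1 + √c)) :=
        ((continuous_const.add Real.continuous_sqrt).tendsto c).mono_left nhdsWithin_le_nhds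
      refine le_of_tendsto htend ?_
      filter_upwards [Ioo_mem_nhdsLT (show (0 : ℝ) < c by linarith)] with t h using
        ht t h.1.le h.2
    calc (1 + √c) ^ 2 ≤ √c' ^ 2 := pow_le_pow_left₀ (by positivity) hle 2
      _ = c' := Real.sq_sqrt (by linarith)

end StanleyWilf

namespace StanleyWilf
open Filter Topology

/-- The one-line notation of the pattern `1 2 ⋯ (k-3) (k-1) k (k-2)` of length `k = j + 4`,
with values starting from `0`. -/
def increasing1342 : (j : ℕ) → Fin (j + 4) → ℕ
  | 0 => ![0, 2, 3, 1]
  | j + 1 => oneSum (increasing1342 j)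

theorem increasing1342_apply (j : ℕ) (i : Fin (j + 4)) :
    increasing1342 j i = if (i : ℕ) < j + 1 then (i : ℕ) else
      if (i : ℕ) = j + 1 then j + 2 else if (i : ℕ) = j + 2 then j + 3 else j + 1 := by
  induction j with
  | zero => fin_cases i <;> rfl
  | succ j ih =>
    refine Fin.cases ?_ (fun i => ?_) i
    · rfl
    · simp only [increasing1342, oneSum, Fin.cons_succ, ih, Fin.val_succ]
      split_ifs <;> omega

theorem increasing1342_zero_lt (j : ℕ) (a : Fin (j + 4)) (ha : a ≠ 0) :
    increasing1342 j 0 < increasing1342 j a := by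
  have : (a : ℕ) ≠ 0 := fun h => ha (Fin.ext h)
  rw [increasing1342_apply, increasing1342_apply, Fin.val_zero]
  split_ifs <;> omega

theorem tendsto_increasing1342 {c : ℝ} (hlim : Tendsto
    (fun n : ℕ => (avoidCount n ![0, 2, 3, 1] : ℝ) ^ (1 / (n : ℝ))) atTop (𝓝 (c ^ 2)))
    (hle : ∀ n, (avoidCount n ![0, 2, 3, 1] : ℝ) ≤ (c ^ 2) ^ n) (hc : 0 ≤ c) (j : ℕ) :
    Tendsto (fun n : ℕ => (avoidCount n (increasing1342 j) : ℝ) ^ (1 / (n : ℝ))) atTop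
      (𝓝 ((j + c) ^ 2)) ∧ ∀ n, (avoidCount n (increasing1342 j) : ℝ) ≤ ((j + c) ^ 2) ^ n := by
  induction j with
  | zero =>
    simp only [Nat.cast_zero, zero_add]
    exact ⟨hlim, hle⟩
  | succ j ih =>
    have hQ0 := increasing1342_zero_lt j
    have := tendsto_root_of_interleaving
      (fun n => avoidCount_pos n hQ0) (fun n => avoidCount_pos n (increasing1342_zero_lt (j + 1)))
      (avoidCount_mul_le (increasing1342_zero_lt (j + 1))) ih.1 ih.2
      (fun n => avoidCount_oneSum_le hQ0) (pow_le_avoidCount_oneSum hQ0)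
    rw [Real.sqrt_sq (by positivity), ← add_assoc, add_comm 1 (j : ℝ)] at this
    rw [Nat.cast_add, Nat.cast_one]
    exact this

theorem avoiders_eq_avoidCount (n : ℕ) {k : ℕ} {q : Equiv.Perm (Fin k)} {Q : Fin k → ℕ}
    (h : ∀ i, (q i : ℕ) = Q i) : avoiders n q = avoidCount n Q := by
  simp only [avoiders, avoidCount, PermAvoids, PermContains, Occurs, Fin.lt_def, ← h, true_and,
    implies_true]

end StanleyWilf

namespace StanleyWilf

theorem occurs_1342_iff {n : ℕ} (p : Equiv.Perm (Fin n)) :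
    Occurs p (fun _ => True) ![0, 2, 3, 1] ↔
      ∃ i j k l, i < j ∧ j < k ∧ k < l ∧ p i < p l ∧ p l < p j ∧ p j < p k := by
  constructor
  · rintro ⟨f, hf, -, hQ⟩
    exact ⟨f 0, f 1, f 2, f 3, hf (by decide), hf (by decide), hf (by decide),
      (hQ 0 3).2 (by decide), (hQ 3 1).2 (by decide), (hQ 1 2).2 (by decide)⟩
  · rintro ⟨i, j, k, l, hij, hjk, hkl, h1, h2, h3⟩
    refine ⟨![i, j, k, l], ?_, fun _ => trivial, ?_⟩
    · refine Fin.strictMono_iff_lt_succ.2 fun a => ?_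
      fin_cases a
      exacts [hij, hjk, hkl]
    · rw [Fin.lt_def] at h1 h2 h3
      intro a b
      rw [Fin.lt_def]
      fin_cases a <;> fin_cases b <;> simp <;> omega

/-- Put a new entry of value `f` in front of `p`. -/
def insertFirst {n : ℕ} (f : Fin (n + 1)) (p : Equiv.Perm (Fin n)) : Equiv.Perm (Fin (n + 1)) :=
  (finSuccEquiv n).trans <| (Equiv.optionCongr p).trans (finSuccEquiv' f).symm

theorem insertFirst_zero {n : ℕ} (f : Fin (n + 1)) (p : Equiv.Perm (Fin n)) :
    insertFirst f p 0 = f := by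
  simp [insertFirst]

theorem insertFirst_succ {n : ℕ} (f : Fin (n + 1)) (p : Equiv.Perm (Fin n)) (i : Fin n) :
    insertFirst f p i.succ = f.succAbove (p i) := by
  simp [insertFirst]

theorem insertFirst_succ_val {n : ℕ} (f : Fin (n + 1)) (p : Equiv.Perm (Fin n)) (i : Fin n) :
    (insertFirst f p i.succ : ℕ) = if (p i : ℕ) < f then (p i : ℕ) else p i + 1 := by
  rw [insertFirst_succ, Fin.succAbove]
  simp only [Fin.lt_def, Fin.val_castSucc]
  split_ifs <;> simp

/-- Permutations of length `n + 1` are described by their first entry and the permutation formed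
by the remaining ones. -/
noncomputable def insertFirstEquiv (n : ℕ) :
    Fin (n + 1) × Equiv.Perm (Fin n) ≃ Equiv.Perm (Fin (n + 1)) :=
  Equiv.ofBijective (fun x => insertFirst x.1 x.2) <| by
    refine (Fintype.bijective_iff_injective_and_card _).2 ⟨?_, ?_⟩
    · rintro ⟨f, p⟩ ⟨f', p'⟩ h
      simp only at h
      have hf : f = f' := by rw [← insertFirst_zero f p, h, insertFirst_zero]
      subst hf
      congr
      ext i
      have := congrArg (fun r => r i.succ) h
      simp only [insertFirst_succ] at this
      rw [Fin.succAbove_right_injective this]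
    · simp [Fintype.card_perm, Nat.factorial_succ]

/-- `p` contains an occurrence of `231` all of whose entries are at least `v`. -/
def Has231 {n : ℕ} (p : Equiv.Perm (Fin n)) (v : ℕ) : Prop :=
  ∃ i j k, i < j ∧ j < k ∧ v ≤ (p k : ℕ) ∧ p k < p i ∧ p i < p j

theorem occurs_insertFirst_iff {n : ℕ} (f : Fin (n + 1)) (p : Equiv.Perm (Fin n)) :
    Occurs (insertFirst f p) (fun _ => True) ![0, 2, 3, 1] ↔
      Occurs p (fun _ => True) ![0, 2, 3, 1] ∨ Has231 p f := by
  simp only [occurs_1342_iff, Has231, Fin.exists_fin_succ, Fin.lt_def, insertFirst_succ_val,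
    insertFirst_zero, Fin.val_succ, Fin.val_zero, Nat.add_lt_add_iff_right, Nat.not_lt_zero,
    false_and, and_false, exists_false, false_or]
  constructor
  · rintro (⟨j, k, l, h1, h2, h3, h4, h5, h6⟩ | ⟨i, j, k, l, h1, h2, h3, h4, h5, h6⟩)
    · refine Or.inr ⟨j, k, l, h2, h3, ?_⟩
      split_ifs at h4 h5 h6 <;> omega
    · refine Or.inl ⟨i, j, k, l, h1, h2, h3, ?_⟩
      split_ifs at h4 h5 h6 <;> omega
  · rintro (⟨i, j, k, l, h1, h2, h3, h4, h5, h6⟩ | ⟨j, k, l, h2, h3, h4, h5, h6⟩)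
    · refine Or.inr ⟨i, j, k, l, h1, h2, h3, ?_⟩
      split_ifs <;> omega
    · refine Or.inl ⟨j, k, l, by omega, h2, h3, ?_⟩
      split_ifs <;> omega

theorem has231_insertFirst_iff {n : ℕ} (f : Fin (n + 1)) (p : Equiv.Perm (Fin n)) (v : ℕ) :
    Has231 (insertFirst f p) v ↔ (v ≤ f ∧ Has231 p v) ∨ (f < v ∧ Has231 p (v - 1)) ∨
      ∃ j k, j < k ∧ v ≤ (p k : ℕ) ∧ (p k : ℕ) < f ∧ f ≤ (p j : ℕ) := by
  simp only [Has231, Fin.exists_fin_succ, Fin.lt_def, insertFirst_succ_val,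
    insertFirst_zero, Fin.val_succ, Fin.val_zero, Nat.add_lt_add_iff_right, Nat.not_lt_zero,
    false_and, and_false, exists_false, false_or]
  constructor
  · rintro (⟨j, k, h1, h2, h3, h4, h5⟩ | ⟨i, j, k, h1, h2, h3, h4, h5⟩)
    · refine Or.inr (Or.inr ⟨j, k, h2, ?_⟩)
      split_ifs at h3 h4 h5 <;> omega
    · rcases le_or_gt v f with hv | hv
      · refine Or.inl ⟨hv, i, j, k, h1, h2, ?_⟩
        split_ifs at h3 h4 h5 <;> omega
      · refine Or.inr (Or.inl ⟨hv, i, j, k, h1, h2, ?_⟩)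
        split_ifs at h3 h4 h5 <;> omega
  · rintro (⟨hv, i, j, k, h1, h2, h3, h4, h5⟩ | ⟨hv, i, j, k, h1, h2, h3, h4, h5⟩ |
      ⟨j, k, h1, h2, h3, h4⟩)
    · refine Or.inr ⟨i, j, k, h1, h2, ?_⟩
      split_ifs <;> omega
    · refine Or.inr ⟨i, j, k, h1, h2, ?_⟩
      split_ifs <;> omega
    · refine Or.inl ⟨j, k, by omega, h1, ?_⟩
      split_ifs <;> omega

/-- The `N` largest entries of `p` form the largest `231`-avoiding set of top entries. The set of
entries of this window lying below the gap `g` is an initial summand of the window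
if and only if `b g`. -/
structure TopWindow {n : ℕ} (p : Equiv.Perm (Fin n)) (N : ℕ) (b : ℕ → Bool) : Prop where
  le : N ≤ n
  has231_iff : ∀ v, Has231 p v ↔ v + N < n
  of_true : ∀ g ≤ N, b g = true → ∀ i j, i < j → (p j : ℕ) < n - N + g → n - N + g ≤ (p i : ℕ) →
    (p j : ℕ) < n - N
  of_false : ∀ g ≤ N, b g = false → ∃ i j, i < j ∧ (p j : ℕ) + 1 = n - N + g ∧
    n - N + g ≤ (p i : ℕ)

theorem TopWindow.insertFirst_of_true {n : ℕ} {p : Equiv.Perm (Fin n)} {N : ℕ} {b : ℕ → Bool}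
    (h : TopWindow p N b) {f : Fin (n + 1)} {g : ℕ} (hg : g ≤ N) (hf : (f : ℕ) = n - N + g)
    (hb : b g = true) {b' : ℕ → Bool}
    (hb' : ∀ t, b' t = if t = 0 then true else if t ≤ g then false else b (t - 1)) :
    TopWindow (insertFirst f p) (N + 1) b' := by
  obtain ⟨hN, h231, hT, hF⟩ := h
  refine ⟨by omega, fun v => ?_, fun t ht hbt => ?_, fun t ht hbt => ?_⟩
  · rw [has231_insertFirst_iff, h231, h231]
    constructor
    · rintro (h | h | ⟨j, k, hjk, h1, h2, h3⟩)
      · omega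
      · omega
      · have := hT g hg hb j k hjk (by omega) (by omega)
        omega
    · intro h
      exact Or.inl (by omega)
  · rw [hb'] at hbt
    intro i j
    refine Fin.cases ?_ (fun i => ?_) i <;> refine Fin.cases ?_ (fun j => ?_) j
    · simp
    · rw [insertFirst_zero, insertFirst_succ_val]
      intro _ h1 h2
      split_ifs at hbt h1 ⊢ <;> omega
    · simp
    · rw [insertFirst_succ_val, insertFirst_succ_val, Fin.succ_lt_succ_iff]
      intro hij h1 h2
      by_cases ht0 : t = 0
      · omega
      · by_cases htg : t ≤ g
        · simp [ht0, htg] at hbt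
        · rw [if_neg ht0, if_neg htg] at hbt
          have := hT (t - 1) (by omega) hbt i j hij
          split_ifs at h1 h2 ⊢ <;> omega
  · rw [hb'] at hbt
    by_cases ht0 : t = 0
    · simp [ht0] at hbt
    · by_cases htg : t ≤ g
      · refine ⟨0, Fin.succ (p.symm ⟨n - N + t - 1, by omega⟩), Fin.succ_pos _, ?_, ?_⟩
        · rw [insertFirst_succ_val, Equiv.apply_symm_apply]
          simp only
          split_ifs <;> omega
        · rw [insertFirst_zero]; omega
      · rw [if_neg ht0, if_neg htg] at hbt
        have htg' : t - 1 ≠ g := by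
          rintro rfl
          rw [hb] at hbt
          cases hbt
        obtain ⟨i, j, hij, h1, h2⟩ := hF (t - 1) (by omega) hbt
        refine ⟨i.succ, j.succ, Fin.succ_lt_succ_iff.2 hij, ?_, ?_⟩ <;>
          rw [insertFirst_succ_val] <;> split_ifs <;> omega

theorem TopWindow.insertFirst_of_false {n : ℕ} {p : Equiv.Perm (Fin n)} {N : ℕ} {b : ℕ → Bool}
    (h : TopWindow p N b) {f : Fin (n + 1)} {g : ℕ} (hg : g ≤ N) (hf : (f : ℕ) = n - N + g)
    (hb : b g = false) {b' : ℕ → Bool}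
    (hb' : ∀ t, b' t = if t ≤ 1 then true else b (g + t - 1)) :
    TopWindow (insertFirst f p) (N - g + 1) b' := by
  obtain ⟨hN, h231, hT, hF⟩ := h
  obtain ⟨i₀, j₀, hij₀, hj₀, hi₀⟩ := hF g hg hb
  refine ⟨by omega, fun v => ?_, fun t ht hbt => ?_, fun t ht hbt => ?_⟩
  · rw [has231_insertFirst_iff, h231, h231]
    constructor
    · rintro (h | h | ⟨j, k, hjk, h1, h2, h3⟩) <;> omega
    · intro h
      exact Or.inr (Or.inr ⟨i₀, j₀, hij₀, by omega, by omega, by omega⟩)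
  · rw [hb'] at hbt
    intro i j
    refine Fin.cases ?_ (fun i => ?_) i <;> refine Fin.cases ?_ (fun j => ?_) j
    · simp
    · rw [insertFirst_zero, insertFirst_succ_val]
      intro _ h1 h2
      split_ifs at hbt h1 ⊢ <;> omega
    · simp
    · rw [insertFirst_succ_val, insertFirst_succ_val, Fin.succ_lt_succ_iff]
      intro hij h1 h2
      by_cases ht1 : t ≤ 1
      · split_ifs at h1 h2 ⊢ <;> omega
      · rw [if_neg ht1] at hbt
        have := hT (g + t - 1) (by omega) hbt i j hij
        split_ifs at h1 h2 ⊢ <;> omega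
  · rw [hb'] at hbt
    by_cases ht1 : t ≤ 1
    · simp [ht1] at hbt
    · rw [if_neg ht1] at hbt
      obtain ⟨i, j, hij, h1, h2⟩ := hF (g + t - 1) (by omega) hbt
      refine ⟨i.succ, j.succ, Fin.succ_lt_succ_iff.2 hij, ?_, ?_⟩ <;>
        rw [insertFirst_succ_val] <;> split_ifs <;> omega

end StanleyWilf

namespace StanleyWilf

/-- The state of a `1342`-avoiding permutation is the list of the sizes, decreased by one, of the
indecomposable summands of its top window. This is the length of that window. -/
def windowSize : List ℕ → ℕ
  | [] => 0
  | a :: s => a + 1 + windowSize s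

/-- Whether the first `g` entries of the window form a union of summands. -/
def isBreak : List ℕ → ℕ → Bool
  | [], _ => true
  | a :: s, g => if g = 0 then true else if g ≤ a then false else isBreak s (g - a - 1)

/-- The state after the insertion of a new first entry into the gap `g` of the window, if `acc`
entries below the given ones have already been passed. -/
def child : ℕ → List ℕ → ℕ → List ℕ
  | acc, [], _ => [acc]
  | acc, a :: s, 0 => acc :: a :: s
  | acc, a :: s, g + 1 => if g < a then 0 :: (a - 1 - g) :: s else child (acc + a + 1) s (g - a)

/-- The sum of `φ` over all states obtained by inserting a new first entry. -/
def childSum {R : Type*} [AddCommMonoid R] (φ : List ℕ → R) : ℕ → List ℕ → R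
  | acc, [] => φ [acc]
  | acc, a :: s => φ (acc :: a :: s) + ∑ h ∈ Finset.range a, φ (0 :: h :: s) +
      childSum φ (acc + a + 1) s

theorem sum_child {R : Type*} [AddCommMonoid R] (φ : List ℕ → R) (acc : ℕ) (s : List ℕ) :
    ∑ g ∈ Finset.range (windowSize s + 1), φ (child acc s g) = childSum φ acc s := by
  induction s generalizing acc with
  | nil => simp [windowSize, child, childSum]
  | cons a s ih =>
    rw [Finset.sum_range_succ', windowSize, childSum, add_comm, add_assoc a,
      Finset.sum_range_add, ← ih (acc + a + 1), add_comm 1, ← add_assoc]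
    refine congrArg₂ (· + ·) (congrArg₂ (· + ·) rfl ?_) ?_
    · rw [← Finset.sum_range_reflect (fun h => φ (0 :: h :: s))]
      refine Finset.sum_congr rfl fun g hg => ?_
      rw [child, if_pos (Finset.mem_range.1 hg)]
    · refine Finset.sum_congr rfl fun g _ => ?_
      rw [child, if_neg (by omega), Nat.add_sub_cancel_left]

theorem windowSize_child_of_true (acc : ℕ) {s : List ℕ} {g : ℕ} (hg : g ≤ windowSize s)
    (hb : isBreak s g = true) : windowSize (child acc s g) = acc + windowSize s + 1 := by
  induction s generalizing acc g with
  | nil => simp [child, windowSize]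
  | cons a s ih =>
    rcases g with _ | g
    · simp only [child, windowSize]; omega
    · simp only [windowSize] at hg
      by_cases hga : g < a
      · simp [isBreak, Nat.succ_le_of_lt hga] at hb
      · rw [isBreak, if_neg (by omega), if_neg (by omega),
          show g + 1 - a - 1 = g - a by omega] at hb
        rw [child, if_neg hga, ih _ (by omega) hb, windowSize]
        omega

theorem isBreak_child_of_true (acc : ℕ) {s : List ℕ} {g : ℕ} (hg : g ≤ windowSize s)
    (hb : isBreak s g = true) (t : ℕ) : isBreak (child acc s g) t =
      if t = 0 then true else if t ≤ acc + g then false else isBreak s (t - 1 - acc) := by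
  induction s generalizing acc g with
  | nil =>
    rw [windowSize, Nat.le_zero] at hg
    simp [child, isBreak, hg]
  | cons a s ih =>
    rcases g with _ | g
    · rw [child, isBreak, Nat.add_zero, Nat.sub_right_comm]
    · simp only [windowSize] at hg
      by_cases hga : g < a
      · simp [isBreak, Nat.succ_le_of_lt hga] at hb
      · rw [isBreak, if_neg (by omega), if_neg (by omega),
          show g + 1 - a - 1 = g - a by omega] at hb
        rw [child, if_neg hga, ih _ (by omega) hb, show acc + a + 1 + (g - a) = acc + (g + 1) by omega]
        split_ifs with h1 h2
        · rfl
        · rfl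
        · rw [isBreak, if_neg (by omega), if_neg (by omega)]
          congr 1
          omega

theorem windowSize_child_of_false (acc : ℕ) {s : List ℕ} {g : ℕ} (hg : g ≤ windowSize s)
    (hb : isBreak s g = false) : windowSize (child acc s g) = windowSize s - g + 1 := by
  induction s generalizing acc g with
  | nil => simp [isBreak] at hb
  | cons a s ih =>
    rcases g with _ | g
    · simp [isBreak] at hb
    · simp only [windowSize] at hg
      by_cases hga : g < a
      · rw [child, if_pos hga]
        simp only [windowSize]
        omega
      · rw [isBreak, if_neg (by omega), if_neg (by omega),
          show g + 1 - a - 1 = g - a by omega] at hb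
        rw [child, if_neg hga, ih _ (by omega) hb, windowSize]
        omega

theorem isBreak_child_of_false (acc : ℕ) {s : List ℕ} {g : ℕ} (hb : isBreak s g = false) (t : ℕ) :
    isBreak (child acc s g) t = if t ≤ 1 then true else isBreak s (g + t - 1) := by
  induction s generalizing acc g with
  | nil => simp [isBreak] at hb
  | cons a s ih =>
    rcases g with _ | g
    · simp [isBreak] at hb
    · by_cases hga : g < a
      · rw [child, if_pos hga, isBreak]
        rcases t with _ | _ | t
        · simp
        · simp [isBreak]
        · simp only [isBreak]
          split_ifs <;> first | rfl | contradiction | omega | (congr 1; omega)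
      · rw [isBreak, if_neg (by omega), if_neg (by omega),
          show g + 1 - a - 1 = g - a by omega] at hb
        rw [child, if_neg hga, ih _ hb]
        split_ifs with h
        · rfl
        · rw [isBreak, if_neg (by omega), if_neg (by omega)]
          congr 1
          omega

theorem topWindow_insertFirst {n : ℕ} {p : Equiv.Perm (Fin n)} {s : List ℕ}
    (h : TopWindow p (windowSize s) (isBreak s)) {f : Fin (n + 1)} (hf : n ≤ f + windowSize s) :
    TopWindow (insertFirst f p) (windowSize (child 0 s (f - (n - windowSize s))))
      (isBreak (child 0 s (f - (n - windowSize s)))) := by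
  have hN := h.le
  have hfn := f.isLt
  have hg : (f : ℕ) - (n - windowSize s) ≤ windowSize s := by omega
  cases hb : isBreak s (f - (n - windowSize s))
  · rw [windowSize_child_of_false 0 hg hb]
    exact h.insertFirst_of_false hg (by omega) hb (isBreak_child_of_false 0 hb)
  · rw [windowSize_child_of_true 0 hg hb, zero_add]
    refine h.insertFirst_of_true hg (by omega) hb fun t => ?_
    rw [isBreak_child_of_true 0 hg hb, zero_add, Nat.sub_zero]

open Classical in
/-- The `1342`-avoiding permutations of length `n` are enumerated by their states, through
iterated summation over children. -/
theorem exists_state (n : ℕ) : ∃ st : Equiv.Perm (Fin n) → List ℕ,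
    (∀ p, ¬ Occurs p (fun _ => True) ![0, 2, 3, 1] →
      TopWindow p (windowSize (st p)) (isBreak (st p))) ∧
    ∀ φ : List ℕ → ℕ, (∑ p : Equiv.Perm (Fin n),
      if Occurs p (fun _ => True) ![0, 2, 3, 1] then 0 else φ (st p)) =
      ((fun φ => childSum φ 0)^[n] φ) [] := by
  induction n with
  | zero =>
    refine ⟨fun _ => [], fun p _ => ?_, fun φ => ?_⟩
    · refine ⟨le_rfl, fun v => ?_, fun g _ _ i => i.elim0, fun g _ hb => ?_⟩
      · exact iff_of_false (fun ⟨i, _⟩ => i.elim0) (by omega)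
      · simp [isBreak] at hb
    · simp [occurs_1342_iff]
  | succ n ih =>
    obtain ⟨st, hst, hsum⟩ := ih
    set e := insertFirstEquiv n
    have he : ∀ x, e x = insertFirst x.1 x.2 := fun _ => rfl
    refine ⟨fun r => child 0 (st (e.symm r).2)
      ((e.symm r).1 - (n - windowSize (st (e.symm r).2))), fun r hr => ?_, fun φ => ?_⟩
    · obtain ⟨⟨f, p⟩, rfl⟩ := e.surjective r
      rw [he, occurs_insertFirst_iff, not_or] at hr
      have hW := hst p hr.1
      simp only [Equiv.symm_apply_apply]
      rw [he]
      refine topWindow_insertFirst hW ?_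
      have := hW.has231_iff f
      have := hr.2
      simp only at this
      by_contra!
      tauto
    · rw [Function.iterate_succ_apply, ← hsum, ← e.sum_comp, Fintype.sum_prod_type_right]
      refine Finset.sum_congr rfl fun p _ => ?_
      simp only [Equiv.symm_apply_apply]
      simp only [he, occurs_insertFirst_iff]
      by_cases hp : Occurs p (fun _ => True) ![0, 2, 3, 1]
      · simp [hp]
      · have hW := hst p hp
        have hN := hW.le
        simp only [hp, false_or, hW.has231_iff, if_false]
        rw [← sum_child, Fin.sum_univ_eq_sum_range (fun f => if f + windowSize (st p) < n then 0 else
          φ (child 0 (st p) (f - (n - windowSize (st p))))) (n + 1),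
          show n + 1 = n - windowSize (st p) + (windowSize (st p) + 1) by omega,
          Finset.sum_range_add, Finset.sum_eq_zero, zero_add]
        · refine Finset.sum_congr rfl fun g _ => ?_
          rw [if_neg (by omega), Nat.add_sub_cancel_left]
        · intro f hf
          rw [Finset.mem_range] at hf
          rw [if_pos (by omega)]

/-- The number of `1342`-avoiding permutations, computed through the generating tree. -/
theorem avoidCount_1342_eq (n : ℕ) :
    avoidCount n ![0, 2, 3, 1] = ((fun φ : List ℕ → ℕ => childSum φ 0)^[n] fun _ => 1) [] := by
  classical
  obtain ⟨st, -, h⟩ := exists_state n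
  rw [← h, avoidCount, Nat.card_eq_fintype_card, Fintype.card_subtype, Finset.card_filter]
  simp only [ite_not]

end StanleyWilf

namespace StanleyWilf
open scoped ENNReal

section levelSum

variable {R : Type*} [AddCommMonoid R]

/-- The sum of `φ` over the states of all nodes at level `n` of the generating tree. -/
def levelSum (n : ℕ) (φ : List ℕ → R) : R := ((fun φ => childSum φ 0)^[n] φ) []

theorem levelSum_zero (φ : List ℕ → R) : levelSum 0 φ = φ [] := rfl

theorem levelSum_succ (n : ℕ) (φ : List ℕ → R) :
    levelSum (n + 1) φ = levelSum n (childSum φ 0) := rfl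

theorem map_childSum {S : Type*} [AddCommMonoid S] (F : R →+ S) (φ : List ℕ → R) (acc : ℕ)
    (s : List ℕ) : F (childSum φ acc s) = childSum (fun t => F (φ t)) acc s := by
  induction s generalizing acc with
  | nil => rfl
  | cons a s ih => simp [childSum, ih]

theorem map_levelSum {S : Type*} [AddCommMonoid S] (F : R →+ S) (n : ℕ) (φ : List ℕ → R) :
    F (levelSum n φ) = levelSum n fun t => F (φ t) := by
  induction n generalizing φ with
  | zero => rfl
  | succ n ih =>
    rw [levelSum_succ, levelSum_succ, ih]
    congr 1
    ext s
    exact map_childSum F φ 0 s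

theorem childSum_zero (acc : ℕ) (s : List ℕ) : childSum (fun _ => (0 : R)) acc s = 0 :=
  (map_childSum (0 : R →+ R) (fun _ => 0) acc s).symm

theorem levelSum_const_zero (n : ℕ) : levelSum n (fun _ => (0 : R)) = 0 :=
  (map_levelSum (0 : R →+ R) n fun _ => 0).symm

theorem childSum_append_singleton (φ : List ℕ → R) (acc : ℕ) (d : List ℕ) (l : ℕ) :
    childSum φ acc (d ++ [l]) = childSum (fun c => φ (c ++ [l])) acc d +
      (∑ h ∈ Finset.range l, φ [0, h] + φ [acc + windowSize d + l + 1]) := by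
  induction d generalizing acc with
  | nil => simp [childSum, windowSize, add_assoc]
  | cons a s ih =>
    simp only [List.cons_append, childSum, ih, windowSize, add_assoc]

theorem windowSize_append_singleton (d : List ℕ) (l : ℕ) :
    windowSize (d ++ [l]) = windowSize d + (l + 1) := by
  induction d with
  | nil => simp [windowSize]
  | cons a s ih => simp only [List.cons_append, windowSize, ih]; omega

end levelSum

theorem tsum_childSum {ι : Type*} (φ : ι → List ℕ → ℝ≥0∞) (acc : ℕ) (s : List ℕ) :
    childSum (fun t => ∑' i, φ i t) acc s = ∑' i, childSum (φ i) acc s := by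
  induction s generalizing acc with
  | nil => rfl
  | cons a s ih =>
    simp only [childSum, ih, ENNReal.tsum_add]
    rw [Summable.tsum_finsetSum fun _ _ => ENNReal.summable]

theorem tsum_levelSum {ι : Type*} (n : ℕ) (φ : ι → List ℕ → ℝ≥0∞) :
    levelSum n (fun t => ∑' i, φ i t) = ∑' i, levelSum n (φ i) := by
  induction n generalizing φ with
  | zero => rfl
  | succ n ih =>
    simp only [levelSum_succ, ← ih]
    congr 1
    ext s
    exact tsum_childSum φ 0 s

/-- The indicator function of a state. -/
def indicator (t s : List ℕ) : ℝ≥0∞ := if s = t then 1 else 0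

theorem levelSum_eq_tsum (n : ℕ) (φ : List ℕ → ℝ≥0∞) :
    levelSum n φ = ∑' t, φ t * levelSum n (indicator t) := by
  have h : φ = fun s => ∑' t, φ t * indicator t s := by
    ext s
    rw [tsum_eq_single s fun t ht => by simp [indicator, ht.symm]]
    simp [indicator]
  conv_lhs => rw [h, tsum_levelSum]
  exact tsum_congr fun t => (map_levelSum (AddMonoidHom.mulLeft (φ t)) n (indicator t)).symm

theorem tsum_list_append_singleton (F : List ℕ → ℝ≥0∞) :
    ∑' s, F s = F [] + ∑' l, ∑' d, F (d ++ [l]) := by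
  rw [ENNReal.tsum_eq_add_tsum_ite []]
  congr 1
  have hinj : Function.Injective fun x : ℕ × List ℕ => x.2 ++ [x.1] := by
    rintro ⟨l, d⟩ ⟨l', d'⟩ h
    simpa [and_comm] using h
  rw [← hinj.tsum_eq, ENNReal.tsum_prod']
  · simp
  · intro s hs
    rcases s.eq_nil_or_concat with rfl | ⟨d, l, rfl⟩
    · simp at hs
    · exact ⟨(l, d), by simp⟩

theorem levelSum_indicator_nil (n : ℕ) : levelSum n (indicator []) = if n = 0 then 1 else 0 := by
  cases n with
  | zero => rfl
  | succ n =>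
    rw [levelSum_succ, if_neg n.succ_ne_zero]
    have : childSum (indicator []) 0 = fun _ => 0 := by
      have key : ∀ (s : List ℕ) (acc : ℕ), childSum (indicator []) acc s = 0 := by
        intro s
        induction s with
        | nil => simp [childSum, indicator]
        | cons a s ih => simp [childSum, indicator, ih]
      exact funext fun s => key s 0
    rw [this, levelSum_const_zero]

theorem childSum_indicator_singleton_zero : childSum (indicator [0]) 0 = indicator [] := by
  have key : ∀ (s : List ℕ) (acc : ℕ), 0 < acc → childSum (indicator [0]) acc s = 0 := by
    intro s
    induction s with
    | nil => intro acc h; simp [childSum, indicator, h.ne']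
    | cons a s ih => intro acc h; simp [childSum, indicator, ih]
  ext s
  cases s with
  | nil => simp [childSum, indicator]
  | cons a s => simp [childSum, indicator, key]

theorem childSum_indicator_append {c : List ℕ} (hc : c ≠ []) (hc0 : c ≠ [0]) (l l' : ℕ)
    (d : List ℕ) : childSum (indicator (c ++ [l])) 0 (d ++ [l']) =
      if l' = l then childSum (indicator c) 0 d else 0 := by
  have h0 : ∀ h, indicator (c ++ [l]) [0, h] = 0 := fun h => by
    have : ¬ [0, h] = c ++ [l] := fun h' => hc0 <| by
      have : [0] ++ [h] = c ++ [l] := h'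
      exact (List.append_inj' this rfl).1.symm
    simp [indicator, this]
  have h1 : ∀ h, indicator (c ++ [l]) [h] = 0 := fun h => by
    have : ¬ [h] = c ++ [l] := fun h' => hc <| by
      have : [] ++ [h] = c ++ [l] := h'
      exact (List.append_inj' this rfl).1.symm
    simp [indicator, this]
  rw [childSum_append_singleton, h1]
  simp only [h0, Finset.sum_const_zero, add_zero]
  split_ifs with h
  · subst h
    simp only [indicator, List.append_cancel_right_eq]
    rfl
  · have : (fun c' => indicator (c ++ [l]) (c' ++ [l'])) = fun _ => 0 := by
      ext c'
      simp [indicator, h]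
    rw [this, childSum_zero]

/-- Once the topmost summand of a state has split off, it does not interact with the others. -/
theorem levelSum_indicator_append {c : List ℕ} (hc : c ≠ []) (l n : ℕ) :
    levelSum n (indicator (c ++ [l])) = ∑ x ∈ Finset.HasAntidiagonal.antidiagonal n,
      levelSum x.1 (indicator c) * levelSum (x.2 + 1) (indicator [0, l]) := by
  induction n generalizing c with
  | zero => simp [levelSum_zero, indicator, hc.symm]
  | succ n ih =>
    rw [Finset.Nat.sum_antidiagonal_succ]
    have h0 : levelSum 0 (indicator c) = 0 := by simp [levelSum_zero, indicator, hc.symm]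
    rw [h0, zero_mul, zero_add]
    by_cases hc0 : c = [0]
    · subst hc0
      simp only [levelSum_succ _ (indicator [0]), childSum_indicator_singleton_zero,
        levelSum_indicator_nil]
      rw [Finset.sum_eq_single (0, n)]
      · simp
      · rintro ⟨i, j⟩ hij hne
        rw [Finset.HasAntidiagonal.mem_antidiagonal] at hij
        have : i ≠ 0 := by
          rintro rfl
          exact hne (by simpa using hij)
        simp [this]
      · simp
    · simp only [levelSum_succ _ (indicator c)]
      rw [levelSum_succ, levelSum_eq_tsum, tsum_list_append_singleton]
      have hnil : childSum (indicator (c ++ [l])) 0 [] = 0 := by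
        have : ¬ [0] = c ++ [l] := fun h' => hc <| by
          have : [] ++ [0] = c ++ [l] := h'
          exact (List.append_inj' this rfl).1.symm
        simp [childSum, indicator, this]
      simp only [hnil, zero_mul, zero_add, childSum_indicator_append hc hc0, ite_mul]
      rw [tsum_eq_single l fun l' hl' => by simp [hl']]
      simp only [if_true]
      have hd : ∀ d, childSum (indicator c) 0 d * levelSum n (indicator (d ++ [l])) =
          ∑ x ∈ Finset.HasAntidiagonal.antidiagonal n, childSum (indicator c) 0 d *
            levelSum x.1 (indicator d) * levelSum (x.2 + 1) (indicator [0, l]) := by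
        intro d
        by_cases hd : d = []
        · subst hd
          have : childSum (indicator c) 0 [] = 0 := by simp [childSum, indicator, Ne.symm hc0]
          simp [this]
        · rw [ih hd, Finset.mul_sum]
          simp only [mul_assoc]
      simp only [hd]
      rw [Summable.tsum_finsetSum fun _ _ => ENNReal.summable]
      refine Finset.sum_congr rfl fun x _ => ?_
      rw [ENNReal.tsum_mul_right, ← levelSum_eq_tsum]

end StanleyWilf

namespace StanleyWilf
open scoped ENNReal

/-- The generating function of the level sums of `φ`. -/
noncomputable def genFun (x : ℝ≥0∞) (φ : List ℕ → ℝ≥0∞) : ℝ≥0∞ := ∑' n, x ^ n * levelSum n φ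

theorem genFun_eq (x : ℝ≥0∞) (φ : List ℕ → ℝ≥0∞) :
    genFun x φ = φ [] + x * genFun x (childSum φ 0) := by
  rw [genFun, tsum_eq_zero_add' ENNReal.summable, genFun, ← ENNReal.tsum_mul_left]
  simp [levelSum_zero, levelSum_succ, pow_succ', mul_assoc]

theorem genFun_eq_tsum (x : ℝ≥0∞) (φ : List ℕ → ℝ≥0∞) :
    genFun x φ = ∑' t, φ t * genFun x (indicator t) := by
  simp only [genFun, ← ENNReal.tsum_mul_left]
  rw [ENNReal.tsum_comm]
  refine tsum_congr fun n => ?_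
  rw [levelSum_eq_tsum, ← ENNReal.tsum_mul_left]
  exact tsum_congr fun t => by ring

/-- The factor that a topmost summand of size `l + 1` contributes to the generating function of a
decomposable state. -/
noncomputable def topFactor (x : ℝ≥0∞) (l : ℕ) : ℝ≥0∞ :=
  ∑' j, x ^ j * levelSum (j + 1) (indicator [0, l])

theorem genFun_indicator_append (x : ℝ≥0∞) {c : List ℕ} (hc : c ≠ []) (l : ℕ) :
    genFun x (indicator (c ++ [l])) = genFun x (indicator c) * topFactor x l := by
  have h : ∀ n, x ^ n * levelSum n (indicator (c ++ [l])) =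
      ∑ p ∈ Finset.HasAntidiagonal.antidiagonal n, x ^ p.1 * levelSum p.1 (indicator c) *
        (x ^ p.2 * levelSum (p.2 + 1) (indicator [0, l])) := by
    intro n
    rw [levelSum_indicator_append hc, Finset.mul_sum]
    refine Finset.sum_congr rfl fun p hp => ?_
    rw [← Finset.HasAntidiagonal.mem_antidiagonal.1 hp, pow_add]
    ring
  simp only [genFun, topFactor, h]
  simp only [← ENNReal.tsum_mul_left, ← ENNReal.tsum_mul_right]
  rw [ENNReal.tsum_comm, ← ENNReal.tsum_prod,
    ← Finset.HasAntidiagonal.sigmaAntidiagonalEquivProd.tsum_eq,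
    ENNReal.tsum_sigma']
  refine tsum_congr fun n => ?_
  rw [← Finset.tsum_subtype']
  rfl

/-- The generating function of a nonempty state. -/
noncomputable def posPart (x : ℝ≥0∞) (d : List ℕ) : ℝ≥0∞ :=
  if d = [] then 0 else genFun x (indicator d)

theorem genFun_indicator_nil (x : ℝ≥0∞) : genFun x (indicator []) = 1 := by
  rw [genFun, tsum_eq_single 0 fun n hn => by simp [levelSum_indicator_nil, hn]]
  simp [levelSum_indicator_nil]

theorem genFun_indicator_singleton_zero (x : ℝ≥0∞) : genFun x (indicator [0]) = x := by
  rw [genFun_eq, childSum_indicator_singleton_zero, genFun_indicator_nil]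
  simp [indicator]

theorem genFun_eq_add_tsum_posPart (x : ℝ≥0∞) (ψ : List ℕ → ℝ≥0∞) :
    genFun x ψ = ψ [] + ∑' d, ψ d * posPart x d := by
  rw [genFun_eq_tsum, ENNReal.tsum_eq_add_tsum_ite [], genFun_indicator_nil, mul_one]
  congr 1
  exact tsum_congr fun d => by simp [posPart]

theorem genFun_eq_add_tsum_append (x : ℝ≥0∞) (φ : List ℕ → ℝ≥0∞) :
    genFun x φ = φ [] + ∑' l, (φ [l] * genFun x (indicator [l]) +
      (∑' d, φ (d ++ [l]) * posPart x d) * topFactor x l) := by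
  rw [genFun_eq_tsum, tsum_list_append_singleton, genFun_indicator_nil, mul_one]
  congr 1
  refine tsum_congr fun l => ?_
  rw [ENNReal.tsum_eq_add_tsum_ite [], ← ENNReal.tsum_mul_right]
  refine congrArg₂ (· + ·) rfl (tsum_congr fun d => ?_)
  by_cases hd : d = []
  · simp [hd, posPart]
  · simp [hd, posPart, genFun_indicator_append x hd, mul_assoc]

theorem childSum_singleton_pow (z : ℝ≥0∞) (acc : ℕ) (s : List ℕ) :
    childSum (fun s => if s.length = 1 then z ^ s.headI else 0) acc s =
      z ^ (acc + windowSize s) := by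
  induction s generalizing acc with
  | nil => simp [childSum, windowSize]
  | cons a s ih => simp [childSum, windowSize, ih, add_assoc]

theorem tsum_pow_mul_genFun_indicator (x z : ℝ≥0∞) :
    ∑' l, z ^ l * genFun x (indicator [l]) = x * genFun x fun s => z ^ windowSize s := by
  have h := genFun_eq_add_tsum_append x fun s => if s.length = 1 then z ^ s.headI else 0
  have h' := genFun_eq x fun s => if s.length = 1 then z ^ s.headI else 0
  have hd : ∀ l d, (if (d ++ [l]).length = 1 then z ^ (d ++ [l]).headI else 0) * posPart x d = 0 := by
    intro l d
    by_cases hd : d = []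
    · simp [hd, posPart]
    · simp [hd]
  simp only [hd, tsum_zero, zero_mul, add_zero] at h
  rw [h'] at h
  simpa [funext (childSum_singleton_pow z 0)] using h.symm

theorem genFun_pow_windowSize (x z : ℝ≥0∞) :
    ∑' d, z ^ windowSize d * posPart x d =
      z * (x * (1 + ∑' d, z ^ windowSize d * posPart x d)) +
        z * (∑' d, z ^ windowSize d * posPart x d) * ∑' l, z ^ l * topFactor x l := by
  have h := genFun_eq_add_tsum_append x fun s => z ^ windowSize s
  have h' := genFun_eq_add_tsum_posPart x fun s => z ^ windowSize s
  have h'' := tsum_pow_mul_genFun_indicator x z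
  rw [h'] at h h''
  simp only [windowSize, pow_zero] at h h''
  rw [ENNReal.add_right_inj ENNReal.one_ne_top] at h
  rw [← h'']
  refine h.trans ?_
  rw [ENNReal.tsum_add, ← ENNReal.tsum_mul_left, ← ENNReal.tsum_mul_left]
  refine congrArg₂ (· + ·) (tsum_congr fun l => by ring) (tsum_congr fun l => ?_)
  have hd : ∀ d, z ^ windowSize (d ++ [l]) * posPart x d =
      z ^ windowSize d * posPart x d * z ^ (l + 1) := fun d => by
    rw [windowSize_append_singleton, pow_add]
    ring
  simp only [hd, ENNReal.tsum_mul_right]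
  ring

theorem childSum_pair_pow (z : ℝ≥0∞) (l : ℕ) (d : List ℕ) :
    childSum (fun s => if s.dropLast = [0] then z ^ s.getLastI else 0) 0 (d ++ [l]) =
      z ^ l * indicator [] d + ∑ h ∈ Finset.range l, z ^ h := by
  rw [childSum_append_singleton, ← childSum_indicator_singleton_zero]
  refine congrArg₂ (· + ·) ?_ ?_
  · rw [← AddMonoidHom.coe_mulLeft, map_childSum]
    congr 1
    ext c
    simp [indicator, List.getLastI_eq_getLast?_getD]
  · simp [List.getLastI]

theorem tsum_pow_mul_topFactor {x : ℝ≥0∞} (hx0 : x ≠ 0) (hx : x ≠ ∞) (z : ℝ≥0∞) :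
    ∑' l, z ^ l * topFactor x l = ∑' l, z ^ l * genFun x (indicator [l]) +
      ∑' l, (∑ h ∈ Finset.range l, z ^ h) * genFun x (indicator [l]) +
      (∑' d, posPart x d) * ∑' l, (∑ h ∈ Finset.range l, z ^ h) * topFactor x l := by
  set φ : List ℕ → ℝ≥0∞ := fun s => if s.dropLast = [0] then z ^ s.getLastI else 0 with hφ
  have h1 : genFun x φ = x * ∑' l, z ^ l * topFactor x l := by
    rw [genFun_eq_add_tsum_append, ← ENNReal.tsum_mul_left]
    have : φ [] = 0 := by simp [hφ]
    rw [this, zero_add]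
    refine tsum_congr fun l => ?_
    have : φ [l] = 0 := by simp [hφ]
    rw [this, zero_mul, zero_add, tsum_eq_single [0] fun d hd => by simp [hφ, hd]]
    simp [hφ, posPart, genFun_indicator_singleton_zero, List.getLastI]
    ring
  have h2 : genFun x φ = x * genFun x (childSum φ 0) := by
    rw [genFun_eq]
    simp [hφ]
  rw [h1, ENNReal.mul_right_inj hx0 hx] at h2
  rw [h2, genFun_eq_add_tsum_append, ← ENNReal.tsum_mul_left, ← ENNReal.tsum_add,
    ← ENNReal.tsum_add]
  have : childSum φ 0 [] = 0 := by simp [childSum, hφ]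
  rw [this, zero_add]
  refine tsum_congr fun l => ?_
  have h3 : childSum φ 0 [l] = z ^ l + ∑ h ∈ Finset.range l, z ^ h := by
    simpa [indicator] using childSum_pair_pow z l []
  have h4 : ∀ d, childSum φ 0 (d ++ [l]) * posPart x d =
      (∑ h ∈ Finset.range l, z ^ h) * posPart x d := by
    intro d
    rw [hφ, childSum_pair_pow]
    by_cases hd : d = []
    · simp [hd, posPart]
    · simp [indicator, hd]
  simp only [h3, h4, ENNReal.tsum_mul_left]
  ring

theorem tsum_add_one_pow_mul (w : ℝ≥0∞) (g : ℕ → ℝ≥0∞) :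
    ∑' l, (w + 1) ^ l * g l = ∑' l, g l + w * ∑' l, (∑ h ∈ Finset.range l, (w + 1) ^ h) * g l := by
  rw [← ENNReal.tsum_mul_left, ← ENNReal.tsum_add]
  refine tsum_congr fun l => ?_
  rw [← geom_sum_mul_add w l]
  ring

theorem genFun_functional_equation {x w : ℝ≥0∞} (hx0 : x ≠ 0) (hx : x ≠ ∞) (hw0 : w ≠ 0)
    (hw : w ≠ ∞) (hP : (genFun x fun s => (w + 1) ^ windowSize s) ≠ ∞) :
    let P := (genFun x fun s => (w + 1) ^ windowSize s).toReal
    let S := (genFun x fun _ => 1).toReal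
    let z := (w + 1).toReal
    S * (z - 1) * (P - 1) = x.toReal * z * P * (z * P - S) := by
  intro P S z
  have hw1 : w + 1 ≠ ∞ := by simp [hw]
  have p1 := genFun_pow_windowSize x (w + 1)
  have p2 := genFun_pow_windowSize x 1
  have p3 := tsum_pow_mul_topFactor hx0 hx (w + 1)
  have p4 := tsum_pow_mul_genFun_indicator x (w + 1)
  have p5 := tsum_pow_mul_genFun_indicator x 1
  have p6 := tsum_add_one_pow_mul w fun l => genFun x (indicator [l])
  have p7 := tsum_add_one_pow_mul w (topFactor x)
  have p8 := genFun_eq_add_tsum_posPart x fun s => (w + 1) ^ windowSize s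
  have p9 := genFun_eq_add_tsum_posPart x fun s => 1
  simp only [one_pow, one_mul, windowSize, pow_zero] at p2 p5 p8 p9
  simp only [P, S, z]
  rw [p4] at p6 p3
  rw [p5] at p6
  rw [p8] at p3 p6 hP ⊢
  rw [p9] at p6 ⊢
  clear p4 p5 p8 p9
  generalize (∑' d, (w + 1) ^ windowSize d * posPart x d) = P0 at *
  generalize (∑' d, posPart x d) = S0 at *
  generalize (∑' l, (w + 1) ^ l * topFactor x l) = F at *
  generalize (∑' l, topFactor x l) = F1 at *
  generalize (∑' l, (∑ h ∈ Finset.range l, (w + 1) ^ h) * topFactor x l) = B at *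
  generalize (∑' l, (∑ h ∈ Finset.range l, (w + 1) ^ h) * genFun x (indicator [l])) = A at *
  have hP0 : P0 ≠ ∞ := fun h => hP (by simp [h])
  have hP00 : P0 ≠ 0 := by
    rw [p1]
    simp [hx0]
  have hxP : x * (1 + P0) ≠ ∞ := ENNReal.mul_ne_top hx hP
  have hF : F ≠ ∞ := fun h => by
    rw [h, ENNReal.mul_top (by simp [hP00])] at p1
    exact hP0 (by rw [p1]; simp)
  have hS0 : S0 ≠ ∞ := fun h => by
    rw [h] at p6
    exact hxP (by rw [p6]; simp [ENNReal.mul_top hx0])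
  have hA : A ≠ ∞ := fun h => hF (by rw [p3, h]; simp)
  have hF1 : F1 ≠ ∞ := fun h => hF (by rw [p7, h]; simp)
  have hB : B ≠ ∞ := fun h => hF (by rw [p7, h, ENNReal.mul_top hw0]; simp)
  lift P0 to NNReal using hP0
  lift S0 to NNReal using hS0
  lift F to NNReal using hF
  lift F1 to NNReal using hF1
  lift A to NNReal using hA
  lift B to NNReal using hB
  lift x to NNReal using hx
  lift w to NNReal using hw
  have q : ∀ r : NNReal, ((1 : ℝ≥0∞) + r).toReal = 1 + r := fun r => by
    rw [ENNReal.toReal_add (by simp) (by simp)]; simp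
  have q' : ((w : ℝ≥0∞) + 1).toReal = w + 1 := by rw [add_comm, q, add_comm]
  rw [q, q, q']
  norm_cast at p1 p2 p3 p6 p7
  replace p1 := congrArg NNReal.toReal p1
  replace p2 := congrArg NNReal.toReal p2
  replace p3 := congrArg NNReal.toReal p3
  replace p6 := congrArg NNReal.toReal p6
  replace p7 := congrArg NNReal.toReal p7
  push_cast at p1 p2 p3 p6 p7
  simp only [ENNReal.coe_toReal]
  generalize (P0 : ℝ) = P0 at *
  generalize (S0 : ℝ) = S0 at *
  generalize (F : ℝ) = F at *
  generalize (F1 : ℝ) = F1 at *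
  generalize (A : ℝ) = A at *
  generalize (B : ℝ) = B at *
  generalize (x : ℝ) = x at *
  generalize (w : ℝ) = w at *
  have key : (w - S0) * F = (w + 1) * x * (1 + P0) - S0 := by
    linear_combination w * p3 - p6 - S0 * p7 + p2
  linear_combination (w - S0) * p1 + (w + 1) * P0 * key

end StanleyWilf

namespace StanleyWilf
open scoped ENNReal

section order

variable {R : Type*} [AddCommMonoid R] [PartialOrder R] [IsOrderedAddMonoid R]

theorem childSum_le_childSum {φ ψ : List ℕ → R} (h : ∀ s, φ s ≤ ψ s) (acc : ℕ) (s : List ℕ) :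
    childSum φ acc s ≤ childSum ψ acc s := by
  induction s generalizing acc with
  | nil => exact h _
  | cons a s ih =>
    exact add_le_add (add_le_add (h _) (Finset.sum_le_sum fun _ _ => h _)) (ih _)

theorem levelSum_le_levelSum {φ ψ : List ℕ → R} (h : ∀ s, φ s ≤ ψ s) (n : ℕ) :
    levelSum n φ ≤ levelSum n ψ := by
  induction n generalizing φ ψ with
  | zero => exact h _
  | succ n ih => exact ih fun s => childSum_le_childSum h 0 s

end order

theorem childSum_two_pow_le (acc : ℕ) (s : List ℕ) :
    childSum (fun s => 2 ^ windowSize s * 2 ^ s.length) acc s ≤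
      (8 * 2 ^ acc + 8) * (2 ^ windowSize s * 2 ^ s.length) := by
  induction s generalizing acc with
  | nil =>
    simp only [childSum, windowSize, List.length_cons, List.length_nil]
    ring_nf
    omega
  | cons a s ih =>
    have h1 : ∑ h ∈ Finset.range a, 2 ^ windowSize (0 :: h :: s) * 2 ^ (0 :: h :: s).length + 16 *
        (2 ^ windowSize s * 2 ^ s.length) = 16 * 2 ^ a * (2 ^ windowSize s * 2 ^ s.length) := by
      have h2 : ∀ h, 2 ^ windowSize (0 :: h :: s) * 2 ^ (0 :: h :: s).length =
          2 ^ h * (16 * (2 ^ windowSize s * 2 ^ s.length)) := fun h => by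
        simp only [windowSize, List.length_cons]
        ring
      simp only [h2]
      rw [← Finset.sum_mul]
      have := geom_sum_mul_add 1 a
      norm_num at this
      rw [← this]
      ring
    have h3 := ih (acc + a + 1)
    simp only [childSum]
    simp only [windowSize, List.length_cons, pow_add] at h1 h3 ⊢
    generalize 2 ^ windowSize s = W at *
    generalize 2 ^ s.length = L at *
    generalize 2 ^ a = v at *
    generalize 2 ^ acc = u at *
    linarith [Nat.zero_le (v * (W * L)), Nat.zero_le (W * L)]

theorem levelSum_two_pow_le (n : ℕ) :
    levelSum n (fun s => 2 ^ windowSize s * 2 ^ s.length) ≤ 16 ^ n := by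
  induction n with
  | zero => simp [levelSum_zero, windowSize]
  | succ n ih =>
    rw [levelSum_succ]
    refine (levelSum_le_levelSum (childSum_two_pow_le 0) n).trans ?_
    have := map_levelSum (AddMonoidHom.mulLeft 16) n
      (fun s : List ℕ => 2 ^ windowSize s * 2 ^ s.length)
    simp only [AddMonoidHom.coe_mulLeft] at this
    norm_num
    rw [← this, pow_succ']
    exact Nat.mul_le_mul_left _ ih

/-- The distribution polynomial of the size of the top window on `1342`-avoiding permutations of
length `n`. -/
noncomputable def windowPoly (n : ℕ) (z : ℝ) : ℝ := levelSum n fun s => z ^ windowSize s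

theorem windowPoly_one (n : ℕ) : windowPoly n 1 = avoidCount n ![0, 2, 3, 1] := by
  rw [avoidCount_1342_eq]
  have h := map_levelSum (Nat.castAddMonoidHom ℝ) n fun _ => 1
  simp only [windowPoly, one_pow, Nat.coe_castAddMonoidHom, Nat.cast_one] at h ⊢
  exact h.symm

theorem windowPoly_nonneg (n : ℕ) {z : ℝ} (hz : 0 ≤ z) : 0 ≤ windowPoly n z :=
  (levelSum_const_zero n).symm.le.trans (levelSum_le_levelSum (fun _ => by positivity) n)

theorem windowPoly_le (n : ℕ) {z : ℝ} (hz : 0 ≤ z) (hz2 : z ≤ 2) : windowPoly n z ≤ 16 ^ n := by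
  have h1 : ((levelSum n fun s => 2 ^ windowSize s * 2 ^ s.length : ℕ) : ℝ) ≤ 16 ^ n := by
    exact_mod_cast levelSum_two_pow_le n
  refine le_trans ?_ h1
  have h2 := map_levelSum (Nat.castAddMonoidHom ℝ) n fun s => 2 ^ windowSize s * 2 ^ s.length
  rw [Nat.coe_castAddMonoidHom] at h2
  rw [h2]
  refine levelSum_le_levelSum (fun s => ?_) n
  push_cast
  calc z ^ windowSize s ≤ 2 ^ windowSize s := by gcongr
    _ ≤ 2 ^ windowSize s * 2 ^ s.length :=
      le_mul_of_one_le_right (by positivity) (one_le_pow₀ one_le_two)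

theorem continuous_windowPoly (n : ℕ) : Continuous (windowPoly n) := by
  have h1 : ∀ φ : ℝ → List ℕ → ℝ, (∀ s, Continuous fun z => φ z s) → ∀ (s : List ℕ) (acc : ℕ),
      Continuous fun z => childSum (φ z) acc s := by
    intro φ hφ s
    induction s with
    | nil => exact fun acc => hφ _
    | cons a s ih =>
      exact fun acc => ((hφ _).add (continuous_finsetSum _ fun _ _ => hφ _)).add (ih _)
  have h2 : ∀ φ : ℝ → List ℕ → ℝ, (∀ s, Continuous fun z => φ z s) →
      Continuous fun z => levelSum n (φ z) := by
    induction n with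
    | zero => exact fun φ hφ => hφ _
    | succ n ih => exact fun φ hφ => ih _ fun s => h1 φ hφ s 0
  exact h2 _ fun s => continuous_pow _

theorem pow_mul_windowPoly_le {x z : ℝ} (hx : 0 ≤ x) (hz : 0 ≤ z) (hz2 : z ≤ 2) (n : ℕ) :
    x ^ n * windowPoly n z ≤ (16 * x) ^ n := by
  rw [mul_pow, mul_comm]
  exact mul_le_mul_of_nonneg_right (windowPoly_le n hz hz2) (by positivity)

theorem summable_windowPoly {x z : ℝ} (hx : 0 ≤ x) (hx' : 16 * x < 1) (hz : 0 ≤ z) (hz2 : z ≤ 2) :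
    Summable fun n => x ^ n * windowPoly n z :=
  Summable.of_nonneg_of_le (fun n => mul_nonneg (by positivity) (windowPoly_nonneg n hz))
    (pow_mul_windowPoly_le hx hz hz2) (summable_geometric_of_lt_one (by positivity) hx')

theorem genFun_coe {x z : NNReal} (hx : 16 * (x : ℝ) < 1) (hz : (z : ℝ) ≤ 2) :
    (genFun x fun s => (z : ℝ≥0∞) ^ windowSize s) ≠ ∞ ∧
      (genFun x fun s => (z : ℝ≥0∞) ^ windowSize s).toReal = ∑' n, (x : ℝ) ^ n * windowPoly n z := by
  have h1 : ∀ n, windowPoly n z = ((levelSum n fun s => z ^ windowSize s : NNReal) : ℝ) := fun n => by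
    simpa [windowPoly] using
      (map_levelSum NNReal.toRealHom.toAddMonoidHom n fun s => z ^ windowSize s).symm
  have h2 : ∀ n, (levelSum n fun s => (z : ℝ≥0∞) ^ windowSize s) =
      ((levelSum n fun s => z ^ windowSize s : NNReal) : ℝ≥0∞) := fun n => by
    refine Eq.trans ?_
      (map_levelSum ENNReal.ofNNRealHom.toAddMonoidHom n fun s => z ^ windowSize s).symm
    congr 1
  have h3 := summable_windowPoly x.2 hx z.2 hz
  have h4 : genFun x (fun s => (z : ℝ≥0∞) ^ windowSize s) =
      ∑' n, ((x ^ n * levelSum n fun s => z ^ windowSize s : NNReal) : ℝ≥0∞) := by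
    rw [genFun]
    refine tsum_congr fun n => ?_
    rw [h2]
    push_cast
    rfl
  rw [h4]
  constructor
  · rw [ENNReal.tsum_coe_ne_top_iff_summable, ← NNReal.summable_coe]
    simpa [h1] using h3
  · rw [ENNReal.tsum_toReal_eq fun _ => ENNReal.coe_ne_top]
    exact tsum_congr fun n => by simp [h1]

theorem windowPoly_functional_equation {x z : ℝ} (hx0 : 0 < x) (hx : 16 * x < 1) (hz : 1 < z)
    (hz2 : z ≤ 2) :
    (∑' n, x ^ n * windowPoly n 1) * (z - 1) * (∑' n, x ^ n * windowPoly n z - 1) =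
      x * z * (∑' n, x ^ n * windowPoly n z) *
        (z * ∑' n, x ^ n * windowPoly n z - ∑' n, x ^ n * windowPoly n 1) := by
  lift x to NNReal using hx0.le
  obtain ⟨w, rfl⟩ : ∃ w : NNReal, z = ((w + 1 : NNReal) : ℝ) :=
    ⟨(z - 1).toNNReal, by simp [Real.coe_toNNReal (z - 1) (by linarith)]⟩
  have hw : w ≠ 0 := by
    rintro rfl
    simp at hz
  obtain ⟨hP, hP'⟩ := genFun_coe hx hz2
  have hS' := (genFun_coe (x := x) (z := 1) hx (by norm_num)).2
  have h := genFun_functional_equation (x := x) (w := w) (by simpa using hx0.ne') (by simp)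
    (by simpa using hw) (by simp) (by simpa using hP)
  simp only [ENNReal.coe_one, one_pow, NNReal.coe_one] at hS'
  rw [ENNReal.coe_add, ENNReal.coe_one] at hP'
  simp only [hS', hP'] at h
  simpa [ENNReal.toReal_add] using h

end StanleyWilf

namespace StanleyWilf

open Topology

/-- The sequence counting the `1342`-avoiding permutations has generating function
`(1 - 2 * y) / (1 - y) ^ 3` under the substitution `x = y * (1 - 2 * y)`. -/
theorem exists_eq_tsum_windowPoly {x : ℝ} (hx0 : 0 < x) (hx : x ≤ 1 / 100) :
    ∃ y : ℝ, 0 < y ∧ y < 1 / 4 ∧ x = y * (1 - 2 * y) ∧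
      ∑' n, x ^ n * windowPoly n 1 = (1 - 2 * y) / (1 - y) ^ 3 := by
  have hx16 : 16 * x < 1 := by linarith
  set P : ℝ → ℝ := fun z => ∑' n, x ^ n * windowPoly n z with hP
  have hcont : ContinuousOn P (Set.Icc 0 2) := by
    refine continuousOn_tsum (u := fun n => (16 * x) ^ n)
      (fun n => (continuous_const.mul (continuous_windowPoly n)).continuousOn)
      (summable_geometric_of_lt_one (by positivity) hx16) fun n z hz => ?_
    rw [Real.norm_of_nonneg (mul_nonneg (by positivity) (windowPoly_nonneg n hz.1))]
    exact pow_mul_windowPoly_le hx0.le hz.1 hz.2 n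
  have hPle : ∀ z ∈ Set.Icc (0 : ℝ) 2, P z * (1 - 16 * x) ≤ 1 := fun z hz => by
    have h := (summable_windowPoly hx0.le hx16 hz.1 hz.2).tsum_le_tsum
      (pow_mul_windowPoly_le hx0.le hz.1 hz.2) (summable_geometric_of_lt_one (by positivity) hx16)
    rw [tsum_geometric_of_lt_one (by positivity) hx16] at h
    rwa [← le_div_iff₀ (by linarith), one_div]
  have hS : 1 ≤ P 1 := by
    have h := (summable_windowPoly hx0.le hx16 zero_le_one one_le_two).sum_le_tsum {0}
      fun n _ => mul_nonneg (by positivity) (windowPoly_nonneg n zero_le_one)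
    simpa [hP, windowPoly, levelSum_zero, windowSize] using h
  have heq : ∀ z, 1 < z → z ≤ 2 → P 1 * (z - 1) * (P z - 1) = x * z * P z * (z * P z - P 1) :=
    fun z hz hz2 => windowPoly_functional_equation hx0 hx16 hz hz2
  change ∃ y : ℝ, 0 < y ∧ y < 1 / 4 ∧ x = y * (1 - 2 * y) ∧ P 1 = (1 - 2 * y) / (1 - y) ^ 3
  generalize hS' : P 1 = S at *
  set H : ℝ → ℝ := fun z => 2 * x * z ^ 2 * P z + S * (1 - z - x * z) with hH
  have hHcont : ContinuousOn H (Set.Icc 1 (1 + 2 * x)) := by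
    have := hcont.mono (Set.Icc_subset_Icc zero_le_one (by linarith : 1 + 2 * x ≤ 2))
    fun_prop
  have h1 : 0 < H 1 := by
    simp only [hH, hS']
    nlinarith
  have h2 : H (1 + 2 * x) < 0 := by
    have h := hPle (1 + 2 * x) ⟨by linarith, by linarith⟩
    have h' : 2 * x * (1 + 2 * x) ^ 2 * P (1 + 2 * x) * (1 - 16 * x) ≤ 2 * x * (1 + 2 * x) ^ 2 := by
      have := mul_le_mul_of_nonneg_left h (by positivity : 0 ≤ 2 * x * (1 + 2 * x) ^ 2)
      linarith
    have h3 : H (1 + 2 * x) * (1 - 16 * x) < 0 := by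
      simp only [hH]
      have h4 : 2 * x * (1 + 2 * x) ^ 2 < x * (3 + 2 * x) * (1 - 16 * x) := by
        have : 54 * x + 40 * x ^ 2 < 1 := by nlinarith
        nlinarith
      have h5 : x * (3 + 2 * x) * (1 - 16 * x) ≤ S * (x * (3 + 2 * x) * (1 - 16 * x)) :=
        le_mul_of_one_le_left (by nlinarith) hS
      nlinarith
    by_contra! h4
    nlinarith
  obtain ⟨Z, hZ, hHZ⟩ := intermediate_value_Icc' (by linarith) hHcont ⟨h2.le, h1.le⟩
  have hZ1 : 1 < Z := lt_of_le_of_ne hZ.1 (by rintro rfl; linarith)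
  have hZ2 : Z < 1 + 2 * x := lt_of_le_of_ne hZ.2 (by rintro rfl; linarith)
  set Δ : ℝ → ℝ := fun z => S ^ 2 * (1 - z - x * z) ^ 2 + 4 * x * z ^ 2 * S * (1 - z) with hΔ
  have hsq : ∀ z, 1 < z → z ≤ 2 → H z ^ 2 = Δ z := fun z hz hz2 => by
    simp only [hH, hΔ]
    linear_combination -4 * x * z ^ 2 * heq z hz hz2
  have hmin : IsLocalMin Δ Z := by
    filter_upwards [Ioo_mem_nhds hZ1 (show Z < 2 by linarith)] with z hz
    rw [← hsq Z hZ1 (by linarith), ← hsq z hz.1 hz.2.le, hHZ, zero_pow two_ne_zero]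
    exact sq_nonneg _
  have hderiv : HasDerivAt Δ (S ^ 2 * (2 * (1 - Z - x * Z) * (-1 - x)) +
      (8 * x * Z * S * (1 - Z) - 4 * x * Z ^ 2 * S)) Z := by
    have h3 : HasDerivAt (fun z : ℝ => 1 - z - x * z) (-1 - x) Z := by
      simpa using (((hasDerivAt_id Z).const_sub 1).fun_sub ((hasDerivAt_id Z).const_mul x))
    have h4 := ((h3.fun_pow 2).const_mul (S ^ 2)).fun_add
      ((((hasDerivAt_pow 2 Z).const_mul (4 * x)).mul_const S).fun_mul ((hasDerivAt_id Z).const_sub 1))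
    refine h4.congr_deriv ?_
    simp
    ring
  have hd0 := hmin.hasDerivAt_eq_zero hderiv
  have hΔ0 : Δ Z = 0 := by rw [← hsq Z hZ1 (by linarith), hHZ]; ring
  simp only [hΔ] at hΔ0
  have hS0 : S ≠ 0 := by linarith
  have hZ0 : Z ≠ 0 := by linarith
  have e1 : S * (Z * (1 + x) - 1) ^ 2 = 4 * x * Z ^ 2 * (Z - 1) :=
    mul_left_cancel₀ hS0 (by linear_combination hΔ0)
  have e2 : S * (1 + x) * (Z * (1 + x) - 1) = 2 * x * Z * (3 * Z - 2) :=
    mul_left_cancel₀ hS0 (by linear_combination hd0 / 2)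
  have e3 : (1 + x) * Z ^ 2 = 3 * Z - 2 := by
    have : x * Z ≠ 0 := mul_ne_zero hx0.ne' hZ0
    refine mul_left_cancel₀ this ?_
    linear_combination (1 + x) / 2 * e1 - (Z * (1 + x) - 1) / 2 * e2
  have e4 : S = Z ^ 2 * (2 - Z) := by
    have : (Z - 1) ^ 2 ≠ 0 := pow_ne_zero 2 (by linarith)
    refine mul_left_cancel₀ this ?_
    linear_combination Z ^ 2 / 4 * e1 + (Z ^ 2 * (Z - 1) - S / 4 * ((1 + x) * Z ^ 2 + Z - 2)) * e3
  have hZpos : 0 < Z := by linarith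
  refine ⟨1 - 1 / Z, ?_, ?_, ?_, ?_⟩
  · rw [sub_pos, div_lt_one hZpos]
    exact hZ1
  · have : 3 / 4 < 1 / Z := by
      rw [div_lt_div_iff₀ (by norm_num) hZpos]
      linarith
    linarith
  · field_simp
    linear_combination e3
  · rw [e4]
    field_simp
    ring

end StanleyWilf

namespace StanleyWilf

open Filter Topology
open scoped NNReal ENNReal

section powerSeries

variable {𝕜 : Type*} [RCLike 𝕜]

/-- The power series whose coefficients count the `1342`-avoiding permutations. -/
noncomputable def avoidSeries (𝕜 : Type*) [RCLike 𝕜] : FormalMultilinearSeries 𝕜 𝕜 𝕜 :=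
  .ofScalars 𝕜 fun n => (avoidCount n ![0, 2, 3, 1] : 𝕜)

theorem norm_avoidSeries (n : ℕ) : ‖avoidSeries 𝕜 n‖ = avoidCount n ![0, 2, 3, 1] := by
  rw [avoidSeries, FormalMultilinearSeries.ofScalars_norm, RCLike.norm_natCast]

theorem avoidSeries_sum (x : 𝕜) :
    (avoidSeries 𝕜).sum x = ∑' n, (avoidCount n ![0, 2, 3, 1] : 𝕜) * x ^ n := by
  rw [avoidSeries]
  exact FormalMultilinearSeries.ofScalars_sum_eq _ x

theorem inv_le_avoidSeries_radius {c : ℝ≥0} (hc : 0 < c)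
    (h : ∀ n, (avoidCount n ![0, 2, 3, 1] : ℝ) ≤ c ^ n) :
    ((c⁻¹ : ℝ≥0) : ℝ≥0∞) ≤ (avoidSeries 𝕜).radius := by
  refine FormalMultilinearSeries.le_radius_of_bound _ 1 fun n => ?_
  have : (0 : ℝ) < c := hc
  rw [norm_avoidSeries, NNReal.coe_inv, inv_pow, ← div_eq_mul_inv, div_le_one (by positivity)]
  exact h n

theorem avoidCount_le_pow (n : ℕ) : (avoidCount n ![0, 2, 3, 1] : ℝ) ≤ 16 ^ n := by
  rw [← windowPoly_one]
  exact windowPoly_le n zero_le_one one_le_two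

theorem avoidSeries_radius_pos : 0 < (avoidSeries 𝕜).radius :=
  lt_of_lt_of_le (by simp) (inv_le_avoidSeries_radius (c := 16) (by simp) avoidCount_le_pow)

end powerSeries

theorem exists_eq_avoidSeries_sum {x : ℝ} (hx0 : 0 < x) (hx : x ≤ 1 / 100) :
    ∃ y : ℝ, 0 < y ∧ y < 1 / 4 ∧ x = y * (1 - 2 * y) ∧
      (avoidSeries ℝ).sum x = (1 - 2 * y) / (1 - y) ^ 3 := by
  obtain ⟨y, hy, hy', hxy, h⟩ := exists_eq_tsum_windowPoly hx0 hx
  refine ⟨y, hy, hy', hxy, ?_⟩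
  rw [← h, avoidSeries_sum]
  exact tsum_congr fun n => by rw [windowPoly_one, mul_comm]

/-- The analytic continuation of the generating function of the `1342`-avoiding permutations. -/
noncomputable def closedForm (x : ℂ) : ℂ :=
  (1 - 2 * ((1 - (1 - 8 * x) ^ (1 / 2 : ℂ)) / 4)) / (1 - (1 - (1 - 8 * x) ^ (1 / 2 : ℂ)) / 4) ^ 3

theorem closedForm_eq {x : ℝ} (hx0 : 0 < x) (hx : x ≤ 1 / 100) :
    closedForm x = (avoidSeries ℂ).sum x := by
  obtain ⟨y, hy, hy', hxy, h⟩ := exists_eq_avoidSeries_sum hx0 hx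
  have h1 : (avoidSeries ℂ).sum x = ((avoidSeries ℝ).sum x : ℝ) := by
    rw [avoidSeries_sum, avoidSeries_sum]
    push_cast
    rfl
  have h2 : (1 - 8 * (x : ℂ)) ^ (1 / 2 : ℂ) = ((1 - 4 * y : ℝ) : ℂ) := by
    have h3 : √(1 - 8 * x) = 1 - 4 * y := by
      rw [show 1 - 8 * x = (1 - 4 * y) ^ 2 by rw [hxy]; ring, Real.sqrt_sq (by linarith)]
    rw [← h3, Real.sqrt_eq_rpow, Complex.ofReal_cpow (by linarith)]
    push_cast
    rfl
  rw [h1, h, closedForm, h2]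
  push_cast
  congr 2 <;> ring

theorem differentiableOn_closedForm : DifferentiableOn ℂ closedForm (Metric.ball 0 (1 / 8)) := by
  intro x hx
  have hx' : 0 < (1 - 8 * x).re := by
    have h1 := Complex.re_le_norm x
    rw [mem_ball_zero_iff] at hx
    simp
    linarith
  have hslit : 1 - 8 * x ∈ Complex.slitPlane := Or.inl hx'
  have h1 : DifferentiableAt ℂ (fun x : ℂ => (1 - 8 * x) ^ (1 / 2 : ℂ)) x :=
    DifferentiableAt.cpow (by fun_prop) (by fun_prop) hslit
  have h2 : 1 - (1 - (1 - 8 * x) ^ (1 / 2 : ℂ)) / 4 ≠ 0 := by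
    intro h
    have h3 : (1 - 8 * x) ^ (1 / 2 : ℂ) = -3 := by linear_combination 4 * h
    have h4 : 0 ≤ ((1 - 8 * x) ^ (1 / 2 : ℂ)).re := by
      rw [one_div, Complex.cpow_inv_two_re]
      exact Real.sqrt_nonneg _
    rw [h3] at h4
    norm_num at h4
  refine DifferentiableAt.differentiableWithinAt ?_
  unfold closedForm
  exact DifferentiableAt.div (by fun_prop) (by fun_prop) (pow_ne_zero 3 h2)

theorem le_avoidSeries_radius {r : ℝ≥0} (hr : 0 < r) (hr8 : r < 1 / 8) :
    (r : ℝ≥0∞) ≤ (avoidSeries ℂ).radius := by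
  have hr8' : (r : ℝ) < 1 / 8 := by exact_mod_cast hr8
  have h1 := (differentiableOn_closedForm.mono
    (Metric.closedBall_subset_ball hr8')).hasFPowerSeriesOnBall hr
  have h2 := (avoidSeries ℂ).hasFPowerSeriesOnBall avoidSeries_radius_pos
  have h3 : ∃ᶠ x in 𝓝[≠] (0 : ℂ), closedForm x = (avoidSeries ℂ).sum x := by
    have h4 : Tendsto (fun x : ℝ => (x : ℂ)) (𝓝[>] 0) (𝓝[≠] 0) := by
      refine tendsto_nhdsWithin_iff.2 ⟨?_, ?_⟩
      · exact (Complex.continuous_ofReal.tendsto' 0 0 (by simp)).mono_left nhdsWithin_le_nhds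
      · filter_upwards [self_mem_nhdsWithin] with x hx
        simpa using hx.ne'
    refine h4.frequently (Eventually.frequently ?_)
    filter_upwards [Ioc_mem_nhdsGT (show (0 : ℝ) < 1 / 100 by norm_num)] with x hx
    exact closedForm_eq hx.1 hx.2
  have h5 := (h1.analyticAt.frequently_eq_iff_eventually_eq h2.analyticAt).1 h3
  have h6 := h1.hasFPowerSeriesAt.eq_formalMultilinearSeries
    (h2.hasFPowerSeriesAt.congr (EventuallyEq.symm h5))
  rw [← h6]
  exact h1.r_le

theorem eight_le_of_avoidCount_le {c : ℝ} (hc : 1 ≤ c)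
    (h : ∀ n, (avoidCount n ![0, 2, 3, 1] : ℝ) ≤ c ^ n) : 8 ≤ c := by
  by_contra! hc8
  have hpos : ∀ n, 0 < avoidCount n ![0, 2, 3, 1] := fun n =>
    avoidCount_pos n (increasing1342_zero_lt 0)
  lift c to ℝ≥0 using by linarith
  have hc0 : (0 : ℝ) < c := by linarith
  have h1 := inv_le_avoidSeries_radius (𝕜 := ℝ) (c := c) (by exact_mod_cast hc0) h
  have h2 : AnalyticOnNhd ℝ (avoidSeries ℝ).sum (Metric.ball 0 (c : ℝ)⁻¹) := by
    have := ((avoidSeries ℝ).hasFPowerSeriesOnBall avoidSeries_radius_pos).analyticOnNhd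
    refine this.mono fun x hx => ?_
    rw [← NNReal.coe_inv, Metric.mem_ball, dist_nndist, NNReal.coe_lt_coe] at hx
    rw [Metric.mem_eball, edist_nndist]
    exact (ENNReal.coe_lt_coe.2 hx).trans_le h1
  set f := (avoidSeries ℝ).sum with hf
  have h3 : AnalyticOnNhd ℝ (fun x => ((1 + 20 * x - 8 * x ^ 2) * f x - 32 * x) ^ 2)
      (Metric.ball 0 (c : ℝ)⁻¹) := by
    intro x hx
    have := h2 x hx
    fun_prop
  have h4 : AnalyticOnNhd ℝ (fun x => (1 - 8 * x) ^ 3 * f x ^ 2) (Metric.ball 0 (c : ℝ)⁻¹) := by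
    intro x hx
    have := h2 x hx
    fun_prop
  have h5 : ∃ᶠ x in 𝓝[≠] (0 : ℝ), ((1 + 20 * x - 8 * x ^ 2) * f x - 32 * x) ^ 2 =
      (1 - 8 * x) ^ 3 * f x ^ 2 := by
    refine Frequently.filter_mono ?_ (nhdsGT_le_nhdsNE 0)
    refine Eventually.frequently ?_
    filter_upwards [Ioc_mem_nhdsGT (show (0 : ℝ) < 1 / 100 by norm_num)] with x hx
    obtain ⟨y, hy, hy', hxy, h⟩ := exists_eq_avoidSeries_sum hx.1 hx.2
    rw [← hf] at h
    have hy1 : 1 - y ≠ 0 := by linarith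
    rw [h, hxy]
    field_simp
    ring
  have h6 := h3.eqOn_of_preconnected_of_frequently_eq h4 (convex_ball _ _).isPreconnected
    (Metric.mem_ball_self (by positivity)) h5
  obtain ⟨x, hx1, hx2⟩ := exists_between (show (1 / 8 : ℝ) < (c : ℝ)⁻¹ by
    rw [one_div]; exact inv_strictAnti₀ hc0 hc8)
  have hx : x ∈ Metric.ball (0 : ℝ) (c : ℝ)⁻¹ := by
    rw [mem_ball_zero_iff, Real.norm_of_nonneg (by linarith)]
    exact hx2
  have h7 : 0 < f x := by
    rw [hf, avoidSeries_sum]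
    have hcx : c * x < 1 := by
      rw [mul_comm, ← lt_div_iff₀ hc0, one_div]
      exact hx2
    have hsum : Summable fun n => (avoidCount n ![0, 2, 3, 1] : ℝ) * x ^ n := by
      refine Summable.of_nonneg_of_le (fun n => by positivity) (fun n => ?_)
        (summable_geometric_of_lt_one (r := c * x) (by positivity) hcx)
      rw [mul_pow]
      exact mul_le_mul_of_nonneg_right (h n) (by positivity)
    refine hsum.tsum_pos (fun n => by positivity) 0 ?_
    simpa using hpos 0
  have h8 := h6 hx
  simp only at h8
  have h9 : (1 - 8 * x) ^ 3 < 0 := Odd.pow_neg (by decide) (by linarith)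
  nlinarith [sq_nonneg ((1 + 20 * x - 8 * x ^ 2) * f x - 32 * x), pow_pos h7 2]

theorem tendsto_avoidCount_1342 :
    Tendsto (fun n : ℕ => (avoidCount n ![0, 2, 3, 1] : ℝ) ^ (1 / (n : ℝ))) atTop (𝓝 8) ∧
      ∀ n, (avoidCount n ![0, 2, 3, 1] : ℝ) ≤ 8 ^ n := by
  have hpos : ∀ n, 1 ≤ avoidCount n ![0, 2, 3, 1] := fun n =>
    avoidCount_pos n (increasing1342_zero_lt 0)
  obtain ⟨c, hlim, hc1, hc⟩ := exists_tendsto_root hpos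
    (avoidCount_mul_le (increasing1342_zero_lt 0)) avoidCount_le_pow
  suffices c = 8 by
    subst this
    exact ⟨hlim, hc⟩
  refine le_antisymm (le_of_forall_gt_imp_ge_of_dense fun s hs => le_of_forall_lt_imp_le_of_dense
    fun t ht => ?_) (eight_le_of_avoidCount_le hc1 hc)
  rcases le_or_gt t 0 with ht0 | ht0
  · linarith
  obtain ⟨K, hK, hKt⟩ := exists_const_mul_pow_le hpos ht0.le ht hlim
  lift s to ℝ≥0 using by linarith
  have hs0 : (0 : ℝ) < s := by linarith
  obtain ⟨u, hu8, hus⟩ := exists_between hs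
  lift u to ℝ≥0 using by linarith
  have hu0 : (0 : ℝ) < u := by linarith
  have hrad := le_avoidSeries_radius (r := u⁻¹) (by simpa using hu0) (by
    rw [← NNReal.coe_lt_coe]
    push_cast
    rw [one_div]
    exact inv_strictAnti₀ (by norm_num) hu8)
  have hs_lt : ((s⁻¹ : ℝ≥0) : ℝ≥0∞) < (avoidSeries ℂ).radius := by
    refine lt_of_lt_of_le (ENNReal.coe_lt_coe.2 ?_) hrad
    rw [← NNReal.coe_lt_coe]
    push_cast
    exact inv_strictAnti₀ hu0 hus
  obtain ⟨B, hB, hBs⟩ := (avoidSeries ℂ).norm_mul_pow_le_of_lt_radius hs_lt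
  refine le_of_forall_const_mul_pow_le (div_pos hK hB) hs0 fun n => ?_
  have h1 := hBs n
  rw [norm_avoidSeries, NNReal.coe_inv, inv_pow, ← div_eq_mul_inv,
    div_le_iff₀ (by positivity)] at h1
  calc K / B * t ^ n = K * t ^ n / B := by ring
    _ ≤ (s : ℝ) ^ n := by
      rw [div_le_iff₀ hB, mul_comm _ B]
      exact (hKt n).trans h1
    _ ≤ (n + 1) * (s : ℝ) ^ n := le_mul_of_one_le_left (by positivity) (by simp)

end StanleyWilf

/-- For `k ≥ 4`, let `q_k` be the pattern `1 2 ⋯ (k-3) (k-1) k (k-2)`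
(0-indexed: `q i = i` for `i < k-3`, `q (k-3) = k-2`, `q (k-2) = k-1`, `q (k-1) = k-3`).
Then `(S_n(q_k))^{1/n} → (k - 4 + √8)²`. -/
theorem stanley_wilf_limit_qk (k : ℕ) (hk : 4 ≤ k) (q : Equiv.Perm (Fin k))
    (hq : ∀ i : Fin k,
      ((i : ℕ) < k - 3 → (q i : ℕ) = i) ∧
      ((i : ℕ) = k - 3 → (q i : ℕ) = k - 2) ∧
      ((i : ℕ) = k - 2 → (q i : ℕ) = k - 1) ∧
      ((i : ℕ) = k - 1 → (q i : ℕ) = k - 3)) :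
    Filter.Tendsto (fun n : ℕ => (avoiders n q : ℝ) ^ (1 / (n : ℝ)))
      Filter.atTop (nhds (((k : ℝ) - 4 + Real.sqrt 8) ^ 2)) := by
  obtain ⟨j, rfl⟩ := Nat.exists_eq_add_of_le' hk
  have hQ : ∀ i, (q i : ℕ) = StanleyWilf.increasing1342 j i := by
    intro i
    have := hq i
    have := i.isLt
    rw [StanleyWilf.increasing1342_apply]
    split_ifs <;> omega
  simp only [StanleyWilf.avoiders_eq_avoidCount _ hQ]
  obtain ⟨hlim, hle⟩ := StanleyWilf.tendsto_avoidCount_1342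
  rw [← Real.sq_sqrt (show (0 : ℝ) ≤ 8 by norm_num)] at hlim hle
  have := (StanleyWilf.tendsto_increasing1342 hlim hle (Real.sqrt_nonneg 8) j).1
  convert this using 3
  push_cast
  ring
end

section
/- Let q be a pattern of length k that starts with 1 (i.e., q(1) = 1), and let q' be the pattern of length k+1 defined by q'(1) = 1 and q'(i+1) = q(i) + 1 for 1 ≤ i ≤ k. If c is a real constant such that S_n(q) < c^n for all positive integers n, then S_n(q') < (1 + √c)^{2n} for all positive integers n. -/
open Classical in
/-- The positions of `p` that are not left-to-right minima. -/
noncomputable def nonLtrMin {n : ℕ} (p : Equiv.Perm (Fin n)) : Finset (Fin n) :=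
  {i | ¬ IsLtrMin p i}

lemma mem_nonLtrMin {n : ℕ} {p : Equiv.Perm (Fin n)} {i : Fin n} :
    i ∈ nonLtrMin p ↔ ¬ IsLtrMin p i := by
  simp [nonLtrMin]

/-- A copy of `q` on positions that are not left-to-right minima extends to a copy of `q'`. -/
lemma permContains_prepend {n k : ℕ} (hk : 0 < k)
    {q : Equiv.Perm (Fin k)} (hq0 : (q ⟨0, hk⟩ : ℕ) = 0)
    {q' : Equiv.Perm (Fin (k + 1))}
    (hq'0 : q' 0 = 0) (hq' : ∀ i : Fin k, q' i.succ = (q i).succ)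
    {p : Equiv.Perm (Fin n)} (h : ContainsOn p (fun i => ¬ IsLtrMin p i) q) :
    PermContains p q' := by
  obtain ⟨g, hg, hmin, hgq⟩ := h
  have hfirst := hmin ⟨0, hk⟩
  simp only [IsLtrMin, not_forall, not_lt] at hfirst
  obtain ⟨j, hj, hpj⟩ := hfirst
  have hpj' : p j < p (g ⟨0, hk⟩) := lt_of_le_of_ne hpj (p.injective.ne hj.ne)
  have hlt (a : Fin k) : p j < p (g a) := by
    refine hpj'.trans_le (not_lt.1 fun hlt => ?_)
    have := (hgq _ _).1 hlt
    rw [Fin.lt_def] at this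
    omega
  refine ⟨Fin.cons j g, ?_, ?_⟩
  · intro a b hab
    induction b using Fin.cases with
    | zero => exact absurd hab (Fin.not_lt_zero a)
    | succ b =>
      induction a using Fin.cases with
      | zero => exact hj.trans_le (hg.monotone (Fin.le_def.2 (Nat.zero_le _)))
      | succ a => exact hg (Fin.succ_lt_succ_iff.1 hab)
  · intro a b
    induction a using Fin.cases with
    | zero =>
      induction b using Fin.cases with
      | zero => simp
      | succ b => simp [hq'0, hq', hlt]
    | succ a =>
      induction b using Fin.cases with
      | zero => simpa [hq'0, hq'] using (hlt a).le
      | succ b => simp [hq', hgq]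

/-- The pattern formed by the entries of `p` in positions `A`, where `B = p(A)`. -/
def restrictedPattern {n : ℕ} {A B : Finset (Fin n)} (hB : B.card = A.card)
    (p : Equiv.Perm (Fin n)) (h : ∀ i, i ∈ A ↔ p i ∈ B) : Equiv.Perm (Fin A.card) :=
  ((A.orderIsoOfFin rfl).toEquiv.trans (p.subtypeEquiv h)).trans
    (B.orderIsoOfFin hB).symm.toEquiv

lemma orderIsoOfFin_restrictedPattern {n : ℕ} {A B : Finset (Fin n)} (hB : B.card = A.card)
    (p : Equiv.Perm (Fin n)) (h : ∀ i, i ∈ A ↔ p i ∈ B) (i : Fin A.card) :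
    (B.orderIsoOfFin hB (restrictedPattern hB p h i) : Fin n) =
      p (A.orderIsoOfFin rfl i) := by
  simp [restrictedPattern]

lemma restrictedPattern_lt_iff {n : ℕ} {A B : Finset (Fin n)} (hB : B.card = A.card)
    (p : Equiv.Perm (Fin n)) (h : ∀ i, i ∈ A ↔ p i ∈ B) (i j : Fin A.card) :
    restrictedPattern hB p h i < restrictedPattern hB p h j ↔
      p (A.orderIsoOfFin rfl i) < p (A.orderIsoOfFin rfl j) := by
  rw [← orderIsoOfFin_restrictedPattern hB p h, ← orderIsoOfFin_restrictedPattern hB p h,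
    Subtype.coe_lt_coe, OrderIso.lt_iff_lt]

/-- A permutation is determined by the positions and values of its entries that are not
left-to-right minima, together with the pattern those entries form. -/
lemma eq_of_restrictedPattern_eq {n : ℕ} {A B : Finset (Fin n)} (hB : B.card = A.card)
    {p₁ p₂ : Equiv.Perm (Fin n)} (hA₁ : nonLtrMin p₁ = A) (hA₂ : nonLtrMin p₂ = A)
    (h₁ : ∀ i, i ∈ A ↔ p₁ i ∈ B) (h₂ : ∀ i, i ∈ A ↔ p₂ i ∈ B)
    (h : restrictedPattern hB p₁ h₁ = restrictedPattern hB p₂ h₂) : p₁ = p₂ := by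
  have hanti {p : Equiv.Perm (Fin n)} (hA : nonLtrMin p = A) :
      StrictAnti fun i : {i // i ∉ A} => p i := by
    rintro ⟨i, hi⟩ ⟨j, hj⟩ hij
    rw [← hA, mem_nonLtrMin, not_not] at hj
    exact hj i hij
  have hrange {p : Equiv.Perm (Fin n)} (hp : ∀ i, i ∈ A ↔ p i ∈ B) :
      Set.range (fun i : {i // i ∉ A} => p i) = {v | v ∉ B} := by
    ext v
    simp only [Set.mem_range, Subtype.exists, Set.mem_ofPred_eq, exists_prop]
    constructor
    · rintro ⟨i, hi, rfl⟩
      rwa [← hp]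
    · exact fun hv => ⟨p.symm v, by simpa [hp] using hv, by simp⟩
  have hcompl := ((hanti hA₁).range_inj (hanti hA₂)).1 ((hrange h₁).trans (hrange h₂).symm)
  ext1 i
  by_cases hi : i ∈ A
  · have hval := orderIsoOfFin_restrictedPattern hB p₁ h₁ ((A.orderIsoOfFin rfl).symm ⟨i, hi⟩)
    rw [h, orderIsoOfFin_restrictedPattern] at hval
    simpa using hval.symm
  · exact congrFun hcompl ⟨i, hi⟩

open Classical in
/-- The number of `q'`-avoiders whose entries other than left-to-right minima occupy given
positions and have given values is at most the number of `q`-avoiders of their pattern's length. -/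
lemma card_avoiders_prepend_fiber_le {n k : ℕ} (hk : 0 < k)
    {q : Equiv.Perm (Fin k)} (hq0 : (q ⟨0, hk⟩ : ℕ) = 0)
    {q' : Equiv.Perm (Fin (k + 1))}
    (hq'0 : q' 0 = 0) (hq' : ∀ i : Fin k, q' i.succ = (q i).succ)
    {A B : Finset (Fin n)} (hB : B.card = A.card) :
    Finset.card {p : Equiv.Perm (Fin n) | PermAvoids p q' ∧
      nonLtrMin p = A ∧ (nonLtrMin p).map p.toEmbedding = B} ≤ avoiders A.card q := by
  have hmem {p : Equiv.Perm (Fin n)} (hp : nonLtrMin p = A ∧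
      (nonLtrMin p).map p.toEmbedding = B) (i : Fin n) : i ∈ A ↔ p i ∈ B := by
    rw [← hp.2, hp.1]
    simp
  rw [← Fintype.card_subtype, ← Nat.card_eq_fintype_card, avoiders]
  refine Nat.card_le_card_of_injective
    (fun p => ⟨restrictedPattern hB p.1 (hmem p.2.2), ?_⟩) ?_
  · rintro ⟨f, hf, hfq⟩
    refine p.2.1 (permContains_prepend hk hq0 hq'0 hq' ⟨fun a => A.orderIsoOfFin rfl (f a),
      fun a b hab => ?_, fun a => ?_, fun a b => ?_⟩)
    · exact (A.orderIsoOfFin rfl).strictMono (hf hab)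
    · refine mem_nonLtrMin.1 ?_
      rw [p.2.2.1]
      exact (A.orderIsoOfFin rfl (f a)).2
    · rw [← hfq, restrictedPattern_lt_iff]
  · intro p₁ p₂ h
    exact Subtype.ext (eq_of_restrictedPattern_eq hB p₁.2.2.1 p₂.2.2.1 _ _
      (congrArg Subtype.val h))

lemma avoiders_zero_le_one {k : ℕ} (q : Equiv.Perm (Fin k)) : avoiders 0 q ≤ 1 := by
  rw [avoiders, Finite.card_le_one_iff_subsingleton]
  infer_instance

/-- If `q` starts with its smallest entry, `q'` is obtained from `q` by adding 1 to each
entry and prepending the entry 1, and `S_n(q) < c^n` for all positive `n`, then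
`S_n(q') < (1 + √c)^{2n}` for all positive `n`. -/
theorem avoiders_prepend_upper {k : ℕ} (hk : 0 < k)
    (q : Equiv.Perm (Fin k)) (hq0 : (q ⟨0, hk⟩ : ℕ) = 0)
    (q' : Equiv.Perm (Fin (k + 1)))
    (hq'0 : q' 0 = 0) (hq' : ∀ i : Fin k, q' i.succ = (q i).succ)
    (c : ℝ) (hc : ∀ n : ℕ, 0 < n → (avoiders n q : ℝ) < c ^ n) :
    ∀ n : ℕ, 0 < n → (avoiders n q' : ℝ) < (1 + Real.sqrt c) ^ (2 * n) := by
  classical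
  intro n hn
  have hcpos : 0 < c := by
    simpa using (Nat.cast_nonneg (avoiders 1 q)).trans_lt (hc 1 one_pos)
  have hle (m : ℕ) : (avoiders m q : ℝ) ≤ c ^ m := by
    rcases Nat.eq_zero_or_pos m with rfl | hm
    · simpa using avoiders_zero_le_one q
    · exact (hc m hm).le
  have hsqrt (m : ℕ) : c ^ m = √c ^ m * √c ^ m := by
    rw [← mul_pow, Real.mul_self_sqrt hcpos.le]
  let F (x : Finset (Fin n) × Finset (Fin n)) : Finset (Equiv.Perm (Fin n)) :=
    {p | PermAvoids p q' ∧ nonLtrMin p = x.1 ∧ (nonLtrMin p).map p.toEmbedding = x.2}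
  have hcard : avoiders n q' = ∑ x, (F x).card := by
    rw [avoiders, Nat.card_eq_fintype_card, Fintype.card_subtype,
      Finset.card_eq_sum_card_fiberwise (t := Finset.univ)
        (f := fun p => (nonLtrMin p, (nonLtrMin p).map p.toEmbedding)) (by simp)]
    simp only [F, Finset.filter_filter, Prod.ext_iff]
  have hF (x : Finset (Fin n) × Finset (Fin n)) :
      ((F x).card : ℝ) ≤ √c ^ x.1.card * √c ^ x.2.card := by
    by_cases hx : x.2.card = x.1.card
    · rw [hx, ← hsqrt]
      exact (Nat.cast_le.2 (card_avoiders_prepend_fiber_le hk hq0 hq'0 hq' hx)).trans (hle _)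
    · have hempty : F x = ∅ := by
        refine Finset.filter_eq_empty_iff.2 fun p _ hp => hx ?_
        rw [← hp.2.1, ← hp.2.2, Finset.card_map]
      rw [hempty, Finset.card_empty, Nat.cast_zero]
      positivity
  have hFuniv : ((F (Finset.univ, Finset.univ)).card : ℝ) <
      √c ^ (Finset.univ : Finset (Fin n)).card * √c ^ (Finset.univ : Finset (Fin n)).card := by
    rw [← hsqrt]
    exact (Nat.cast_le.2 (card_avoiders_prepend_fiber_le hk hq0 hq'0 hq' rfl)).trans_lt
      (hc _ (by simpa using hn))
  have hsum : ∑ A : Finset (Fin n), √c ^ A.card = (1 + √c) ^ n := by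
    simpa [add_comm] using Finset.sum_pow_mul_eq_add_pow (√c) 1 (Finset.univ : Finset (Fin n))
  calc (avoiders n q' : ℝ) = ∑ x, ((F x).card : ℝ) := by rw [hcard, Nat.cast_sum]
    _ < ∑ x : Finset (Fin n) × Finset (Fin n), √c ^ x.1.card * √c ^ x.2.card :=
        Finset.sum_lt_sum (fun x _ => hF x) ⟨_, Finset.mem_univ _, hFuniv⟩
    _ = (1 + √c) ^ (2 * n) := by
        simp only [Fintype.sum_prod_type]
        rw [← Finset.sum_mul_sum, hsum, ← pow_add, two_mul]
end

section
/- Let q be a pattern of length k ≥ 2 that starts with 1 (i.e., q(1) = 1), and let q' be the pattern of length k+1 defined by q'(1) = 1 and q'(i+1) = q(i) + 1 for 1 ≤ i ≤ k. If the sequence (S_n(q))^{1/n} converges to a real number L, then the sequence (S_n(q'))^{1/n} converges to 1 + L + 2√L. -/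
/-- The bijection `e` between ordered types contains the pattern `q`. -/
def EquivContains {X Y : Type*} [Preorder X] [Preorder Y] {k : ℕ} (e : X ≃ Y)
    (q : Equiv.Perm (Fin k)) : Prop :=
  ∃ f : Fin k → X, StrictMono f ∧ ∀ a b, e (f a) < e (f b) ↔ q a < q b

theorem equivContains_conj {X Y X' Y' : Type*} [LinearOrder X] [LinearOrder Y] [LinearOrder X']
    [LinearOrder Y'] {k : ℕ} (u : X ≃o X') (v : Y ≃o Y') (e : X ≃ Y) (q : Equiv.Perm (Fin k)) :
    EquivContains (Equiv.equivCongr u.toEquiv v.toEquiv e) q ↔ EquivContains e q := by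
  constructor
  · rintro ⟨f, hf, h⟩
    refine ⟨u.symm ∘ f, u.symm.strictMono.comp hf, fun a b => ?_⟩
    rw [← h]
    simp
  · rintro ⟨f, hf, h⟩
    refine ⟨u ∘ f, u.strictMono.comp hf, fun a b => ?_⟩
    rw [← h]
    simp

theorem card_avoiding_equiv {X Y : Type*} [LinearOrder X] [LinearOrder Y] [Fintype X] [Fintype Y]
    {k n : ℕ} (q : Equiv.Perm (Fin k)) (hX : Fintype.card X = n) (hY : Fintype.card Y = n) :
    Nat.card {e : X ≃ Y // ¬ EquivContains e q} = avoiders n q := by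
  refine Nat.card_congr (Equiv.subtypeEquiv (Equiv.equivCongr
    (Fintype.orderIsoFinOfCardEq X hX).symm.toEquiv
    (Fintype.orderIsoFinOfCardEq Y hY).symm.toEquiv) fun e => ?_)
  rw [← equivContains_conj (Fintype.orderIsoFinOfCardEq X hX).symm
    (Fintype.orderIsoFinOfCardEq Y hY).symm]
  rfl

theorem eqOn_of_strictAntiOn_of_image_eq {α β : Type*} [LinearOrder α] [Finite α] [LinearOrder β]
    {s : Set α} {f g : α → β} (hf : StrictAntiOn f s) (hg : StrictAntiOn g s)
    (h : f '' s = g '' s) : Set.EqOn f g s := by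
  have hf' : StrictMono fun x : s => OrderDual.toDual (f x) :=
    fun x y hxy => hf x.2 y.2 hxy
  have hg' : StrictMono fun x : s => OrderDual.toDual (g x) :=
    fun x y hxy => hg x.2 y.2 hxy
  have key := (StrictMono.range_inj hf' hg').1 (by
    ext y
    have := Set.ext_iff.1 h (OrderDual.ofDual y)
    simp only [Set.mem_image] at this
    simp only [Set.mem_range, Subtype.exists, exists_prop]
    exact this)
  intro x hx
  exact congrFun key ⟨x, hx⟩

theorem strictAntiOn_ltrMin {n : ℕ} (p : Equiv.Perm (Fin n)) :
    StrictAntiOn p {i | IsLtrMin p i} :=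
  fun _ _ _ hj hij => hj _ hij

theorem not_equivContains_compl_ltrMin {n k : ℕ} (hk : 0 < k) {q : Equiv.Perm (Fin k)}
    (hq0 : ∀ i, q ⟨0, hk⟩ ≤ q i) {q' : Equiv.Perm (Fin (k + 1))}
    (hq'0 : q' 0 = 0) (hq' : ∀ i : Fin k, q' i.succ = (q i).succ) {p : Equiv.Perm (Fin n)}
    (hp : PermAvoids p q') {P Q : Fin n → Prop} (hP : ∀ i, P i → ¬ IsLtrMin p i)
    (h : ∀ i, P i ↔ Q (p i)) :
    ¬ EquivContains (p.subtypeEquiv h) q := by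
  rintro ⟨f, hf, hfq⟩
  have hmin := hP _ (f ⟨0, hk⟩).2
  simp only [IsLtrMin, not_forall, not_lt] at hmin
  obtain ⟨j, hj, hpj⟩ := hmin
  have hpj : p j < p (f ⟨0, hk⟩) := lt_of_le_of_ne hpj fun h => hj.ne (p.injective h)
  have hfq' : ∀ a b, p (f a) < p (f b) ↔ q a < q b := fun a b => hfq a b
  have hle : ∀ a, p (f ⟨0, hk⟩) ≤ p (f a) := fun a => not_lt.1 fun hlt =>
    (hq0 a).not_gt ((hfq' _ _).1 hlt)
  apply hp
  refine ⟨Fin.cons j fun i => (f i : Fin n), ?_, fun a b => ?_⟩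
  · intro a b hab
    induction a using Fin.cases with
    | zero =>
      induction b using Fin.cases with
      | zero => exact absurd hab (lt_irrefl _)
      | succ b =>
        simp only [Fin.cons_zero, Fin.cons_succ]
        exact hj.trans_le (hf.monotone (Fin.mk_le_of_le_val (Nat.zero_le _)))
    | succ a =>
      induction b using Fin.cases with
      | zero => exact absurd hab (Fin.not_lt_zero _)
      | succ b =>
        simp only [Fin.cons_succ]
        exact hf (Fin.succ_lt_succ_iff.1 hab)
  · induction a using Fin.cases with
    | zero =>
      induction b using Fin.cases with
      | zero => simp
      | succ b => simpa [hq'0, hq'] using hpj.trans_le (hle b)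
    | succ a =>
      induction b using Fin.cases with
      | zero => simpa [hq'0, hq'] using (hpj.trans_le (hle a)).le
      | succ b => simpa [hq'] using hfq' a b

open Classical in
theorem avoiders_prepend_le {k : ℕ} (hk : 0 < k) {q : Equiv.Perm (Fin k)}
    (hq0 : ∀ i, q ⟨0, hk⟩ ≤ q i) {q' : Equiv.Perm (Fin (k + 1))}
    (hq'0 : q' 0 = 0) (hq' : ∀ i : Fin k, q' i.succ = (q i).succ) (n : ℕ) :
    avoiders n q' ≤ ∑ i ∈ Finset.range (n + 1), n.choose i ^ 2 * avoiders (n - i) q := by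
  let A : Equiv.Perm (Fin n) → Finset (Fin n) := fun p => Finset.univ.filter (IsLtrMin p)
  let T : Finset (Σ _ : Finset (Fin n), Finset (Fin n)) :=
    Finset.univ.sigma fun s => Finset.powersetCard s.card Finset.univ
  let S : Finset (Equiv.Perm (Fin n)) := Finset.univ.filter fun p => PermAvoids p q'
  have hS : avoiders n q' = S.card := by
    rw [avoiders, Nat.card_eq_fintype_card, Fintype.card_subtype]
  have hfib : ∀ t ∈ T, (S.filter fun p => (⟨A p, (A p).image p⟩ : Σ _, _) = t).card ≤
      avoiders (n - t.1.card) q := by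
    rintro ⟨s, t⟩ hst
    have hst : t.card = s.card := by simpa [T] using hst
    have hmem : ∀ p ∈ S.filter fun p => (⟨A p, (A p).image p⟩ : Σ _, _) = ⟨s, t⟩,
        PermAvoids p q' ∧ (∀ i, i ∈ s ↔ IsLtrMin p i) ∧ s.image p = t := by
      intro p hp
      obtain ⟨hpS, hp⟩ := Finset.mem_filter.1 hp
      obtain ⟨hA, hB⟩ := Sigma.mk.inj_iff.1 hp
      rw [← hA]
      exact ⟨by simpa [S] using hpS, fun i => by simp [A], eq_of_heq hB⟩
    have hiff : ∀ p ∈ S.filter fun p => (⟨A p, (A p).image p⟩ : Σ _, _) = ⟨s, t⟩,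
        ∀ i, i ∉ s ↔ p i ∉ t := by
      intro p hp i
      rw [← (hmem p hp).2.2]
      simp
    let φ : (S.filter fun p => (⟨A p, (A p).image p⟩ : Σ _, _) = ⟨s, t⟩) →
        {e : {x // x ∉ s} ≃ {x // x ∉ t} // ¬ EquivContains e q} := fun p =>
      ⟨p.1.subtypeEquiv (hiff p.1 p.2), not_equivContains_compl_ltrMin hk hq0 hq'0 hq'
        (hmem p.1 p.2).1 (fun i hi h => hi (((hmem p.1 p.2).2.1 i).2 h)) _⟩
    have hφ : Function.Injective φ := by
      intro p p' h
      have heq : ∀ i, i ∉ s → p.1 i = p'.1 i := fun i hi =>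
        congrArg Subtype.val (Equiv.congr_fun (congrArg Subtype.val h) ⟨i, hi⟩)
      have hanti : ∀ p ∈ S.filter fun p => (⟨A p, (A p).image p⟩ : Σ _, _) = ⟨s, t⟩,
          StrictAntiOn p (s : Set (Fin n)) := fun p hp =>
        (strictAntiOn_ltrMin p).mono fun i hi => ((hmem p hp).2.1 i).1 hi
      have heq' := eqOn_of_strictAntiOn_of_image_eq (hanti _ p.2) (hanti _ p'.2) (by
        rw [← Finset.coe_image, ← Finset.coe_image, (hmem _ p.2).2.2, (hmem _ p'.2).2.2])
      refine Subtype.ext (Equiv.ext fun i => ?_)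
      by_cases hi : i ∈ s
      · exact heq' hi
      · exact heq i hi
    calc _ = Nat.card (S.filter fun p => (⟨A p, (A p).image p⟩ : Σ _, _) = ⟨s, t⟩) := by
          rw [Nat.card_eq_fintype_card, Fintype.card_coe]
      _ ≤ _ := Nat.card_le_card_of_injective φ hφ
      _ = _ := card_avoiding_equiv q (by simp [Fintype.card_subtype_compl])
          (by simp [Fintype.card_subtype_compl, hst])
  calc avoiders n q' = ∑ t ∈ T, (S.filter fun p => (⟨A p, (A p).image p⟩ : Σ _, _) = t).card := by
        rw [hS]
        refine Finset.card_eq_sum_card_fiberwise fun p _ => ?_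
        simp [T, Finset.mem_powersetCard, Finset.card_image_of_injective _ p.injective]
    _ ≤ ∑ t ∈ T, avoiders (n - t.1.card) q := Finset.sum_le_sum hfib
    _ = ∑ s ∈ (Finset.univ : Finset (Fin n)).powerset,
          n.choose s.card * avoiders (n - s.card) q := by
        simp [T, Finset.sum_sigma]
    _ = _ := by
        rw [Finset.sum_powerset_apply_card (fun i => n.choose i * avoiders (n - i) q)]
        simp [pow_two, mul_assoc]

theorem eq_of_strictMono_sum {a s : ℕ} {Z : Type*} [LinearOrder Z] {e e' : Fin a ⊕ Fin s ≃ Z}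
    (h : StrictMono (e ∘ Sum.inr)) (h' : StrictMono (e' ∘ Sum.inr))
    (hl : e ∘ Sum.inl = e' ∘ Sum.inl) : e = e' := by
  have hr : ∀ e : Fin a ⊕ Fin s ≃ Z, Set.range (e ∘ Sum.inr) = (Set.range (e ∘ Sum.inl))ᶜ := by
    intro e
    rw [Set.range_comp, Set.range_comp, ← Set.image_compl_eq e.bijective, Set.compl_range_inl]
  have := (StrictMono.range_inj h h').1 (by rw [hr, hr, hl])
  ext (i | i)
  · exact congrFun hl i
  · exact congrFun this i

/-- Bijections from `Fin a ⊕ Fin s` that are increasing on both summands. -/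
abbrev Shuffle (a s : ℕ) : Type :=
  {e : Fin a ⊕ Fin s ≃ Fin (a + s) // StrictMono (e ∘ Sum.inl) ∧ StrictMono (e ∘ Sum.inr)}

theorem choose_le_card_shuffle (a s : ℕ) : (a + s).choose a ≤ Nat.card (Shuffle a s) := by
  have hc : ∀ t : Finset.powersetCard a (Finset.univ : Finset (Fin (a + s))),
      t.1.card = a ∧ t.1ᶜ.card = s := fun t => by
    have := (Finset.mem_powersetCard.1 t.2).2
    simp [Finset.card_compl, this]
  let φ : Finset.powersetCard a (Finset.univ : Finset (Fin (a + s))) → Shuffle a s := fun t =>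
    ⟨finSumEquivOfFinset (hc t).1 (hc t).2,
      (t.1.orderEmbOfFin (hc t).1).strictMono, (t.1ᶜ.orderEmbOfFin (hc t).2).strictMono⟩
  have hφ : Function.Injective φ := by
    intro t t' h
    refine Subtype.ext (Finset.coe_injective ?_)
    rw [← Finset.range_orderEmbOfFin t.1 (hc t).1, ← Finset.range_orderEmbOfFin t'.1 (hc t').1]
    refine congrArg Set.range (funext fun i => ?_)
    exact Equiv.congr_fun (congrArg Subtype.val h) (Sum.inl i)
  calc (a + s).choose a
      = Nat.card (Finset.powersetCard a (Finset.univ : Finset (Fin (a + s)))) := by simp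
    _ ≤ _ := Nat.card_le_card_of_injective φ hφ

/-- The bijections that avoid `q` and whose `a` smallest values occur in decreasing order. -/
abbrev Stage {k : ℕ} (a : ℕ) (q : Equiv.Perm (Fin k)) (X U : Type) [LinearOrder X]
    [LinearOrder U] : Type :=
  {p : X ≃ Fin a ⊕ₗ U // ¬ EquivContains p q ∧
    ∀ i j : Fin a, i < j → p.symm (Sum.inlₗ j) < p.symm (Sum.inlₗ i)}

section Extend

variable {X U : Type} {a s : ℕ}

/-- Rearranges the values so that the middle two blocks can be interleaved. -/
def sumRearrange (A U B S : Type) : (A ⊕ U) ⊕ (B ⊕ S) ≃ B ⊕ ((A ⊕ S) ⊕ U) where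
  toFun := Sum.elim (Sum.elim (fun i => .inr (.inl (.inl i))) (fun u => .inr (.inr u)))
    (Sum.elim .inl fun v => .inr (.inl (.inr v)))
  invFun := Sum.elim (fun i => .inr (.inl i))
    (Sum.elim (Sum.elim (fun i => .inl (.inl i)) fun v => .inr (.inr v)) fun u => .inl (.inr u))
  left_inv := by rintro ((_ | _) | (_ | _)) <;> rfl
  right_inv := by rintro (_ | ((_ | _) | _)) <;> rfl

/-- Adds to the right of `p` a block made of a copy of `w`, whose values are interleaved by `β`
with the `a` smallest values of `p`, and of a decreasing sequence of `a` new smallest values,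
whose positions are interleaved by `α` with those of `w`. -/
def extend (p : X ≃ Fin a ⊕ₗ U) (w : Equiv.Perm (Fin s)) (α β : Fin a ⊕ Fin s ≃ Fin (a + s)) :
    X ⊕ₗ Fin (a + s) ≃ Fin a ⊕ₗ (Fin (a + s) ⊕ₗ U) :=
  ofLex.trans <| (Equiv.sumCongr (p.trans ofLex)
    (α.symm.trans (Equiv.sumCongr Fin.revPerm w))).trans <|
    (sumRearrange (Fin a) U (Fin a) (Fin s)).trans <|
    (Equiv.sumCongr (Equiv.refl _) ((Equiv.sumCongr β (Equiv.refl _)).trans toLex)).trans toLex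

variable (p : X ≃ Fin a ⊕ₗ U) (w : Equiv.Perm (Fin s)) (α β : Fin a ⊕ Fin s ≃ Fin (a + s))

theorem extend_low (i : Fin a) :
    extend p w α β (Sum.inlₗ (p.symm (Sum.inlₗ i))) = Sum.inrₗ (Sum.inlₗ (β (.inl i))) := by
  simp [extend, sumRearrange]

theorem extend_high (u : U) :
    extend p w α β (Sum.inlₗ (p.symm (Sum.inrₗ u))) = Sum.inrₗ (Sum.inrₗ u) := by
  simp [extend, sumRearrange]

theorem extend_new (i : Fin a) :
    extend p w α β (Sum.inrₗ (α (.inl i))) = Sum.inlₗ i.rev := by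
  simp [extend, sumRearrange]

theorem extend_block (v : Fin s) :
    extend p w α β (Sum.inrₗ (α (.inr v))) = Sum.inrₗ (Sum.inlₗ (β (.inr (w v)))) := by
  simp [extend, sumRearrange]

theorem extend_cases (z : X ⊕ₗ Fin (a + s)) :
    (∃ i, z = Sum.inlₗ (p.symm (Sum.inlₗ i))) ∨ (∃ u, z = Sum.inlₗ (p.symm (Sum.inrₗ u))) ∨
    (∃ i, z = Sum.inrₗ (α (.inl i))) ∨ ∃ v, z = Sum.inrₗ (α (.inr v)) := by
  match z with
  | Sum.inlₗ x =>
    obtain ⟨y, rfl⟩ := p.symm.surjective x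
    match y with
    | Sum.inlₗ i => exact .inl ⟨i, rfl⟩
    | Sum.inrₗ u => exact .inr (.inl ⟨u, rfl⟩)
  | Sum.inrₗ x =>
    obtain ⟨y, rfl⟩ := α.surjective x
    match y with
    | .inl i => exact .inr (.inr (.inl ⟨i, rfl⟩))
    | .inr v => exact .inr (.inr (.inr ⟨v, rfl⟩))

variable [LinearOrder X]

variable {p w α β} in
theorem extend_symm_strictAnti (hαl : StrictMono (α ∘ Sum.inl)) (i j : Fin a) (hij : i < j) :
    (extend p w α β).symm (Sum.inlₗ j) < (extend p w α β).symm (Sum.inlₗ i) := by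
  have h : ∀ i : Fin a, (extend p w α β).symm (Sum.inlₗ i) = Sum.inrₗ (α (.inl i.rev)) := by
    intro i
    rw [Equiv.symm_apply_eq, extend_new, Fin.rev_rev]
  rw [h, h, Sum.Lex.inr_lt_inr_iff]
  exact hαl (Fin.rev_lt_rev.2 hij)

variable {p w α β} in
theorem extend_inj {p' : X ≃ Fin a ⊕ₗ U} {w' : Equiv.Perm (Fin s)}
    {α' β' : Fin a ⊕ Fin s ≃ Fin (a + s)} [Finite X]
    (hp : ∀ i j : Fin a, i < j → p.symm (Sum.inlₗ j) < p.symm (Sum.inlₗ i))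
    (hp' : ∀ i j : Fin a, i < j → p'.symm (Sum.inlₗ j) < p'.symm (Sum.inlₗ i))
    (hα : StrictMono (α ∘ Sum.inr)) (hα' : StrictMono (α' ∘ Sum.inr))
    (hβ : StrictMono (β ∘ Sum.inr)) (hβ' : StrictMono (β' ∘ Sum.inr))
    (h : extend p w α β = extend p' w' α' β') : p = p' ∧ w = w' ∧ α = α' ∧ β = β' := by
  have hαα : α = α' := by
    refine eq_of_strictMono_sum hα hα' (funext fun i => ?_)
    have h1 := extend_new p w α β i
    rw [h, ← extend_new p' w' α' β' i] at h1
    simpa using (extend p' w' α' β').injective h1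
  subst hαα
  have hr : ∀ u, p.symm (Sum.inrₗ u) = p'.symm (Sum.inrₗ u) := by
    intro u
    have h1 := extend_high p w α β u
    rw [h, ← extend_high p' w' α β' u] at h1
    simpa using (extend p' w' α β').injective h1
  have hl : ∀ i, p.symm (Sum.inlₗ i) = p'.symm (Sum.inlₗ i) := by
    have hrange : ∀ p : X ≃ Fin a ⊕ₗ U, (fun i => p.symm (Sum.inlₗ i)) '' Set.univ =
        (Set.range fun u => p.symm (Sum.inrₗ u))ᶜ := by
      intro p
      ext x
      obtain ⟨y, rfl⟩ := p.symm.surjective x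
      match y with
      | Sum.inlₗ i => simp
      | Sum.inrₗ i => simp
    have := eqOn_of_strictAntiOn_of_image_eq (s := Set.univ)
      (f := fun i => p.symm (Sum.inlₗ i)) (g := fun i => p'.symm (Sum.inlₗ i))
      (fun i _ j _ hij => hp i j hij) (fun i _ j _ hij => hp' i j hij)
      (by rw [hrange, hrange, funext hr])
    exact fun i => this (Set.mem_univ i)
  have hpp : p = p' := by
    rw [← Equiv.symm_bijective.injective.eq_iff]
    ext y
    match y with
    | Sum.inlₗ i => exact hl i
    | Sum.inrₗ u => exact hr u
  subst hpp
  have hββ : β = β' := by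
    refine eq_of_strictMono_sum hβ hβ' (funext fun i => ?_)
    have h1 := extend_low p w α β i
    rw [h, extend_low] at h1
    simpa using h1.symm
  subst hββ
  refine ⟨rfl, Equiv.ext fun v => ?_, rfl, rfl⟩
  have h1 := extend_block p w α β v
  rw [h, extend_block] at h1
  simpa using h1.symm

variable [LinearOrder U]

variable {p w α β} in
theorem not_equivContains_extend {k : ℕ} (hk : 0 < k) {q : Equiv.Perm (Fin k)}
    (hq0 : ∀ i, q ⟨0, hk⟩ ≤ q i) {q' : Equiv.Perm (Fin (k + 1))}
    (hq'0 : q' 0 = 0) (hq' : ∀ i : Fin k, q' i.succ = (q i).succ)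
    (hp : ¬ EquivContains p q') (hp' : ∀ i j : Fin a, i < j →
      p.symm (Sum.inlₗ j) < p.symm (Sum.inlₗ i)) (hw : PermAvoids w q)
    (hαl : StrictMono (α ∘ Sum.inl)) (hαr : StrictMono (α ∘ Sum.inr))
    (hβl : StrictMono (β ∘ Sum.inl)) (hβr : StrictMono (β ∘ Sum.inr)) :
    ¬ EquivContains (extend p w α β) q' := by
  rintro ⟨f, hf, hfq⟩
  have hαl' : ∀ {i j}, α (.inl i) < α (.inl j) ↔ i < j := hαl.lt_iff_lt
  have hαr' : ∀ {i j}, α (.inr i) < α (.inr j) ↔ i < j := hαr.lt_iff_lt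
  have hβl' : ∀ {i j}, β (.inl i) < β (.inl j) ↔ i < j := hβl.lt_iff_lt
  have hβr' : ∀ {i j}, β (.inr i) < β (.inr j) ↔ i < j := hβr.lt_iff_lt
  have h0 : ∀ i : Fin k, extend p w α β (f 0) < extend p w α β (f i.succ) := fun i => by
    simp [hfq, hq'0, hq']
  have hnew : ∀ (i : Fin k) d, f i.succ ≠ Sum.inrₗ (α (.inl d)) := by
    intro i d hd
    have h1 := h0 i
    have h2 := hf (Fin.succ_pos i)
    rw [hd] at h1 h2
    rw [extend_new] at h1
    obtain ⟨d', h⟩ | ⟨u, h⟩ | ⟨d', h⟩ | ⟨v, h⟩ := extend_cases p α (f 0)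
    · rw [h, extend_low] at h1
      simp at h1
    · rw [h, extend_high] at h1
      simp at h1
    · rw [h, extend_new] at h1
      rw [h] at h2
      simp [hαl'] at h1 h2
      exact lt_asymm h1 h2
    · rw [h, extend_block] at h1
      simp at h1
  have hge : ∀ i : Fin k, ⟨0, hk⟩ ≤ i := fun i => Fin.mk_le_of_le_val (Nat.zero_le _)
  have hfge : ∀ i : Fin k, f (Fin.succ ⟨0, hk⟩) ≤ f i.succ := fun i =>
    hf.monotone (Fin.succ_le_succ_iff.2 (hge i))
  have hgge : ∀ i : Fin k, extend p w α β (f (Fin.succ ⟨0, hk⟩)) ≤ extend p w α β (f i.succ) :=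
    fun i => not_lt.1 fun h => by
      rw [hfq, hq', hq', Fin.succ_lt_succ_iff] at h
      exact (hq0 i).not_gt h
  have hold : ∀ x, f (Fin.succ ⟨0, hk⟩) = Sum.inlₗ x → False := by
    intro x hx
    have hall : ∀ i, ∃ y, f i = Sum.inlₗ y := by
      obtain ⟨x0, hx0⟩ : ∃ y, f 0 = Sum.inlₗ y := by
        have := hf (Fin.succ_pos ⟨0, hk⟩)
        rw [hx] at this
        match h : f 0 with
        | Sum.inlₗ y => exact ⟨y, rfl⟩
        | Sum.inrₗ y => exact absurd (h ▸ this) Sum.Lex.not_inr_lt_inl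
      refine Fin.cases ⟨x0, hx0⟩ fun i => ?_
      obtain ⟨d, h⟩ | ⟨u, h⟩ | ⟨d, h⟩ | ⟨v, h⟩ := extend_cases p α (f i.succ)
      · exact ⟨_, h⟩
      · exact ⟨_, h⟩
      · exact absurd h (hnew i d)
      · exfalso
        have h1 := hgge i
        have h2 := h0 ⟨0, hk⟩
        have h3 := hf (Fin.succ_pos ⟨0, hk⟩)
        rw [h, hx, extend_block] at h1
        rw [hx0, hx] at h2 h3
        obtain ⟨y, rfl⟩ := p.symm.surjective x
        obtain ⟨y0, rfl⟩ := p.symm.surjective x0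
        match y, y0 with
        | Sum.inrₗ u, _ => rw [extend_high] at h1; simp at h1
        | Sum.inlₗ d, Sum.inrₗ u => rw [extend_high, extend_low] at h2; simp at h2
        | Sum.inlₗ d, Sum.inlₗ d0 =>
          rw [extend_low, extend_low] at h2
          simp only [Sum.Lex.inr_lt_inr_iff, Sum.Lex.inl_lt_inl_iff, hβl'] at h2 h3
          exact lt_asymm h3 (hp' _ _ h2)
    choose g hg using hall
    refine hp ⟨g, fun i j hij => ?_, fun i j => ?_⟩
    · have := hf hij
      rw [hg, hg] at this
      simpa using this
    · rw [← hfq, hg, hg]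
      obtain ⟨y, hy⟩ := p.symm.surjective (g i)
      obtain ⟨y', hy'⟩ := p.symm.surjective (g j)
      rw [← hy, ← hy']
      match y, y' with
      | Sum.inlₗ d, Sum.inlₗ d' => rw [extend_low, extend_low]; simp [hβl']
      | Sum.inlₗ d, Sum.inrₗ d' => rw [extend_low, extend_high]; simp
      | Sum.inrₗ d, Sum.inlₗ d' => rw [extend_high, extend_low]; simp
      | Sum.inrₗ d, Sum.inrₗ d' => rw [extend_high, extend_high]; simp
  have hall : ∀ i : Fin k, ∃ v, f i.succ = Sum.inrₗ (α (.inr v)) := by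
    intro i
    have h1 := hfge i
    obtain ⟨d, h⟩ | ⟨u, h⟩ | ⟨d, h⟩ | h := extend_cases p α (f (Fin.succ ⟨0, hk⟩))
    · exact (hold _ h).elim
    · exact (hold _ h).elim
    · exact (hnew _ _ h).elim
    obtain ⟨v, hv⟩ := h
    rw [hv] at h1
    obtain ⟨d, h⟩ | ⟨u, h⟩ | ⟨d, h⟩ | h := extend_cases p α (f i.succ)
    · rw [h] at h1; simp at h1
    · rw [h] at h1; simp at h1
    · exact (hnew _ _ h).elim
    · exact h
  choose g hg using hall
  refine hw ⟨g, fun i j hij => ?_, fun i j => ?_⟩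
  · have := hf (Fin.succ_lt_succ_iff.2 hij)
    rw [hg, hg] at this
    simpa [hαr'] using this
  · rw [← Fin.succ_lt_succ_iff (a := q i), ← hq', ← hq', ← hfq, hg, hg, extend_block, extend_block]
    simp [hβr']

end Extend

theorem card_stage_mul_le {k : ℕ} (hk : 0 < k) {q : Equiv.Perm (Fin k)}
    (hq0 : ∀ i, q ⟨0, hk⟩ ≤ q i) {q' : Equiv.Perm (Fin (k + 1))}
    (hq'0 : q' 0 = 0) (hq' : ∀ i : Fin k, q' i.succ = (q i).succ) (a s : ℕ) (X U : Type)
    [LinearOrder X] [LinearOrder U] [Finite X] [Finite U] :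
    Nat.card (Stage a q' X U) * ((a + s).choose a ^ 2 * avoiders s q) ≤
      Nat.card (Stage a q' (X ⊕ₗ Fin (a + s)) (Fin (a + s) ⊕ₗ U)) := by
  let φ : Stage a q' X U × ((Shuffle a s × Shuffle a s) × {w : Equiv.Perm (Fin s) //
      PermAvoids w q}) → Stage a q' (X ⊕ₗ Fin (a + s)) (Fin (a + s) ⊕ₗ U) :=
    fun t => ⟨extend t.1.1 t.2.2.1 t.2.1.1.1 t.2.1.2.1,
      not_equivContains_extend hk hq0 hq'0 hq' t.1.2.1 t.1.2.2 t.2.2.2 t.2.1.1.2.1 t.2.1.1.2.2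
        t.2.1.2.2.1 t.2.1.2.2.2, extend_symm_strictAnti t.2.1.1.2.1⟩
  have hφ : Function.Injective φ := by
    rintro ⟨p, ⟨α, β⟩, w⟩ ⟨p', ⟨α', β'⟩, w'⟩ h
    obtain ⟨h1, h2, h3, h4⟩ := extend_inj p.2.2 p'.2.2 α.2.2 α'.2.2 β.2.2 β'.2.2
      (congrArg Subtype.val h)
    exact Prod.ext (Subtype.ext h1) (Prod.ext (Prod.ext (Subtype.ext h3) (Subtype.ext h4))
      (Subtype.ext h2))
  have : Finite (X ⊕ₗ Fin (a + s)) := inferInstanceAs (Finite (X ⊕ Fin (a + s)))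
  have : Finite (Fin (a + s) ⊕ₗ U) := inferInstanceAs (Finite (Fin (a + s) ⊕ U))
  have : Finite (Fin a ⊕ₗ (Fin (a + s) ⊕ₗ U)) :=
    inferInstanceAs (Finite (Fin a ⊕ (Fin (a + s) ⊕ₗ U)))
  have := Nat.card_le_card_of_injective φ hφ
  rw [Nat.card_prod, Nat.card_prod, Nat.card_prod, ← pow_two] at this
  refine le_trans ?_ this
  gcongr
  · exact choose_le_card_shuffle a s
  · exact le_rfl

theorem exists_stage {k : ℕ} (hk : 0 < k) {q : Equiv.Perm (Fin k)}
    (hq0 : ∀ i, q ⟨0, hk⟩ ≤ q i) {q' : Equiv.Perm (Fin (k + 1))}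
    (hq'0 : q' 0 = 0) (hq' : ∀ i : Fin k, q' i.succ = (q i).succ) (a b s t : ℕ) :
    ∃ (X U : Type) (_ : LinearOrder X) (_ : LinearOrder U), Nat.card X = a + b + t * (a + s) ∧
      Nat.card U = b + t * (a + s) ∧ Finite X ∧ Finite U ∧
      ((a + s).choose a ^ 2 * avoiders s q) ^ t ≤ Nat.card (Stage a q' X U) := by
  induction t with
  | zero =>
    refine ⟨(Fin a ⊕ₗ Fin b)ᵒᵈ, Fin b, inferInstance, inferInstance, ?_, by simp, ?_,
      inferInstance, ?_⟩
    · change Nat.card (Fin a ⊕ Fin b) = _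
      simp
    · exact inferInstanceAs (Finite (Fin a ⊕ Fin b))
    · have : Finite (Fin a ⊕ₗ Fin b) := inferInstanceAs (Finite (Fin a ⊕ Fin b))
      have : Finite (Fin a ⊕ₗ Fin b)ᵒᵈ := inferInstanceAs (Finite (Fin a ⊕ Fin b))
      rw [pow_zero, Nat.one_le_iff_ne_zero, Nat.card_ne_zero]
      refine ⟨⟨OrderDual.ofDual, ?_, ?_⟩, inferInstance⟩
      · rintro ⟨f, hf, hfq⟩
        have h1 := hf (Fin.succ_pos ⟨0, hk⟩)
        have h2 := (hfq 0 (Fin.succ ⟨0, hk⟩)).2 (by rw [hq'0, hq']; exact Fin.succ_pos _)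
        exact lt_asymm h1 h2
      · intro i j hij
        exact Sum.Lex.inl_lt_inl_iff.2 hij
  | succ t ih =>
    obtain ⟨X, U, _, _, hX, hU, _, _, h⟩ := ih
    refine ⟨X ⊕ₗ Fin (a + s), Fin (a + s) ⊕ₗ U, inferInstance, inferInstance, ?_, ?_,
      inferInstanceAs (Finite (X ⊕ Fin (a + s))), inferInstanceAs (Finite (Fin (a + s) ⊕ U)), ?_⟩
    · change Nat.card (X ⊕ Fin (a + s)) = _
      rw [Nat.card_sum, hX, Nat.card_fin]
      ring
    · change Nat.card (Fin (a + s) ⊕ U) = _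
      rw [Nat.card_sum, hU, Nat.card_fin]
      ring
    · rw [pow_succ]
      exact (Nat.mul_le_mul_right _ h).trans (card_stage_mul_le hk hq0 hq'0 hq' a s X U)

theorem pow_le_avoiders_prepend {k : ℕ} (hk : 0 < k) {q : Equiv.Perm (Fin k)}
    (hq0 : ∀ i, q ⟨0, hk⟩ ≤ q i) {q' : Equiv.Perm (Fin (k + 1))}
    (hq'0 : q' 0 = 0) (hq' : ∀ i : Fin k, q' i.succ = (q i).succ) (a b s t : ℕ) :
    ((a + s).choose a ^ 2 * avoiders s q) ^ t ≤ avoiders (a + b + t * (a + s)) q' := by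
  obtain ⟨X, U, _, _, hX, hU, _, _, h⟩ := exists_stage hk hq0 hq'0 hq' a b s t
  have := Fintype.ofFinite X
  have : Fintype (Fin a ⊕ₗ U) := Fintype.ofFinite (Fin a ⊕ U)
  have hXU : Nat.card (Fin a ⊕ₗ U) = a + b + t * (a + s) := by
    change Nat.card (Fin a ⊕ U) = _
    rw [Nat.card_sum, hU, Nat.card_fin]
    ring
  rw [Nat.card_eq_fintype_card] at hX hXU
  rw [← card_avoiding_equiv q' hX hXU]
  exact h.trans (Nat.card_le_card_of_injective
    (fun p => (⟨p.1, p.2.1⟩ : {e : X ≃ Fin a ⊕ₗ U // ¬ EquivContains e q'}))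
    fun p p' h => Subtype.ext (Subtype.mk.inj h))

theorem avoiders_pos {k : ℕ} (hk0 : 0 < k) (hk : 2 ≤ k) {q : Equiv.Perm (Fin k)}
    (hq0 : ∀ i, q ⟨0, hk0⟩ ≤ q i) (n : ℕ) : 0 < avoiders n q := by
  refine Nat.card_pos_iff.2 ⟨⟨Fin.revPerm, ?_⟩, inferInstance⟩
  rintro ⟨f, hf, hfq⟩
  have h01 : (⟨0, hk0⟩ : Fin k) < ⟨1, hk⟩ := Fin.mk_lt_mk.2 one_pos
  have h1 := (hfq _ _).2 ((hq0 ⟨1, hk⟩).lt_of_ne fun h => h01.ne (q.injective h))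
  simp only [Fin.revPerm_apply, Fin.rev_lt_rev] at h1
  exact lt_asymm h1 (hf h01)

open Filter Topology

theorem exists_forall_le_mul_of_eventually_le {u v : ℕ → ℝ} (hv : ∀ n, 0 < v n)
    (hu : ∀ n, 0 ≤ u n) (h : ∀ᶠ n in atTop, u n ≤ v n) : ∃ K > 0, ∀ n, u n ≤ K * v n := by
  obtain ⟨N, hN⟩ := eventually_atTop.1 h
  have hnn : ∀ i, 0 ≤ u i / v i := fun i => div_nonneg (hu i) (hv i).le
  have hS := Finset.sum_nonneg fun i (_ : i ∈ Finset.range N) => hnn i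
  refine ⟨1 + ∑ i ∈ Finset.range N, u i / v i, by linarith, fun n => ?_⟩
  rcases lt_or_ge n N with hn | hn
  · rw [← div_le_iff₀ (hv n)]
    have := Finset.single_le_sum (fun i _ => hnn i) (Finset.mem_range.2 hn)
    linarith
  · have := mul_nonneg hS (hv n).le
    linarith [hN n hn]

theorem tendsto_root_const_mul_pow {K r : ℝ} (hK : 0 < K) (hr : 0 < r) :
    Tendsto (fun n : ℕ => (K * r ^ n) ^ (1 / (n : ℝ))) atTop (𝓝 r) := by
  have h : Tendsto (fun n : ℕ => K ^ (1 / (n : ℝ)) * r) atTop (𝓝 (K ^ (0 : ℝ) * r)) :=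
    ((tendsto_const_nhds.rpow (tendsto_const_div_atTop_nhds_zero_nat 1)
      (Or.inl hK.ne')).mul_const r)
  rw [Real.rpow_zero, one_mul] at h
  refine h.congr' ?_
  filter_upwards [eventually_ge_atTop 1] with n hn
  rw [Real.mul_rpow hK.le (by positivity), one_div, Real.pow_rpow_inv_natCast hr.le (by omega)]

theorem eventually_root_lt {A : ℕ → ℝ} (hA : ∀ n, 0 ≤ A n) {K r y : ℝ} (hK : 0 < K) (hr : 0 < r)
    (hry : r < y) (h : ∀ᶠ n in atTop, A n ≤ K * r ^ n) :
    ∀ᶠ n : ℕ in atTop, A n ^ (1 / (n : ℝ)) < y := by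
  filter_upwards [(tendsto_root_const_mul_pow hK hr).eventually_lt_const hry, h] with n h1 h2
  exact (Real.rpow_le_rpow (hA n) h2 (by positivity)).trans_lt h1

theorem eventually_lt_root {A : ℕ → ℝ} {K r y : ℝ} (hK : 0 < K) (hr : 0 < r)
    (hry : y < r) (h : ∀ᶠ n in atTop, K * r ^ n ≤ A n) :
    ∀ᶠ n : ℕ in atTop, y < A n ^ (1 / (n : ℝ)) := by
  filter_upwards [(tendsto_root_const_mul_pow hK hr).eventually_const_lt hry, h] with n h1 h2
  exact h1.trans_le (Real.rpow_le_rpow (by positivity) h2 (by positivity))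

theorem sum_choose_mul_sqrt_pow (ℓ : ℝ) (n : ℕ) :
    ∑ i ∈ Finset.range (n + 1), (n.choose i : ℝ) * √ℓ ^ (n - i) = (1 + √ℓ) ^ n := by
  rw [add_pow]
  refine Finset.sum_congr rfl fun i _ => ?_
  ring

theorem sq_choose_mul_sqrt_pow {ℓ : ℝ} (hℓ : 0 ≤ ℓ) (n i : ℕ) :
    ((n.choose i : ℝ) * √ℓ ^ (n - i)) ^ 2 = (n.choose i : ℝ) ^ 2 * ℓ ^ (n - i) := by
  rw [mul_pow, ← pow_mul, mul_comm (n - i), pow_mul, Real.sq_sqrt hℓ]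

theorem sum_choose_sq_le {a : ℕ → ℝ} {K ℓ : ℝ} (hK : 0 ≤ K) (hℓ : 0 ≤ ℓ)
    (ha : ∀ n, a n ≤ K * ℓ ^ n) (n : ℕ) :
    ∑ i ∈ Finset.range (n + 1), (n.choose i : ℝ) ^ 2 * a (n - i) ≤ K * ((1 + √ℓ) ^ 2) ^ n := by
  calc ∑ i ∈ Finset.range (n + 1), (n.choose i : ℝ) ^ 2 * a (n - i)
      ≤ ∑ i ∈ Finset.range (n + 1), K * ((n.choose i : ℝ) * √ℓ ^ (n - i)) ^ 2 := by
        refine Finset.sum_le_sum fun i _ => ?_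
        rw [sq_choose_mul_sqrt_pow hℓ, mul_left_comm]
        exact mul_le_mul_of_nonneg_left (ha _) (by positivity)
    _ ≤ K * (∑ i ∈ Finset.range (n + 1), (n.choose i : ℝ) * √ℓ ^ (n - i)) ^ 2 := by
        rw [← Finset.mul_sum]
        refine mul_le_mul_of_nonneg_left ?_ hK
        rw [sq (∑ i ∈ Finset.range (n + 1), (n.choose i : ℝ) * √ℓ ^ (n - i)), Finset.sum_mul]
        refine Finset.sum_le_sum fun i hi => ?_
        rw [sq]
        exact mul_le_mul_of_nonneg_left (Finset.single_le_sum
          (f := fun i => (n.choose i : ℝ) * √ℓ ^ (n - i)) (fun i _ => by positivity) hi)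
          (by positivity)
    _ = K * ((1 + √ℓ) ^ 2) ^ n := by
        rw [sum_choose_mul_sqrt_pow, ← pow_mul, ← pow_mul, mul_comm n]

theorem exists_pow_le_choose_sq_mul {a : ℕ → ℝ} {K ℓ r : ℝ} (hK : 0 < K) (hℓ : 0 ≤ ℓ)
    (ha : ∀ n, ℓ ^ n ≤ K * a n) (hr : 0 < r) (hrℓ : r < (1 + √ℓ) ^ 2) :
    ∃ i s : ℕ, 0 < i + s ∧ r ^ (i + s) ≤ ((i + s).choose i : ℝ) ^ 2 * a s := by
  have hR : 0 < (1 + √ℓ) ^ 2 := hr.trans hrℓ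
  have hlim := tendsto_pow_const_mul_const_pow_of_abs_lt_one 2
    (r := r / (1 + √ℓ) ^ 2) (by rwa [abs_of_pos (by positivity), div_lt_one hR])
  obtain ⟨n, hn, hn1⟩ := ((hlim.eventually_lt_const (u := 1 / (4 * K)) (by positivity)).and
    (eventually_ge_atTop 1)).exists
  obtain ⟨i, hi, hle⟩ : ∃ i ∈ Finset.range (n + 1),
      (1 + √ℓ) ^ n / (n + 1) ≤ (n.choose i : ℝ) * √ℓ ^ (n - i) := by
    refine Finset.exists_le_of_sum_le ⟨0, by simp⟩ ?_
    rw [sum_choose_mul_sqrt_pow, Finset.sum_const, Finset.card_range, nsmul_eq_mul]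
    push_cast
    rw [mul_div_cancel₀ _ (by positivity)]
  have hin : i + (n - i) = n := by
    have := Finset.mem_range.1 hi
    omega
  refine ⟨i, n - i, by omega, ?_⟩
  rw [hin]
  have hsq : ((1 + √ℓ) ^ n / (n + 1)) ^ 2 ≤ (n.choose i : ℝ) ^ 2 * (K * a (n - i)) :=
    (pow_le_pow_left₀ (by positivity) hle 2).trans (by
      rw [sq_choose_mul_sqrt_pow hℓ]
      exact mul_le_mul_of_nonneg_left (ha _) (by positivity))
  have hn1' : (1 : ℝ) ≤ n := by exact_mod_cast hn1
  rw [div_pow, ← pow_mul, mul_comm n, pow_mul, div_le_iff₀ (by positivity)] at hsq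
  rw [div_pow, ← mul_div_assoc, div_lt_div_iff₀ (by positivity) (by positivity)] at hn
  have h4 : ((n : ℝ) + 1) ^ 2 ≤ 4 * n ^ 2 := by nlinarith
  have hpos : 0 ≤ (n.choose i : ℝ) ^ 2 * (K * a (n - i)) := by
    have := (pow_nonneg hℓ _).trans (ha (n - i))
    positivity
  have h5 := hsq.trans (mul_le_mul_of_nonneg_left h4 hpos)
  have h6 : (4 * K * n ^ 2) * r ^ n ≤ (4 * K * n ^ 2) * ((n.choose i : ℝ) ^ 2 * a (n - i)) := by
    linarith
  exact le_of_mul_le_mul_left h6 (by positivity)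

theorem mul_pow_le_of_blocks {A : ℕ → ℝ} {r : ℝ} {i n : ℕ} (hr : 1 ≤ r) (hn : 0 < n)
    (h : ∀ b t, (r ^ n) ^ t ≤ A (i + b + t * n)) :
    ∀ᶠ N in atTop, (r ^ (i + n))⁻¹ * r ^ N ≤ A N := by
  filter_upwards [eventually_ge_atTop i] with N hN
  have hN' : i + (N - i) % n + (N - i) / n * n = N := by
    have := Nat.mod_add_div' (N - i) n
    omega
  have h1 := h ((N - i) % n) ((N - i) / n)
  rw [hN'] at h1
  refine le_trans ?_ h1
  rw [inv_mul_le_iff₀ (by positivity), ← pow_mul, ← pow_add]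
  refine pow_le_pow_right₀ hr ?_
  have := Nat.mod_lt (N - i) hn
  rw [mul_comm] at hN'
  omega

/-- If `q` has length `k ≥ 2` and starts with its smallest entry, `q'` is obtained from
`q` by adding 1 to each entry and prepending the entry 1, and `(S_n(q))^{1/n} → L`,
then `(S_n(q'))^{1/n} → 1 + L + 2√L`. -/
theorem stanley_wilf_limit_prepend {k : ℕ} (hk : 2 ≤ k)
    (q : Equiv.Perm (Fin k)) (hq0 : (q ⟨0, by omega⟩ : ℕ) = 0)
    (q' : Equiv.Perm (Fin (k + 1)))
    (hq'0 : q' 0 = 0) (hq' : ∀ i : Fin k, q' i.succ = (q i).succ)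
    (L : ℝ)
    (hL : Filter.Tendsto (fun n : ℕ => (avoiders n q : ℝ) ^ (1 / (n : ℝ)))
      Filter.atTop (nhds L)) :
    Filter.Tendsto (fun n : ℕ => (avoiders n q' : ℝ) ^ (1 / (n : ℝ)))
      Filter.atTop (nhds (1 + L + 2 * Real.sqrt L)) := by
  have hk0 : 0 < k := by omega
  have hq0' : ∀ i, q ⟨0, hk0⟩ ≤ q i := fun i => Fin.le_def.2 (by omega)
  have hpos : ∀ n, (0 : ℝ) < avoiders n q := fun n => by exact_mod_cast avoiders_pos hk0 hk hq0' n
  have hroot : ∀ n : ℕ, n ≠ 0 → ((avoiders n q : ℝ) ^ (1 / (n : ℝ))) ^ n = avoiders n q := by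
    intro n hn
    rw [one_div, Real.rpow_inv_natCast_pow (hpos n).le hn]
  have hL1 : 1 ≤ L := by
    refine ge_of_tendsto' hL fun n => Real.one_le_rpow ?_ (by positivity)
    exact_mod_cast avoiders_pos hk0 hk hq0' n
  have hlim : 1 + L + 2 * √L = (1 + √L) ^ 2 := by
    have := Real.sq_sqrt (zero_le_one.trans hL1)
    linear_combination -this
  have hcont : Continuous fun ℓ : ℝ => (1 + √ℓ) ^ 2 := by fun_prop
  rw [hlim]
  refine tendsto_order.2 ⟨fun y hy => ?_, fun y hy => ?_⟩
  · have h1 : 1 < (1 + √L) ^ 2 := by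
      have := Real.sqrt_pos.2 (zero_lt_one.trans_le hL1)
      nlinarith
    obtain ⟨r, hyr, hrL⟩ := exists_between (max_lt hy h1)
    obtain ⟨hyr, h1r⟩ := max_lt_iff.1 hyr
    obtain ⟨ℓ, hℓ, hℓL⟩ := ((((hcont.tendsto L).eventually_const_lt hrL).and
      (eventually_gt_nhds (zero_lt_one.trans_le hL1))).filter_mono
      nhdsWithin_le_nhds |>.and (self_mem_nhdsWithin (s := Set.Iio L))).exists
    obtain ⟨K, hK, hKa⟩ := exists_forall_le_mul_of_eventually_le hpos
      (fun n => pow_nonneg hℓ.2.le n) (by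
        filter_upwards [hL.eventually_const_lt hℓL, eventually_ne_atTop 0] with n h1 h2
        rw [← hroot n h2]
        exact pow_le_pow_left₀ hℓ.2.le h1.le n)
    obtain ⟨i, s, his, hle⟩ := exists_pow_le_choose_sq_mul hK hℓ.2.le hKa
      (zero_lt_one.trans h1r) hℓ.1
    have hr0 := zero_lt_one.trans h1r
    refine eventually_lt_root (K := (r ^ (i + (i + s)))⁻¹) (by positivity) hr0 hyr
      (mul_pow_le_of_blocks h1r.le his fun b t => ?_)
    refine (pow_le_pow_left₀ (by positivity) hle t).trans ?_
    exact_mod_cast pow_le_avoiders_prepend hk0 hq0' hq'0 hq' i b s t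
  · obtain ⟨ℓ, hℓ, hℓL⟩ := (((hcont.tendsto L).eventually_lt_const hy).filter_mono
      nhdsWithin_le_nhds |>.and (self_mem_nhdsWithin (s := Set.Ioi L))).exists
    have hℓ0 : 0 < ℓ := (zero_lt_one.trans_le hL1).trans hℓL
    obtain ⟨K, hK, hKa⟩ := exists_forall_le_mul_of_eventually_le
      (fun n => pow_pos hℓ0 n) (fun n => (hpos n).le) (by
        filter_upwards [hL.eventually_lt_const hℓL, eventually_ne_atTop 0] with n h1 h2
        rw [← hroot n h2]
        exact pow_le_pow_left₀ (by positivity) h1.le n)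
    refine eventually_root_lt (fun n => Nat.cast_nonneg _) hK (r := (1 + √ℓ) ^ 2)
      (by positivity) hℓ (Eventually.of_forall fun n => ?_)
    refine le_trans ?_ (sum_choose_sq_le hK.le hℓ0.le hKa n)
    exact_mod_cast avoiders_prepend_le hk0 hq0' hq'0 hq' n
end
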